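/- Let f ∈ L log L(𝕋²) and for n ≥ 1 define I^{(2)}_n(x,y,f) = p.v. (1/2π)∫_𝕋 [cos(nu)/(2 tan(u/2))] · ( p.v. (1/π)∫_𝕋 f(x+ν, y+ν−u)/(2 tan(ν/2)) dν ) du. Then there is an absolute constant c > 0 such that for every λ > 0, |{(x,y) ∈ 𝕋² : bmo[I^{(2)}_n(x,y,f)] > λ}| ≤ (c/λ)·(1 + ∬_{𝕋²} |f| log⁺|f|). -/

import Mathlib

open MeasureTheory Filter Set

noncomputable section

/-- `[-π, π)`, a fundamental domain for the circle `𝕋 = ℝ/2πℤ`. -/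
def T1 : Set ℝ := Set.Ico (-Real.pi) Real.pi

/-- `[-π, π)²`, a fundamental domain for the torus `𝕋²`. -/
def T2 : Set (ℝ × ℝ) := T1 ×ˢ T1

/-- `log⁺ u = log u` for `u > 1`, and `0` otherwise. -/
def logPlus (u : ℝ) : ℝ := if 1 < u then Real.log u else 0

/-- `f` is `2π`-periodic in each variable. -/
def Biperiodic (f : ℝ × ℝ → ℝ) : Prop :=
  ∀ x y : ℝ, f (x + 2 * Real.pi, y) = f (x, y) ∧ f (x, y + 2 * Real.pi) = f (x, y)

/-- Fourier coefficients `f̂(m,n)` of a function on `𝕋²`. -/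
def fourierCoef2 (f : ℝ × ℝ → ℝ) (m n : ℤ) : ℂ :=
  (1 / (4 * (Real.pi : ℂ) ^ 2)) *
    ∫ p in T2, (f p : ℂ) * Complex.exp (-Complex.I * ((m : ℂ) * (p.1 : ℂ) + (n : ℂ) * (p.2 : ℂ)))

/-- Quadratic partial sums `S_{nn}(x, y, f)` of the double Fourier series.
(For real `f` the symmetric sum is real, so we take the real part.) -/
def Snn (f : ℝ × ℝ → ℝ) (n : ℕ) (x y : ℝ) : ℝ :=
  (∑ m ∈ Finset.Icc (-(n : ℤ)) (n : ℤ), ∑ k ∈ Finset.Icc (-(n : ℤ)) (n : ℤ),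
    fourierCoef2 f m k * Complex.exp (Complex.I * ((m : ℂ) * (x : ℂ) + (k : ℂ) * (y : ℂ)))).re

/-- The `BMO[0,1]` norm:
`‖g‖_BMO = sup_{I ⊂ [0,1]} (1/|I|) ∫_I |g - g_I| + |∫_0^1 g|`. -/
def bmoNorm (g : ℝ → ℝ) : ℝ :=
  (⨆ I : {p : ℝ × ℝ // 0 ≤ p.1 ∧ p.1 < p.2 ∧ p.2 ≤ 1},
      (I.1.2 - I.1.1)⁻¹ *
        ∫ t in Set.Icc I.1.1 I.1.2,
          |g t - (I.1.2 - I.1.1)⁻¹ * ∫ s in Set.Icc I.1.1 I.1.2, g s|) +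
    |∫ t in Set.Icc (0 : ℝ) 1, g t|

/-- The step function `Σ_{k=0}^n ξ_k 𝟙_{δ_k^n}` with `δ_k^n = [k/(n+1), (k+1)/(n+1)]`. -/
def stepFun (ξ : ℕ → ℝ) (n : ℕ) (t : ℝ) : ℝ :=
  ∑ k ∈ Finset.range (n + 1),
    Set.indicator (Set.Icc ((k : ℝ) / ((n : ℝ) + 1)) (((k : ℝ) + 1) / ((n : ℝ) + 1)))
      (fun _ => ξ k) t

/-- `bmo[ξ_n] = sup_{n ≥ 0} ‖Σ_{k=0}^n ξ_k 𝟙_{δ_k^n}‖_BMO`. -/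
def bmoSeq (ξ : ℕ → ℝ) : ℝ := ⨆ n : ℕ, bmoNorm (stepFun ξ n)

/-- `L` is the principal value `p.v. ∫_𝕋 g`, i.e. the limit as `ε → 0⁺` of the
integrals over `{ε < |t| < π}`. -/
def pvT1 (g : ℝ → ℝ) (L : ℝ) : Prop :=
  Filter.Tendsto (fun ε : ℝ => ∫ t in {t : ℝ | ε < |t| ∧ |t| < Real.pi}, g t)
    (nhdsWithin 0 (Set.Ioi 0)) (nhds L)

/-- `L` is the two-dimensional principal value `p.v. ∬_{𝕋²} g`, the limit as `ε → 0⁺`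
of the integrals over `{ε < |t| < π, ε < |s| < π}`. -/
def pvT2 (g : ℝ × ℝ → ℝ) (L : ℝ) : Prop :=
  Filter.Tendsto
    (fun ε : ℝ =>
      ∫ q in {q : ℝ × ℝ | (ε < |q.1| ∧ |q.1| < Real.pi) ∧ ε < |q.2| ∧ |q.2| < Real.pi}, g q)
    (nhdsWithin 0 (Set.Ioi 0)) (nhds L)

/-- Luxemburg norm with respect to a Young function `M`. -/
def luxNorm {α : Type*} [MeasurableSpace α] (μ : Measure α) (M : ℝ → ℝ) (g : α → ℝ) : ℝ :=
  sInf {lam : ℝ | 0 < lam ∧ ∫⁻ x, ENNReal.ofReal (M (|g x| / lam)) ∂μ ≤ 1}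

/-- The Young function `Φ(t) = t log⁺ t`. -/
def PhiY (t : ℝ) : ℝ := t * logPlus t

/-- The Young function `Ψ(t) = eᵗ - 1`. -/
def PsiY (t : ℝ) : ℝ := Real.exp t - 1

open scoped ENNReal Topology

theorem kap_aux (ε m : ℝ) (hε : 0 < ε) (hm : 0 < m) :
    ∫⁻ t in Ioi m, ENNReal.ofReal (2 * ε / t ^ 3) = ENNReal.ofReal (ε / m ^ 2) := by
  have hd : ∀ x ∈ Ici m, HasDerivAt (fun t : ℝ => -(ε / t ^ 2)) (2 * ε / x ^ 3) x := by
    intro x hx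
    have hx0 : (0 : ℝ) < x := lt_of_lt_of_le hm hx
    have h1 := ((hasDerivAt_pow 2 x).inv (by positivity)).const_mul (-ε)
    refine (h1.congr_deriv ?_).congr_of_eventuallyEq (Eventually.of_forall fun t => ?_)
    · push_cast
      field_simp
    · simp [div_eq_mul_inv]
  have hnn : ∀ x ∈ Ioi m, 0 ≤ 2 * ε / x ^ 3 := by
    intro x hx
    have : (0 : ℝ) < x := hm.trans hx
    positivity
  have hl : Tendsto (fun t : ℝ => -(ε / t ^ 2)) atTop (𝓝 0) := by
    have : Tendsto (fun t : ℝ => ε / t ^ 2) atTop (𝓝 0) :=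
      Tendsto.const_div_atTop (tendsto_pow_atTop (by norm_num)) ε
    simpa using this.neg
  have hi := integrableOn_Ioi_deriv_of_nonneg' hd hnn hl
  have he := integral_Ioi_of_hasDerivAt_of_nonneg' hd hnn hl
  rw [← ofReal_integral_eq_lintegral_ofReal hi
    ((ae_restrict_iff' measurableSet_Ioi).2 (Eventually.of_forall hnn)), he]
  simp

theorem kap_lintegral (φ : ℝ → ℝ≥0∞) (hφ : Measurable φ) (ε : ℝ) (hε : 0 < ε) :
    ∫⁻ u, ENNReal.ofReal (ε / (max ε |u|) ^ 2) * φ u =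
      ∫⁻ t in Ioi ε, ENNReal.ofReal (2 * ε / t ^ 3) * ∫⁻ u in {u | |u| < t}, φ u := by
  have h1 : ∀ u : ℝ, ENNReal.ofReal (ε / (max ε |u|) ^ 2) * φ u =
      ∫⁻ t in Ioi ε, ENNReal.ofReal (2 * ε / t ^ 3) * ({u : ℝ | |u| < t}.indicator φ u) := by
    intro u
    rw [← kap_aux ε _ hε (lt_max_of_lt_left hε), ← lintegral_mul_const _ (by fun_prop),
      ← lintegral_indicator measurableSet_Ioi, ← lintegral_indicator measurableSet_Ioi]
    congr 1
    ext t
    simp only [indicator, mem_Ioi, max_lt_iff, mem_ofPred_eq]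
    by_cases h1 : ε < t <;> by_cases h2 : |u| < t <;> simp [h1, h2]
  simp_rw [h1]
  rw [lintegral_lintegral_swap]
  · refine lintegral_congr fun t => ?_
    rw [lintegral_const_mul _ (hφ.indicator (measurableSet_lt (by fun_prop) (by fun_prop))),
      lintegral_indicator (measurableSet_lt (by fun_prop) (by fun_prop))]
  · refine Measurable.aemeasurable ?_
    refine Measurable.mul (by fun_prop) ?_
    have : (Function.uncurry fun (u t : ℝ) => ({u : ℝ | |u| < t}.indicator φ u)) =
        {p : ℝ × ℝ | |p.1| < p.2}.indicator (fun p => φ p.1) := by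
      ext p; simp [Function.uncurry, indicator]
    have h2 := (hφ.comp measurable_fst).indicator (s := {p : ℝ × ℝ | |p.1| < p.2})
      (measurableSet_lt (by fun_prop) (by fun_prop))
    rw [← Function.comp_def φ, ← this] at *
    exact h2

theorem kap_bound (φ : ℝ → ℝ≥0∞) (hφ : Measurable φ) (ε : ℝ) (hε : 0 < ε) (A : ℝ≥0∞)
    (h : ∀ t, ε ≤ t → ∫⁻ u in {u | |u| < t}, φ u ≤ ENNReal.ofReal t * A) :
    ∫⁻ u, ENNReal.ofReal (ε / (max ε |u|) ^ 2) * φ u ≤ 2 * A := by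
  rw [kap_lintegral φ hφ ε hε]
  have hd : ∀ x ∈ Ici ε, HasDerivAt (fun t : ℝ => -(2 * ε / t)) (2 * ε / x ^ 2) x := by
    intro x hx
    have hx0 : (0 : ℝ) < x := lt_of_lt_of_le hε hx
    have h1 := (hasDerivAt_inv hx0.ne').const_mul (-(2 * ε))
    refine (h1.congr_deriv ?_).congr_of_eventuallyEq (Eventually.of_forall fun t => ?_)
    · field_simp
    · simp [div_eq_mul_inv]
  have hnn : ∀ x ∈ Ioi ε, 0 ≤ 2 * ε / x ^ 2 := by
    intro x hx
    have : (0 : ℝ) < x := hε.trans hx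
    positivity
  have hl : Tendsto (fun t : ℝ => -(2 * ε / t)) atTop (𝓝 0) := by
    have : Tendsto (fun t : ℝ => 2 * ε / t) atTop (𝓝 0) :=
      Tendsto.const_div_atTop tendsto_id (2 * ε)
    simpa using this.neg
  have hi := integrableOn_Ioi_deriv_of_nonneg' hd hnn hl
  have he := integral_Ioi_of_hasDerivAt_of_nonneg' hd hnn hl
  have hv : ∫⁻ t in Ioi ε, ENNReal.ofReal (2 * ε / t ^ 2) = 2 := by
    rw [← ofReal_integral_eq_lintegral_ofReal hi
      ((ae_restrict_iff' measurableSet_Ioi).2 (Eventually.of_forall hnn)), he]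
    have : (0 : ℝ) - -(2 * ε / ε) = 2 := by field_simp; ring
    rw [this]; simp
  calc ∫⁻ t in Ioi ε, ENNReal.ofReal (2 * ε / t ^ 3) * ∫⁻ u in {u | |u| < t}, φ u
      ≤ ∫⁻ t in Ioi ε, ENNReal.ofReal (2 * ε / t ^ 2) * A := by
        refine setLIntegral_mono' measurableSet_Ioi fun t ht => ?_
        have ht0 : (0 : ℝ) < t := hε.trans ht
        refine (mul_le_mul_right (h t (le_of_lt ht)) _).trans ?_
        rw [← mul_assoc, ← ENNReal.ofReal_mul (by positivity)]
        refine mul_le_mul_left (ENNReal.ofReal_le_ofReal (le_of_eq ?_)) _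
        field_simp
    _ = 2 * A := by rw [lintegral_mul_const _ (by fun_prop), hv]

theorem hl_weak (φ : ℝ → ℝ≥0∞) (A : ℝ) (hA : 0 < A) :
    volume {y : ℝ | ∃ t > 0, ENNReal.ofReal (t * A) < ∫⁻ u in Metric.closedBall y t, φ u} ≤
      ENNReal.ofReal (8 / A) * ∫⁻ u, φ u := by
  by_cases htop : ∫⁻ u, φ u = ⊤
  · rw [htop, ENNReal.mul_top (by simp; positivity)]; exact le_top
  set s : Set (ℝ × ℝ) := {p | 0 < p.2 ∧
    ENNReal.ofReal (p.2 * A) < ∫⁻ u in Metric.closedBall p.1 p.2, φ u} with hs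
  obtain ⟨u, hus, hdis, hcov⟩ := Vitali.exists_disjoint_subfamily_covering_enlargement_closedBall
    s (fun p => p.1) (fun p => p.2) ((∫⁻ u, φ u).toReal / A) (by
      rintro p ⟨hp, hp2⟩
      rw [le_div_iff₀ hA]
      have := (ENNReal.ofReal_lt_iff_lt_toReal (by positivity) (ne_top_of_le_ne_top htop
        (setLIntegral_le_lintegral _ _))).1 hp2
      exact this.le.trans (ENNReal.toReal_mono htop (setLIntegral_le_lintegral _ _))) 4 (by norm_num)
  have hc : u.Countable := by
    refine hdis.countable_of_nonempty_interior fun p hp => ?_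
    rw [interior_closedBall _ (hus hp).1.ne']
    exact Metric.nonempty_ball.2 (hus hp).1
  calc volume {y : ℝ | ∃ t > 0, ENNReal.ofReal (t * A) < ∫⁻ u in Metric.closedBall y t, φ u}
      ≤ volume (⋃ p ∈ u, Metric.closedBall p.1 (4 * p.2)) := by
        refine measure_mono ?_
        rintro y ⟨t, ht, hy⟩
        obtain ⟨b, hb, hb2⟩ := hcov (y, t) ⟨ht, hy⟩
        simp only [mem_iUnion]
        exact ⟨b, hb, hb2 (Metric.mem_closedBall_self ht.le)⟩
    _ ≤ ∑' p : u, volume (Metric.closedBall p.1.1 (4 * p.1.2)) := measure_biUnion_le _ hc _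
    _ ≤ ∑' p : u, ENNReal.ofReal (8 / A) * ∫⁻ x in Metric.closedBall p.1.1 p.1.2, φ x := by
        refine ENNReal.tsum_le_tsum fun p => ?_
        have hp := hus p.2
        rw [Real.volume_closedBall]
        calc ENNReal.ofReal (2 * (4 * p.1.2)) = ENNReal.ofReal (8 / A) * ENNReal.ofReal (p.1.2 * A) := by
              rw [← ENNReal.ofReal_mul (by positivity)]; congr 1; field_simp; ring
          _ ≤ _ := mul_le_mul_right hp.2.le _
    _ = ENNReal.ofReal (8 / A) * ∫⁻ x in ⋃ p ∈ u, Metric.closedBall p.1 p.2, φ x := by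
        rw [ENNReal.tsum_mul_left, lintegral_biUnion hc (fun p _ => measurableSet_closedBall) hdis]
    _ ≤ _ := mul_le_mul_right (setLIntegral_le_lintegral _ _) _

theorem gauss_ft (h z : ℝ) (hh : 0 < h) :
    ‖∫ s : ℝ, Complex.exp (Complex.I * z * s) * Complex.exp (-(((h ^ 2)⁻¹ : ℝ) : ℂ) * s ^ 2)‖ ≤
      2 * h * Real.exp (-(h ^ 2 * z ^ 2 / 4)) := by
  rw [fourierIntegral_gaussian (by rw [Complex.ofReal_re]; positivity)]
  rw [norm_mul]
  have h1 : ‖((Real.pi : ℂ) / (((h ^ 2)⁻¹ : ℝ) : ℂ)) ^ (1 / 2 : ℂ)‖ ≤ 2 * h := by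
    rw [← Complex.ofReal_div, Complex.norm_cpow_eq_rpow_re_of_pos (by positivity)]
    have : ((1 / 2 : ℂ)).re = 1 / 2 := by norm_num
    rw [this, ← Real.sqrt_eq_rpow]
    apply Real.sqrt_le_iff.2
    constructor
    · positivity
    · have := Real.pi_le_four
      rw [div_inv_eq_mul]
      nlinarith [sq_nonneg h]
  have h2 : ‖Complex.exp (-(z : ℂ) ^ 2 / (4 * (((h ^ 2)⁻¹ : ℝ) : ℂ)))‖ =
      Real.exp (-(h ^ 2 * z ^ 2 / 4)) := by
    have : (-(z : ℂ) ^ 2 / (4 * (((h ^ 2)⁻¹ : ℝ) : ℂ))) = ((-(h ^ 2 * z ^ 2 / 4) : ℝ) : ℂ) := by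
      push_cast
      field_simp
    rw [this, Complex.norm_exp_ofReal]
  rw [h2]
  gcongr

theorem quad_gauss (ψ : ℝ → ℂ) (hψ : Integrable ψ) (h : ℝ) (hh : 0 < h) :
    ∫⁻ s in Icc 0 h, ‖∫ u : ℝ, Complex.exp (Complex.I * s * u) * ψ u‖ₑ ^ 2 ≤
      ENNReal.ofReal (6 * h) *
        ∫⁻ p : ℝ × ℝ, ‖ψ p.1‖ₑ * ‖ψ p.2‖ₑ * ENNReal.ofReal (Real.exp (-(h ^ 2 * (p.1 - p.2) ^ 2 / 4))) := by
  set Ψ : ℝ → ℂ := fun s => ∫ u : ℝ, Complex.exp (Complex.I * s * u) * ψ u with hΨ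
  set w : ℝ → ℝ := fun s => Real.exp (-((h ^ 2)⁻¹ : ℝ) * s ^ 2) with hw
  have hwi : Integrable w := integrable_exp_neg_mul_sq (by positivity)
  have hψc : Integrable (fun u => (starRingEnd ℂ) (ψ u)) := by
    refine hψ.norm.mono' ?_ (by simp)
    exact Complex.continuous_conj.comp_aestronglyMeasurable hψ.1
  -- the triple function
  set K : ℝ × (ℝ × ℝ) → ℂ := fun q => Complex.exp (Complex.I * q.1 * (q.2.1 - q.2.2)) *
    ((w q.1 : ℂ) * (ψ q.2.1 * (starRingEnd ℂ) (ψ q.2.2))) with hK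
  have hKi : Integrable K (volume.prod (volume.prod volume)) := by
    have h1 : Integrable (fun q : ℝ × (ℝ × ℝ) =>
        (w q.1 : ℂ) * (ψ q.2.1 * (starRingEnd ℂ) (ψ q.2.2))) (volume.prod (volume.prod volume)) :=
      hwi.ofReal.mul_prod (hψ.mul_prod hψc)
    refine h1.bdd_mul (c := 1) ?_ ?_
    · exact (by fun_prop : Continuous fun q : ℝ × (ℝ × ℝ) =>
        Complex.exp (Complex.I * q.1 * (q.2.1 - q.2.2))).aestronglyMeasurable
    · refine Eventually.of_forall fun q => ?_
      have : Complex.I * q.1 * (q.2.1 - q.2.2) = ((q.1 * (q.2.1 - q.2.2) : ℝ) : ℂ) * Complex.I := by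
        push_cast; ring
      rw [this, Complex.norm_exp_ofReal_mul_I]
  have hpt : ∀ s, ∫ p, K (s, p) ∂(volume.prod volume) = ((‖Ψ s‖ ^ 2 * w s : ℝ) : ℂ) := by
    intro s
    have h1 : ∀ p : ℝ × ℝ, K (s, p) = (w s : ℂ) * ((Complex.exp (Complex.I * s * p.1) * ψ p.1) *
        (starRingEnd ℂ) (Complex.exp (Complex.I * s * p.2) * ψ p.2)) := by
      intro p
      have : Complex.exp (Complex.I * s * (p.1 - p.2)) = Complex.exp (Complex.I * s * p.1) *
          (starRingEnd ℂ) (Complex.exp (Complex.I * s * p.2)) := by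
        rw [← Complex.exp_conj, ← Complex.exp_add]
        congr 1
        simp
        ring
      simp only [hK, this, map_mul]
      ring
    simp_rw [h1]
    rw [integral_const_mul, integral_prod_mul (fun u : ℝ => Complex.exp (Complex.I * s * u) * ψ u)
      (fun u : ℝ => (starRingEnd ℂ) (Complex.exp (Complex.I * s * u) * ψ u)), integral_conj]
    change (w s : ℂ) * (Ψ s * (starRingEnd ℂ) (Ψ s)) = _
    rw [Complex.mul_conj, Complex.normSq_eq_norm_sq]
    push_cast; ring
  have hint : Integrable (fun s => ‖Ψ s‖ ^ 2 * w s) := by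
    have h1 := hKi.integral_prod_left
    simp_rw [hpt] at h1
    have h3 := h1.re
    refine h3.congr (Eventually.of_forall fun s => ?_)
    exact Complex.ofReal_re _
  have hval : ((∫ s, ‖Ψ s‖ ^ 2 * w s : ℝ) : ℂ) = ∫ p : ℝ × ℝ, ψ p.1 * (starRingEnd ℂ) (ψ p.2) *
      (∫ s : ℝ, Complex.exp (Complex.I * ((p.1 - p.2 : ℝ) : ℂ) * s) *
        Complex.exp (-(((h ^ 2)⁻¹ : ℝ) : ℂ) * s ^ 2)) := by
    rw [← integral_complex_ofReal]
    have h2 : ∀ s, ((‖Ψ s‖ ^ 2 * w s : ℝ) : ℂ) = ∫ p, K (s, p) ∂(volume.prod volume) :=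
      fun s => (hpt s).symm
    calc ∫ s, ((‖Ψ s‖ ^ 2 * w s : ℝ) : ℂ) = ∫ s, (∫ p, K (s, p) ∂(volume.prod volume)) := by
          simp_rw [h2]
      _ = ∫ p, (∫ s, K (s, p)) ∂(volume.prod volume) := integral_integral_swap hKi
      _ = _ := by
          refine integral_congr_ae (Eventually.of_forall fun p => ?_)
          simp only
          rw [← integral_const_mul]
          refine integral_congr_ae (Eventually.of_forall fun s => ?_)
          simp only [hK, hw]
          push_cast
          ring_nf
  have hle : ‖(∫ s, ‖Ψ s‖ ^ 2 * w s : ℝ)‖ₑ ≤ ENNReal.ofReal (2 * h) *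
        ∫⁻ p : ℝ × ℝ, ‖ψ p.1‖ₑ * ‖ψ p.2‖ₑ *
          ENNReal.ofReal (Real.exp (-(h ^ 2 * (p.1 - p.2) ^ 2 / 4))) := by
    have : ‖(∫ s, ‖Ψ s‖ ^ 2 * w s : ℝ)‖ₑ = ‖((∫ s, ‖Ψ s‖ ^ 2 * w s : ℝ) : ℂ)‖ₑ := by
      rw [← ofReal_norm, ← ofReal_norm, Complex.norm_real]
    rw [this, hval, ← lintegral_const_mul' _ _ ENNReal.ofReal_ne_top]
    refine (enorm_integral_le_lintegral_enorm _).trans ?_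
    refine lintegral_mono fun p => ?_
    have hg := gauss_ft h (p.1 - p.2) hh
    have hg' := ENNReal.ofReal_le_ofReal hg
    rw [ofReal_norm, ENNReal.ofReal_mul (by positivity)] at hg'
    have hc : ‖(starRingEnd ℂ) (ψ p.2)‖ₑ = ‖ψ p.2‖ₑ := by
      rw [← ofReal_norm, ← ofReal_norm, RCLike.norm_conj]
    simp only [enorm_mul, hc]
    calc _ ≤ ‖ψ p.1‖ₑ * ‖ψ p.2‖ₑ * (ENNReal.ofReal (2 * h) *
          ENNReal.ofReal (Real.exp (-(h ^ 2 * (p.1 - p.2) ^ 2 / 4)))) := mul_le_mul_right hg' _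
      _ = _ := by ring
  have hfin : ∫⁻ s in Icc 0 h, ‖Ψ s‖ₑ ^ 2 ≤ ENNReal.ofReal 3 * ‖(∫ s, ‖Ψ s‖ ^ 2 * w s : ℝ)‖ₑ := by
    have hnn : 0 ≤ ∫ s, ‖Ψ s‖ ^ 2 * w s := integral_nonneg fun s => by positivity
    rw [Real.enorm_of_nonneg hnn, ofReal_integral_eq_lintegral_ofReal hint
      (Eventually.of_forall fun s => by positivity), ← lintegral_const_mul' _ _ ENNReal.ofReal_ne_top]
    refine le_trans ?_ (setLIntegral_le_lintegral (Icc 0 h) _)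
    refine setLIntegral_mono' measurableSet_Icc fun s hs => ?_
    rw [← ofReal_norm, ← ENNReal.ofReal_pow (norm_nonneg _), ← ENNReal.ofReal_mul (by norm_num)]
    refine ENNReal.ofReal_le_ofReal ?_
    have hw1 : 1 ≤ 3 * w s := by
      have h1 : Real.exp (-1) ≤ w s := by
        apply Real.exp_le_exp.2
        have : s ^ 2 ≤ h ^ 2 := pow_le_pow_left₀ hs.1 hs.2 2
        have : (h ^ 2)⁻¹ * s ^ 2 ≤ 1 := by
          rw [inv_mul_le_iff₀ (by positivity)]; linarith
        linarith
      have h2 : Real.exp 1 ≤ 3 := Real.exp_one_lt_three.le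
      have h3 : Real.exp (-1) * Real.exp 1 = 1 := by rw [← Real.exp_add]; simp
      nlinarith [Real.exp_pos (-1)]
    nlinarith [sq_nonneg ‖Ψ s‖]
  refine hfin.trans ((mul_le_mul_right hle _).trans (le_of_eq ?_))
  rw [← mul_assoc, ← ENNReal.ofReal_mul (by norm_num)]
  congr 2; ring

theorem gauss_le_kap (ε z : ℝ) (hε : 0 < ε) :
    Real.exp (-((1 / ε) ^ 2 * z ^ 2 / 4)) ≤ 4 * ε * (ε / (max ε |z|) ^ 2) := by
  have hz : z ^ 2 = |z| ^ 2 := (sq_abs z).symm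
  rcases le_total |z| ε with h | h
  · rw [max_eq_left h]
    have : 4 * ε * (ε / ε ^ 2) = 4 := by field_simp
    rw [this]
    have : Real.exp (-((1 / ε) ^ 2 * z ^ 2 / 4)) ≤ 1 := Real.exp_le_one_iff.2 (by
      have : 0 ≤ (1 / ε) ^ 2 * z ^ 2 / 4 := by positivity
      linarith)
    linarith
  · rw [max_eq_right h, hz]
    have hz0 : 0 < |z| := hε.trans_le h
    have h1 := Real.add_one_le_exp ((1 / ε) ^ 2 * |z| ^ 2 / 4)
    rw [Real.exp_neg]
    have h2 : 0 < (1 / ε) ^ 2 * |z| ^ 2 / 4 := by positivity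
    calc (Real.exp ((1 / ε) ^ 2 * |z| ^ 2 / 4))⁻¹ ≤ ((1 / ε) ^ 2 * |z| ^ 2 / 4)⁻¹ :=
          inv_anti₀ h2 (by linarith)
      _ = 4 * ε * (ε / |z| ^ 2) := by field_simp

theorem quad_kernel (φ : ℝ → ℝ≥0∞) (hφ : Measurable φ) (D : ℝ → ℝ) (hD : Measurable D)
    (hD0 : ∀ u, 0 ≤ D u)
    (ε : ℝ) (hε : 0 < ε) (A : ℝ) (hA : 0 < A)
    (h0 : ∀ t, ε ≤ t → ∫⁻ v in {v | |v| < t}, φ v ≤ ENNReal.ofReal t * ENNReal.ofReal A)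
    (h : ∀ u t, ε ≤ t → ∫⁻ v in {v | |v| < t}, φ (u + v) ≤ ENNReal.ofReal ((t + D u) * A))
    (J : ℝ≥0∞) (hJ : ∫⁻ u, φ u * ENNReal.ofReal (D u / u ^ 2) ≤ J)
    (ψ : ℝ → ℝ≥0∞) (hψ : ∀ u, ψ u ≤ {u : ℝ | ε ≤ |u|}.indicator
      (fun u => φ u * ENNReal.ofReal (1 / |u|)) u) :
    ∫⁻ p : ℝ × ℝ, ψ p.1 * ψ p.2 * ENNReal.ofReal (Real.exp (-((1 / ε) ^ 2 * (p.1 - p.2) ^ 2 / 4)))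
      ≤ ENNReal.ofReal (16 * A) * (2 * ENNReal.ofReal A + J) := by
  set a : ℝ → ℝ≥0∞ := {u : ℝ | ε ≤ |u|}.indicator (fun u => ENNReal.ofReal (1 / |u|)) with ha
  have hms : MeasurableSet {u : ℝ | ε ≤ |u|} := measurableSet_le (by fun_prop) (by fun_prop)
  have ham : Measurable a := Measurable.indicator (by fun_prop) hms
  set k : ℝ → ℝ≥0∞ := fun z => ENNReal.ofReal (ε / (max ε |z|) ^ 2) with hk
  have hkm : Measurable k := by fun_prop
  have hψ' : ∀ u, ψ u ≤ φ u * a u := by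
    intro u
    refine (hψ u).trans (le_of_eq ?_)
    simp only [ha, indicator]
    split_ifs <;> simp
  have hker : ∀ u v : ℝ, ENNReal.ofReal (Real.exp (-((1 / ε) ^ 2 * (u - v) ^ 2 / 4))) ≤
      ENNReal.ofReal (4 * ε) * k (v - u) := by
    intro u v
    rw [hk, ← ENNReal.ofReal_mul (by positivity), abs_sub_comm]
    exact ENNReal.ofReal_le_ofReal (gauss_le_kap ε (u - v) hε)
  have hinner : ∀ u, ∫⁻ v, φ v * k (v - u) ≤ 2 * ENNReal.ofReal ((1 + D u / ε) * A) := by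
    intro u
    have h1 : ∫⁻ v, φ v * k (v - u) = ∫⁻ v, k v * φ (u + v) := by
      rw [← lintegral_add_left_eq_self (fun v => φ v * k (v - u)) u]
      refine lintegral_congr fun v => ?_
      rw [mul_comm]; congr 2; ring
    rw [h1]
    refine kap_bound (fun v => φ (u + v)) (by fun_prop) ε hε _ fun t ht => ?_
    refine (h u t ht).trans ?_
    have ht0 : 0 < t := hε.trans_le ht
    rw [← ENNReal.ofReal_mul ht0.le]
    refine ENNReal.ofReal_le_ofReal ?_
    rw [← mul_assoc]
    refine mul_le_mul_of_nonneg_right ?_ hA.le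
    have : D u ≤ t * (D u / ε) := by
      rw [mul_div_assoc', le_div_iff₀ hε]
      nlinarith [hD0 u]
    linarith
  have hone : ∫⁻ u, φ u * a u ^ 2 * (2 * ENNReal.ofReal ((1 + D u / ε) * A)) ≤
      ENNReal.ofReal (2 * A / ε) * (2 * ENNReal.ofReal A + J) := by
    have hpt : ∀ u, φ u * a u ^ 2 * (2 * ENNReal.ofReal ((1 + D u / ε) * A)) ≤
        ENNReal.ofReal (2 * A / ε) * (k u * φ u + φ u * ENNReal.ofReal (D u / u ^ 2)) := by
      intro u
      simp only [ha, indicator]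
      split_ifs with hu
      · have hu' : ε ≤ |u| := hu
        have hu0 : 0 < |u| := hε.trans_le hu'
        have hD0u := hD0 u
        have e1 : (2 : ℝ≥0∞) = ENNReal.ofReal 2 := by simp
        rw [hk, e1]
        simp only [max_eq_right hu']
        rw [← ENNReal.ofReal_pow (by positivity), mul_assoc, ← ENNReal.ofReal_mul (by norm_num),
          ← ENNReal.ofReal_mul (by positivity), mul_comm (ENNReal.ofReal (ε / |u| ^ 2)), ← mul_add,
          ← ENNReal.ofReal_add (by positivity) (by positivity), mul_left_comm (ENNReal.ofReal (2 * A / ε)),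
          ← ENNReal.ofReal_mul (by positivity)]
        refine mul_le_mul_right (ENNReal.ofReal_le_ofReal (le_of_eq ?_)) _
        rw [sq_abs]
        have hu2 : u ≠ 0 := abs_pos.1 hu0
        rw [div_pow, sq_abs]
        field_simp
      · simp
    calc _ ≤ ∫⁻ u, ENNReal.ofReal (2 * A / ε) * (k u * φ u + φ u * ENNReal.ofReal (D u / u ^ 2)) :=
          lintegral_mono hpt
      _ = ENNReal.ofReal (2 * A / ε) * ((∫⁻ u, k u * φ u) + ∫⁻ u, φ u * ENNReal.ofReal (D u / u ^ 2)) := by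
          rw [lintegral_const_mul' _ _ ENNReal.ofReal_ne_top, lintegral_add_left (by fun_prop)]
      _ ≤ _ := by
          gcongr
          exact kap_bound φ hφ ε hε _ h0
  have hsym : ∫⁻ u, ∫⁻ v, φ u * a u ^ 2 * (φ v * k (v - u)) ≤
      ENNReal.ofReal (2 * A / ε) * (2 * ENNReal.ofReal A + J) := by
    refine le_trans (lintegral_mono fun u => ?_) hone
    rw [lintegral_const_mul _ (by fun_prop)]
    exact mul_le_mul_right (hinner u) _
  have hksym : ∀ z, k (-z) = k z := fun z => by simp [hk]
  have hsq : ∀ x y : ℝ≥0∞, x * y ≤ x ^ 2 + y ^ 2 := by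
    intro x y
    rcases le_total x y with hxy | hxy
    · exact (mul_le_mul_left hxy y).trans (by rw [sq y]; exact le_add_self)
    · exact (mul_le_mul_right hxy x).trans (by rw [sq x]; exact le_self_add)
  calc _ ≤ ∫⁻ p : ℝ × ℝ, ENNReal.ofReal (4 * ε) * (φ p.1 * a p.1 ^ 2 * (φ p.2 * k (p.2 - p.1)) +
        φ p.2 * a p.2 ^ 2 * (φ p.1 * k (p.1 - p.2))) := by
        refine lintegral_mono fun p => ?_
        calc ψ p.1 * ψ p.2 * ENNReal.ofReal (Real.exp (-((1 / ε) ^ 2 * (p.1 - p.2) ^ 2 / 4)))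
            ≤ (φ p.1 * a p.1) * (φ p.2 * a p.2) * (ENNReal.ofReal (4 * ε) * k (p.2 - p.1)) := by
              gcongr
              · exact hψ' _
              · exact hψ' _
              · exact hker _ _
          _ = ENNReal.ofReal (4 * ε) * (φ p.1 * φ p.2 * k (p.2 - p.1)) * (a p.1 * a p.2) := by ring
          _ ≤ ENNReal.ofReal (4 * ε) * (φ p.1 * φ p.2 * k (p.2 - p.1)) * (a p.1 ^ 2 + a p.2 ^ 2) := by
              gcongr; exact hsq _ _
          _ = _ := by
              rw [← hksym (p.1 - p.2), neg_sub]; ring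
    _ = ENNReal.ofReal (4 * ε) * ((∫⁻ u, ∫⁻ v, φ u * a u ^ 2 * (φ v * k (v - u))) +
          ∫⁻ u, ∫⁻ v, φ u * a u ^ 2 * (φ v * k (v - u))) := by
        rw [lintegral_const_mul' _ _ ENNReal.ofReal_ne_top, lintegral_add_left (by fun_prop)]
        congr 2
        · exact lintegral_prod _ (by fun_prop)
        · exact lintegral_prod_symm (fun p : ℝ × ℝ => φ p.2 * a p.2 ^ 2 * (φ p.1 * k (p.1 - p.2)))
            (by fun_prop)
    _ ≤ ENNReal.ofReal (4 * ε) * (ENNReal.ofReal (2 * A / ε) * (2 * ENNReal.ofReal A + J) +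
          ENNReal.ofReal (2 * A / ε) * (2 * ENNReal.ofReal A + J)) := by gcongr
    _ = _ := by
        rw [← two_mul, ← mul_assoc, ← mul_assoc]
        congr 1
        have e1 : (2 : ℝ≥0∞) = ENNReal.ofReal 2 := by simp
        rw [e1, ← ENNReal.ofReal_mul (by positivity), ← ENNReal.ofReal_mul (by positivity)]
        congr 1
        field_simp; ring

/-- Weak type bound controlling averages and local oscillation of modulated singular integrals. -/
theorem rodin_core (g : ℝ → ℝ≥0∞) (hg : Measurable g) (hgf : ∫⁻ u, g u ≠ ⊤) (A : ℝ) (hA : 0 < A) :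
    ∃ E : Set ℝ, volume E ≤ ENNReal.ofReal (12 / A) * ∫⁻ u, g u ∧ ∀ y ∉ E,
      (∀ t > 0, ∫⁻ u in Metric.closedBall y t, g u ≤ ENNReal.ofReal (t * A)) ∧
      ∀ ε > 0, ∀ ψ : ℝ → ℂ, Integrable ψ →
        (∀ u, ‖ψ u‖ₑ ≤ {u : ℝ | ε ≤ |u|}.indicator
          (fun u => g (y - u) * ENNReal.ofReal (1 / |u|)) u) →
        ∫⁻ s in Icc 0 (1 / ε), ‖∫ u : ℝ, Complex.exp (Complex.I * s * u) * ψ u‖ₑ ^ 2 ≤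
          ENNReal.ofReal (288 * A ^ 2 / ε) := by
  set Ω : Set ℝ := {y : ℝ | ∃ t > 0, ENNReal.ofReal (t * A) < ∫⁻ u in Metric.closedBall y t, g u}
    with hΩ
  have hΩv : volume Ω ≤ ENNReal.ofReal (8 / A) * ∫⁻ u, g u := hl_weak g A hA
  have hne : (Ωᶜ).Nonempty := by
    by_contra hcon
    rw [not_nonempty_iff_eq_empty, compl_empty_iff] at hcon
    rw [hcon, Real.volume_univ, top_le_iff] at hΩv
    exact ENNReal.mul_ne_top ENNReal.ofReal_ne_top hgf hΩv
  set d : ℝ → ℝ := fun x => Metric.infDist x Ωᶜ with hd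
  have hdm : Measurable d := (Metric.continuous_infDist_pt _).measurable
  have hd0 : ∀ x, 0 ≤ d x := fun x => Metric.infDist_nonneg
  have hav : ∀ y ∉ Ω, ∀ t > 0, ∫⁻ u in Metric.closedBall y t, g u ≤ ENNReal.ofReal (t * A) := by
    intro y hy t ht
    by_contra hcon
    exact hy ⟨t, ht, not_le.1 hcon⟩
  have hav2 : ∀ x, ∀ t > 0, ∫⁻ u in Metric.closedBall x t, g u ≤ ENNReal.ofReal ((t + d x) * A) := by
    intro x t ht
    have h1 : ∀ δ > 0, ∫⁻ u in Metric.closedBall x t, g u ≤ ENNReal.ofReal ((t + (d x + δ)) * A) := by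
      intro δ hδ
      obtain ⟨z, hz, hxz⟩ := (Metric.infDist_lt_iff hne).1 (lt_add_of_pos_right (d x) hδ)
      refine (lintegral_mono_set ?_).trans (hav z hz (t + (d x + δ)) (by have := hd0 x; positivity))
      exact Metric.closedBall_subset_closedBall' (by linarith)
    have h2 : Tendsto (fun δ : ℝ => ENNReal.ofReal ((t + (d x + δ)) * A)) (𝓝[>] 0)
        (𝓝 (ENNReal.ofReal ((t + (d x + 0)) * A))) := by
      refine tendsto_nhdsWithin_of_tendsto_nhds ?_
      have : Continuous (fun δ : ℝ => ENNReal.ofReal ((t + (d x + δ)) * A)) :=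
        ENNReal.continuous_ofReal.comp (by fun_prop)
      exact this.tendsto 0
    rw [add_zero] at h2
    exact ge_of_tendsto h2 (eventually_mem_nhdsWithin.mono fun δ hδ => h1 δ hδ)
  set J : ℝ → ℝ≥0∞ := fun y => ∫⁻ x, g x * ENNReal.ofReal (d x / (max (d x) |x - y|) ^ 2) with hJ
  have hJm : Measurable J := by
    refine Measurable.lintegral_prod_right' (f := fun p : ℝ × ℝ =>
      g p.2 * ENNReal.ofReal (d p.2 / (max (d p.2) |p.2 - p.1|) ^ 2)) ?_
    fun_prop
  have hJi : ∫⁻ y, J y ≤ 4 * ∫⁻ u, g u := by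
    rw [hJ, lintegral_lintegral_swap (by fun_prop), ← lintegral_const_mul _ hg]
    refine lintegral_mono fun x => ?_
    rw [lintegral_const_mul _ (by fun_prop), mul_comm]
    refine mul_le_mul_left ?_ _
    rcases (hd0 x).eq_or_lt with h0 | h0
    · simp [← h0]
    · rw [← lintegral_add_left_eq_self _ x]
      have := kap_bound (fun _ => 1) measurable_const (d x) h0 2 (fun t ht => by
        have : {u : ℝ | |u| < t} = Metric.ball 0 t := by ext; simp
        rw [setLIntegral_one, this, Real.volume_ball, mul_comm 2 t, ENNReal.ofReal_mul (by linarith)]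
        simp)
      simpa [show (2 : ℝ≥0∞) * 2 = 4 by norm_num] using this
  refine ⟨Ω ∪ {y | ENNReal.ofReal A < J y}, ?_, ?_⟩
  · refine (measure_union_le _ _).trans ?_
    have h2 : volume {y | ENNReal.ofReal A < J y} ≤ ENNReal.ofReal (4 / A) * ∫⁻ u, g u := by
      have h3 := mul_meas_ge_le_lintegral hJm (ENNReal.ofReal A) (μ := volume)
      have h4 : volume {y | ENNReal.ofReal A < J y} ≤ volume {y | ENNReal.ofReal A ≤ J y} :=
        measure_mono fun y hy => by
          simp only [mem_ofPred_eq] at hy ⊢; exact hy.le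
      have hA' : ENNReal.ofReal A ≠ 0 := by simpa using hA
      calc _ ≤ volume {y | ENNReal.ofReal A ≤ J y} := h4
        _ ≤ (∫⁻ y, J y) / ENNReal.ofReal A := by
            rw [ENNReal.le_div_iff_mul_le (Or.inl hA') (Or.inl ENNReal.ofReal_ne_top), mul_comm]
            exact h3
        _ ≤ (4 * ∫⁻ u, g u) / ENNReal.ofReal A := by gcongr
        _ = _ := by
            rw [ENNReal.ofReal_div_of_pos hA]
            simp only [div_eq_mul_inv]
            rw [show ENNReal.ofReal 4 = 4 by simp]
            ring
    refine (add_le_add hΩv h2).trans (le_of_eq ?_)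
    rw [← add_mul, ← ENNReal.ofReal_add (by positivity) (by positivity)]
    congr 2
    ring
  · intro y hy
    rw [mem_union, not_or] at hy
    refine ⟨hav y hy.1, fun ε hε ψ hψi hψ => ?_⟩
    have hyJ : J y ≤ ENNReal.ofReal A := not_lt.1 hy.2
    have hball : ∀ u t : ℝ, 0 < t → ∫⁻ v in {v : ℝ | |v| < t}, g (y - (u + v)) ≤
        ∫⁻ v in Metric.closedBall (y - u) t, g v := by
      intro u t ht
      have hms : MeasurableSet {v : ℝ | |v| < t} := measurableSet_lt (by fun_prop) (by fun_prop)
      rw [← lintegral_indicator hms, ← lintegral_indicator measurableSet_closedBall,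
        ← lintegral_sub_left_eq_self ((Metric.closedBall (y - u) t).indicator g) (y - u)]
      refine lintegral_mono fun v => ?_
      simp only [indicator]
      split_ifs with h1 h2 h2
      · exact le_of_eq (by congr 1; ring)
      · exfalso; apply h2; simp only [mem_ofPred_eq] at h1; rw [Metric.mem_closedBall, Real.dist_eq, sub_sub_cancel_left, abs_neg]; exact h1.le
      · simp
      · simp
    have hq := quad_kernel (fun u => g (y - u)) (by fun_prop) (fun u => d (y - u)) (by fun_prop)
      (fun u => hd0 _) ε hε A hA
      (fun t ht => by
        have ht0 : 0 < t := hε.trans_le ht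
        have h1 := (hball 0 t ht0).trans (by simpa using hav y hy.1 t ht0)
        rw [ENNReal.ofReal_mul ht0.le] at h1
        simpa using h1)
      (fun u t ht => by
        have ht0 : 0 < t := hε.trans_le ht
        exact (hball u t ht0).trans (hav2 _ t ht0))
      (ENNReal.ofReal A) (by
        refine le_trans (le_of_eq ?_) hyJ
        simp only [hJ]
        rw [← lintegral_sub_left_eq_self (fun x => g x * ENNReal.ofReal (d x / (max (d x) |x - y|) ^ 2)) y]
        refine lintegral_congr fun u => ?_
        congr 2
        have : d (y - u) ≤ |y - u - y| := by
          have := Metric.infDist_le_dist_of_mem (x := y - u) (show y ∈ Ωᶜ from hy.1)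
          rwa [Real.dist_eq] at this
        rw [max_eq_right this, sq_abs]; ring)
      (fun u => ‖ψ u‖ₑ) hψ
    refine (quad_gauss ψ hψi (1 / ε) (by positivity)).trans ((mul_le_mul_right hq _).trans
      (le_of_eq ?_))
    have e1 : (2 : ℝ≥0∞) = ENNReal.ofReal 2 := by simp
    rw [e1, ← ENNReal.ofReal_mul (by positivity), ← ENNReal.ofReal_add (by positivity) (by positivity),
      ← ENNReal.ofReal_mul (by positivity), ← ENNReal.ofReal_mul (by positivity)]
    congr 1
    field_simp; ring

/-- Poisson kernel. -/
def Pk (r u : ℝ) : ℝ := (1 - r ^ 2) / (1 - 2 * r * Real.cos u + r ^ 2)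
/-- Conjugate Poisson kernel. -/
def Qk (r u : ℝ) : ℝ := 2 * r * Real.sin u / (1 - 2 * r * Real.cos u + r ^ 2)
/-- Herglotz transform. -/
def Fg (g : ℝ → ℝ) (z : ℂ) : ℂ :=
  Real.circleAverage (fun ζ => herglotzRieszKernel 0 z ζ • ((g (Complex.arg ζ) : ℝ) : ℂ)) 0 1

theorem per_lint (φ : ℝ → ℝ≥0∞) (hφ : Function.Periodic φ (2 * Real.pi)) (a b : ℝ) :
    ∫⁻ t in Ioc a (a + 2 * Real.pi), φ t = ∫⁻ t in Ioc b (b + 2 * Real.pi), φ t := by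
  refine (isAddFundamentalDomain_Ioc Real.two_pi_pos a volume).setLIntegral_eq
    (isAddFundamentalDomain_Ioc Real.two_pi_pos b volume) φ ?_
  rintro ⟨g, hg⟩ x
  obtain ⟨n, rfl⟩ := AddSubgroup.mem_zmultiples_iff.1 hg
  have : φ (n • (2 * Real.pi) + x) = φ x := by
    rw [add_comm]; exact hφ.zsmul n x
  simpa [AddSubgroup.vadd_def] using this

theorem per_T1 (φ : ℝ → ℝ≥0∞) (hφ : Function.Periodic φ (2 * Real.pi)) (a : ℝ) :
    ∫⁻ t in Ioc a (a + 2 * Real.pi), φ t = ∫⁻ t in T1, φ t := by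
  rw [per_lint φ hφ a (-Real.pi), T1, show -Real.pi + 2 * Real.pi = Real.pi by ring]
  exact setLIntegral_congr Ico_ae_eq_Ioc.symm

theorem per_sub (φ : ℝ → ℝ≥0∞) (hφ : Function.Periodic φ (2 * Real.pi)) (θ : ℝ) :
    ∫⁻ u in Ioo (-Real.pi) Real.pi, φ (θ - u) = ∫⁻ t in T1, φ t := by
  rw [← per_T1 φ hφ (θ - Real.pi), setLIntegral_congr (Ioo_ae_eq_Ico (a := -Real.pi) (b := Real.pi)),
    ← lintegral_indicator measurableSet_Ico, ← lintegral_indicator measurableSet_Ioc,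
    ← lintegral_sub_left_eq_self ((Ioc (θ - Real.pi) (θ - Real.pi + 2 * Real.pi)).indicator φ) θ]
  refine lintegral_congr fun u => ?_
  simp only [indicator, mem_Ico, mem_Ioc]
  congr 1
  apply propext
  constructor <;> rintro ⟨h1, h2⟩ <;> constructor <;> linarith

theorem avg_eq {E : Type*} [NormedAddCommGroup E] [NormedSpace ℝ E] (f : ℂ → E) (R θ : ℝ) :
    Real.circleAverage f 0 R =
      (2 * Real.pi)⁻¹ • ∫ u in Ioo (-Real.pi) Real.pi, f (circleMap 0 R (θ - u)) := by
  rw [Real.circleAverage_def, ← integral_Ioc_eq_integral_Ioo,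
    ← intervalIntegral.integral_of_le (by linarith [Real.pi_pos]),
    intervalIntegral.integral_comp_sub_left (fun t => f (circleMap 0 R t))]
  congr 1
  have hp : Function.Periodic (fun t => f (circleMap 0 R t)) (2 * Real.pi) := by
    intro t; simp only [periodic_circleMap 0 R t]
  have := hp.intervalIntegral_add_eq 0 (θ - Real.pi)
  rw [zero_add] at this
  rw [this]; congr 1; ring

theorem den_pos (r u : ℝ) (h1 : 0 ≤ r) (h2 : r < 1) : 0 < 1 - 2 * r * Real.cos u + r ^ 2 := by
  have := Real.cos_le_one u
  nlinarith

theorem herg_eq (r R θ u : ℝ) (hr : 0 ≤ r) (hR : r < R) :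
    herglotzRieszKernel 0 (circleMap 0 r θ) (circleMap 0 R (θ - u)) =
      (Pk (r / R) u : ℂ) + Complex.I * (Qk (r / R) u : ℂ) := by
  have hR0 : 0 < R := hr.trans_lt hR
  set q := r / R with hq
  have hq0 : 0 ≤ q := by positivity
  have hq1 : q < 1 := (div_lt_one hR0).2 hR
  have hrq : r = R * q := by rw [hq]; field_simp
  have e1 : circleMap 0 r θ = circleMap 0 R (θ - u) * ((q : ℂ) * Complex.exp (u * Complex.I)) := by
    simp only [circleMap, zero_add]
    rw [hrq]; push_cast
    rw [show (θ : ℂ) * Complex.I = (θ - u) * Complex.I + u * Complex.I by ring, Complex.exp_add]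
    ring
  have hc : circleMap 0 R (θ - u) ≠ 0 := circleMap_ne_center hR0.ne'
  set D : ℝ := 1 - 2 * q * Real.cos u + q ^ 2 with hD
  have hD0 : 0 < D := den_pos q u hq0 hq1
  have hexp : Complex.exp (u * Complex.I) = Real.cos u + Real.sin u * Complex.I := by
    rw [Complex.exp_mul_I]; push_cast; rfl
  rw [herglotzRieszKernel_def, e1]
  simp only [sub_zero]
  rw [show ∀ a b : ℂ, (a + a * b) / (a - a * b) = (a * (1 + b)) / (a * (1 - b)) by
    intro a b; ring_nf, mul_div_mul_left _ _ hc, hexp]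
  have hne : (1 : ℂ) - q * (Real.cos u + Real.sin u * Complex.I) ≠ 0 := by
    intro h
    have hre := congrArg Complex.re h
    have him := congrArg Complex.im h
    simp at hre him
    have hs := Real.sin_sq_add_cos_sq u
    have : D = 0 := by
      rw [hD]
      norm_cast at hre him
      have : (1 - q * Real.cos u) ^ 2 + (q * Real.sin u) ^ 2 = D := by
        rw [hD]; linear_combination q ^ 2 * hs
      rw [hre, mul_eq_zero.2 him] at this
      rw [← hD]; linarith
    linarith
  rw [div_eq_iff hne]
  have hs : (Real.sin u : ℂ) ^ 2 + (Real.cos u : ℂ) ^ 2 = 1 := by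
    exact_mod_cast Real.sin_sq_add_cos_sq u
  have hDc : (D : ℂ) ≠ 0 := by exact_mod_cast hD0.ne'
  have hP : (Pk q u : ℂ) = (1 - q ^ 2) / D := by rw [Pk, ← hD]; push_cast; rfl
  have hQ : (Qk q u : ℂ) = 2 * q * Real.sin u / D := by rw [Qk, ← hD]; push_cast; rfl
  rw [hP, hQ]
  field_simp
  have hDD : (D : ℂ) = 1 - 2 * q * Real.cos u + q ^ 2 := by rw [hD]; push_cast; rfl
  rw [hDD]
  have hI : Complex.I ^ 2 = -1 := Complex.I_sq
  linear_combination (-2 * (q:ℂ) ^ 2) * hs + 2 * (q:ℂ) ^ 2 * (Real.sin u : ℂ) ^ 2 * hI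

theorem per_int (g : ℝ → ℝ) (hp : Function.Periodic g (2 * Real.pi)) (hi : IntegrableOn g T1)
    (a b : ℝ) : IntervalIntegrable g volume a b := by
  refine hp.intervalIntegrable (t := -Real.pi) Real.two_pi_pos.ne' ?_ a b
  rw [show -Real.pi + 2 * Real.pi = Real.pi by ring, intervalIntegrable_iff_integrableOn_Ico_of_le
    (by linarith [Real.pi_pos])]
  exact hi

theorem per_int_sub (g : ℝ → ℝ) (hp : Function.Periodic g (2 * Real.pi)) (hi : IntegrableOn g T1)
    (θ : ℝ) : IntegrableOn (fun u => g (θ - u)) (Ioo (-Real.pi) Real.pi) := by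
  have h := (per_int g hp hi (θ + Real.pi) (θ - Real.pi)).comp_sub_left θ
  simp only [sub_add_cancel_left, sub_sub_cancel] at h
  rw [intervalIntegrable_iff_integrableOn_Ioo_of_le (by linarith [Real.pi_pos])] at h
  exact h

theorem g_arg (g : ℝ → ℝ) (hp : Function.Periodic g (2 * Real.pi)) (t : ℝ) :
    g (Complex.arg (circleMap 0 1 t)) = g t := by
  simp only [circleMap, zero_add, Complex.ofReal_one, one_mul]
  rw [Complex.arg_exp_mul_I, toIocMod]
  exact hp.sub_zsmul_eq _

theorem Fg_diff (g : ℝ → ℝ) (hp : Function.Periodic g (2 * Real.pi)) (hi : IntegrableOn g T1) :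
    DifferentiableOn ℂ (Fg g) (Metric.ball 0 1) := by
  refine differentiableOn_circleAverage_herglotzRieszKernel_smul ?_
  have : IntervalIntegrable (fun t => (g t : ℂ)) volume 0 (2 * Real.pi) := by
    have := per_int g hp hi 0 (2 * Real.pi)
    rw [intervalIntegrable_iff] at this ⊢
    exact this.ofReal
  rw [CircleIntegrable]
  simpa only [g_arg g hp] using this

theorem Pk_cont (r : ℝ) (h1 : 0 ≤ r) (h2 : r < 1) : Continuous (Pk r) := by
  unfold Pk
  exact Continuous.div (by fun_prop) (by fun_prop) fun u => (den_pos r u h1 h2).ne'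

theorem Qk_cont (r : ℝ) (h1 : 0 ≤ r) (h2 : r < 1) : Continuous (Qk r) := by
  unfold Qk
  exact Continuous.div (by fun_prop) (by fun_prop) fun u => (den_pos r u h1 h2).ne'

theorem mul_ker_int (g : ℝ → ℝ) (hp : Function.Periodic g (2 * Real.pi)) (hi : IntegrableOn g T1)
    (θ : ℝ) (k : ℝ → ℝ) (hk : Continuous k) :
    IntegrableOn (fun u => g (θ - u) * k u) (Ioo (-Real.pi) Real.pi) := by
  have h := per_int_sub g hp hi θ
  rw [← integrableOn_Icc_iff_integrableOn_Ioo] at h ⊢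
  exact h.mul_continuousOn hk.continuousOn isCompact_Icc

theorem Fg_polar (g : ℝ → ℝ) (hp : Function.Periodic g (2 * Real.pi)) (hi : IntegrableOn g T1)
    (r θ : ℝ) (h1 : 0 ≤ r) (h2 : r < 1) :
    Fg g (circleMap 0 r θ) =
      (((2 * Real.pi)⁻¹ * ∫ u in Ioo (-Real.pi) Real.pi, g (θ - u) * Pk r u : ℝ) : ℂ) +
      Complex.I * (((2 * Real.pi)⁻¹ * ∫ u in Ioo (-Real.pi) Real.pi, g (θ - u) * Qk r u : ℝ) : ℂ) := by
  rw [Fg, avg_eq _ 1 θ]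
  have : ∀ u, herglotzRieszKernel 0 (circleMap 0 r θ) (circleMap 0 1 (θ - u)) •
      ((g (Complex.arg (circleMap 0 1 (θ - u))) : ℝ) : ℂ) =
      ((g (θ - u) * Pk r u : ℝ) : ℂ) + Complex.I * ((g (θ - u) * Qk r u : ℝ) : ℂ) := by
    intro u
    rw [herg_eq r 1 θ u h1 h2, g_arg g hp, div_one, smul_eq_mul]
    push_cast; ring
  simp only [this]
  rw [integral_add (mul_ker_int g hp hi θ _ (Pk_cont r h1 h2)).ofReal
    ((mul_ker_int g hp hi θ _ (Qk_cont r h1 h2)).ofReal.const_mul _), integral_const_mul]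
  rw [integral_complex_ofReal, integral_complex_ofReal, Complex.real_smul]
  push_cast; ring

/-- half cotangent kernel -/
def kk (u : ℝ) : ℝ := 1 / (2 * Real.tan (u / 2))

theorem kk_neg (u : ℝ) : kk (-u) = -kk u := by
  simp only [kk, neg_div, Real.tan_neg, mul_neg, one_div, inv_neg]

theorem kk_bound (u : ℝ) (h : |u| < Real.pi) : |kk u| ≤ 1 / |u| := by
  have key : ∀ u : ℝ, 0 < u → u < Real.pi → |kk u| ≤ 1 / |u| := by
    intro u h0 h1
    have ht : u / 2 < Real.tan (u / 2) := Real.lt_tan (by linarith) (by linarith)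
    rw [kk, abs_of_pos h0, abs_of_pos (by have : 0 < Real.tan (u/2) := by linarith
                                          positivity)]
    exact one_div_le_one_div_of_le h0 (by linarith)
  rcases lt_trichotomy u 0 with h0 | h0 | h0
  · have := key (-u) (by linarith) (by rwa [abs_of_neg h0] at h)
    rwa [kk_neg, abs_neg, abs_neg] at this
  · subst h0; simp [kk]
  · exact key u h0 (by rwa [abs_of_pos h0] at h)

theorem kk_meas : Measurable kk := by
  unfold kk
  have : Measurable Real.tan := by
    have : Real.tan = fun x => Real.sin x / Real.cos x := by ext x; exact Real.tan_eq_sin_div_cos x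
    rw [this]; fun_prop
  fun_prop

theorem den_lower (r u : ℝ) (h1 : 1 / 2 ≤ r) (h2 : r < 1) (hu : |u| ≤ Real.pi) :
    (max (1 - r) |u|) ^ 2 / 5 ≤ 1 - 2 * r * Real.cos u + r ^ 2 := by
  have hc : Real.cos u = 1 - 2 * Real.sin (u / 2) ^ 2 := by
    have := Real.cos_sq' (u / 2)
    have h3 := Real.cos_two_mul (u / 2)
    rw [show 2 * (u / 2) = u by ring] at h3
    linarith
  have hs : u ^ 2 / 10 ≤ Real.sin (u / 2) ^ 2 := by
    have h3 := Real.mul_le_sin (x := |u| / 2) (by positivity) (by linarith)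
    have h4 : Real.sin (|u| / 2) ^ 2 = Real.sin (u / 2) ^ 2 := by
      rcases abs_cases u with h | h <;> rw [h.1]
      rw [neg_div, Real.sin_neg, neg_sq]
    rw [← h4, ← sq_abs u]
    have h5 : 0 ≤ 2 / Real.pi * (|u| / 2) := by positivity
    have h6 : (2 / Real.pi * (|u| / 2)) ^ 2 ≤ Real.sin (|u| / 2) ^ 2 := pow_le_pow_left₀ h5 h3 2
    refine le_trans ?_ h6
    have : (2 / Real.pi * (|u| / 2)) ^ 2 = |u| ^ 2 / Real.pi ^ 2 := by field_simp
    rw [this]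
    have hpi : Real.pi ^ 2 ≤ 10 := by nlinarith [Real.pi_lt_d2, Real.pi_pos]
    gcongr
  rcases max_cases (1 - r) |u| with h | h <;> rw [h.1]
  · rw [hc]; nlinarith [sq_nonneg (Real.sin (u / 2)), sq_nonneg (1 - r)]
  · rw [hc, sq_abs]; nlinarith [sq_nonneg (Real.sin (u / 2)), sq_nonneg (1 - r)]

/-- comparison kernel -/
def kap (ε u : ℝ) : ℝ := ε / (max ε |u|) ^ 2

theorem kap_nonneg (ε u : ℝ) (hε : 0 < ε) : 0 ≤ kap ε u := by unfold kap; positivity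

theorem Pk_nonneg (r u : ℝ) (h1 : 0 ≤ r) (h2 : r < 1) : 0 ≤ Pk r u :=
  div_nonneg (by nlinarith) (den_pos r u h1 h2).le

theorem Pk_le (r u : ℝ) (h1 : 1 / 2 ≤ r) (h2 : r < 1) (hu : |u| ≤ Real.pi) :
    Pk r u ≤ 10 * kap (1 - r) u := by
  have h := den_lower r u h1 h2 hu
  have hm : 0 < max (1 - r) |u| := lt_max_of_lt_left (by linarith)
  unfold Pk kap
  calc (1 - r ^ 2) / (1 - 2 * r * Real.cos u + r ^ 2) ≤ (2 * (1 - r)) / ((max (1 - r) |u|) ^ 2 / 5) := by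
        apply div_le_div₀ (by linarith) (by nlinarith) (by positivity) h
    _ = _ := by field_simp; ring

theorem Qk_le (r u : ℝ) (h1 : 1 / 2 ≤ r) (h2 : r < 1) (hu : |u| < Real.pi) :
    |Qk r u - {u : ℝ | 1 - r < |u|}.indicator (fun u => 2 * kk u) u| ≤ 10 * kap (1 - r) u := by
  have h := den_lower r u h1 h2 hu.le
  have hm : 0 < max (1 - r) |u| := lt_max_of_lt_left (by linarith)
  have hD := den_pos r u (by linarith) h2
  have hε : 0 < 1 - r := by linarith
  by_cases hc : 1 - r < |u|
  · rw [indicator_of_mem (by simpa using hc)]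
    have hmx : max (1 - r) |u| = |u| := max_eq_right hc.le
    have hu0 : 0 < |u| := hε.trans hc
    have e : Qk r u - 2 * kk u = -(2 * kk u) * ((1 - r) ^ 2 / (1 - 2 * r * Real.cos u + r ^ 2)) := by
      have hu2 : u / 2 ≠ 0 := by
        have := abs_pos.1 hu0; positivity
      have hsin : Real.sin (u / 2) ≠ 0 := by
        intro h0
        rw [Real.sin_eq_zero_iff_of_lt_of_lt] at h0
        · exact hu2 h0
        · linarith [(abs_lt.1 hu).1]
        · linarith [(abs_lt.1 hu).2, Real.pi_pos]
      have h3 : Real.cos u = 1 - 2 * Real.sin (u / 2) ^ 2 := by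
        have := Real.cos_sq' (u / 2)
        have h3 := Real.cos_two_mul (u / 2)
        rw [show 2 * (u / 2) = u by ring] at h3
        linarith
      have h4 : Real.sin u = 2 * Real.sin (u / 2) * Real.cos (u / 2) := by
        rw [← Real.sin_two_mul]; congr 1; ring
      have h5 : kk u = Real.cos (u / 2) / (2 * Real.sin (u / 2)) := by
        rw [kk, Real.tan_eq_sin_div_cos, one_div, mul_div_assoc', inv_div]
      rw [Qk, h5, h4]
      field_simp
      rw [h3]; ring
    rw [e, abs_mul, abs_neg, abs_mul, abs_two, abs_of_nonneg (a := _ / _) (by positivity), kap, hmx]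
    rw [hmx] at h
    calc 2 * |kk u| * ((1 - r) ^ 2 / (1 - 2 * r * Real.cos u + r ^ 2))
        ≤ 2 * (1 / |u|) * ((1 - r) ^ 2 / (|u| ^ 2 / 5)) := by
          gcongr
          exact kk_bound u hu
      _ = 10 * ((1 - r) / |u| ^ 2) * ((1 - r) / |u|) := by field_simp; ring
      _ ≤ 10 * ((1 - r) / |u| ^ 2) * 1 := by
          gcongr
          rw [div_le_one hu0]; exact hc.le
      _ = _ := by ring
  · rw [indicator_of_notMem (by simpa using hc), sub_zero]
    push Not at hc
    rw [kap, max_eq_left hc, Qk, abs_div, abs_of_pos hD, abs_mul, abs_mul, abs_two,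
      abs_of_nonneg (a := r) (by linarith)]
    rw [max_eq_left hc] at h
    have hs : |Real.sin u| ≤ |u| := Real.abs_sin_le_abs
    calc 2 * r * |Real.sin u| / (1 - 2 * r * Real.cos u + r ^ 2)
        ≤ 2 * 1 * (1 - r) / ((1 - r) ^ 2 / 5) := by
          apply div_le_div₀ (by positivity) _ (by positivity) h
          gcongr
          exact hs.trans hc
      _ = _ := by field_simp; ring

theorem poisson_re (W : ℂ → ℂ) (hW : DifferentiableOn ℂ W (Metric.ball 0 1)) (r ρ θ : ℝ)
    (hr : 0 ≤ r) (hρ : r < ρ) (hρ1 : ρ < 1) :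
    IntegrableOn (fun u => (W (circleMap 0 ρ (θ - u))).re * Pk (r / ρ) u) (Ioo (-Real.pi) Real.pi) ∧
    (W (circleMap 0 r θ)).re =
      (2 * Real.pi)⁻¹ * ∫ u in Ioo (-Real.pi) Real.pi, (W (circleMap 0 ρ (θ - u))).re * Pk (r / ρ) u := by
  have hρ0 : 0 < ρ := hr.trans_lt hρ
  have hcl : closure (Metric.ball (0:ℂ) ρ) ⊆ Metric.ball 0 1 :=
    Metric.closure_ball_subset_closedBall.trans (Metric.closedBall_subset_ball hρ1)
  have hd : DiffContOnCl ℂ W (Metric.ball 0 ρ) := (hW.mono hcl).diffContOnCl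
  have hw : circleMap 0 r θ ∈ Metric.ball (0:ℂ) ρ := by
    simp [abs_of_nonneg hr, hρ]
  have h1 := hd.circleAverage_poissonKernel_smul hw
  rw [avg_eq _ ρ θ] at h1
  have hc : Continuous fun u : ℝ => W (circleMap 0 ρ (θ - u)) := by
    refine hW.continuousOn.comp_continuous (by fun_prop) fun u => ?_
    simp [abs_of_pos hρ0, hρ1]
  have hq1 : r / ρ < 1 := (div_lt_one hρ0).2 hρ
  have hPc := Pk_cont (r / ρ) (by positivity) hq1
  have hcc : Continuous fun u : ℝ => ((Pk (r / ρ) u : ℝ) : ℂ) * W (circleMap 0 ρ (θ - u)) :=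
    (Complex.continuous_ofReal.comp hPc).mul hc
  have hint : IntegrableOn (fun u : ℝ => ((Pk (r / ρ) u : ℝ) : ℂ) * W (circleMap 0 ρ (θ - u)))
      (Ioo (-Real.pi) Real.pi) := (hcc.integrableOn_Icc).mono_set Ioo_subset_Icc_self
  refine ⟨?_, ?_⟩
  · have : Continuous fun u => (W (circleMap 0 ρ (θ - u))).re * Pk (r / ρ) u :=
      (Complex.continuous_re.comp hc).mul hPc
    exact (this.integrableOn_Icc).mono_set Ioo_subset_Icc_self
  · rw [← h1, Complex.real_smul, Complex.re_ofReal_mul]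
    congr 1
    have h2 : ∀ u, (poissonKernel 0 (circleMap 0 r θ) • W) (circleMap 0 ρ (θ - u)) =
        ((Pk (r / ρ) u : ℝ) : ℂ) * W (circleMap 0 ρ (θ - u)) := by
      intro u
      rw [poissonKernel_eq_re_herglotzRieszKernel, Pi.smul_apply', Function.comp_apply,
        herg_eq r ρ θ u hr hρ, Complex.real_smul]
      simp
    simp only [h2]
    rw [← RCLike.re_eq_complex_re, ← integral_re hint]
    refine integral_congr_ae (Eventually.of_forall fun u => ?_)
    simp [mul_comm]

/-- restriction to two periods -/
def cut (φ : ℝ → ℝ≥0∞) : ℝ → ℝ≥0∞ := (Ioc (-(2 * Real.pi)) (2 * Real.pi)).indicator φ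

theorem cut_meas (φ : ℝ → ℝ≥0∞) (hφ : Measurable φ) : Measurable (cut φ) :=
  hφ.indicator measurableSet_Ioc

theorem cut_int (φ : ℝ → ℝ≥0∞) (hp : Function.Periodic φ (2 * Real.pi)) :
    ∫⁻ u, cut φ u = 2 * ∫⁻ u in T1, φ u := by
  rw [cut, lintegral_indicator measurableSet_Ioc,
    ← Ioc_union_Ioc_eq_Ioc (b := 0) (by linarith [Real.pi_pos]) (by linarith [Real.pi_pos]),
    lintegral_union measurableSet_Ioc (Ioc_disjoint_Ioc_of_le le_rfl)]
  have h1 := per_T1 φ hp (-(2 * Real.pi))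
  have h2 := per_T1 φ hp 0
  rw [neg_add_cancel] at h1
  rw [zero_add] at h2
  rw [h1, h2, two_mul]

/-- averages bounded by `A` -/
def avgLe (φ : ℝ → ℝ≥0∞) (y A : ℝ) : Prop :=
  ∀ t > 0, ∫⁻ u in Metric.closedBall y t, cut φ u ≤ ENNReal.ofReal (t * A)

theorem avg_ball (φ : ℝ → ℝ≥0∞) (y A : ℝ) (h : avgLe φ y A) (t : ℝ) (ht : 0 < t) :
    ∫⁻ v in {v : ℝ | |v| < t}, cut φ (y - v) ≤ ENNReal.ofReal (t * A) := by
  refine le_trans ?_ (h t ht)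
  have hms : MeasurableSet {v : ℝ | |v| < t} := measurableSet_lt (by fun_prop) (by fun_prop)
  rw [← lintegral_indicator hms, ← lintegral_indicator measurableSet_closedBall,
    ← lintegral_sub_left_eq_self ((Metric.closedBall y t).indicator (cut φ)) y]
  refine lintegral_mono fun v => ?_
  simp only [indicator]
  split_ifs with h1 h2 h2
  · exact le_rfl
  · exfalso; apply h2; simp only [mem_ofPred_eq] at h1
    rw [Metric.mem_closedBall, Real.dist_eq, sub_sub_cancel_left, abs_neg]; exact h1.le
  · simp
  · simp

theorem cut_eq (φ : ℝ → ℝ≥0∞) (y u : ℝ) (hy : y ∈ T1) (hu : u ∈ Ioo (-Real.pi) Real.pi) :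
    cut φ (y - u) = φ (y - u) := by
  rw [cut, indicator_of_mem]
  have := hy.1; have := hy.2; have := hu.1; have := hu.2
  constructor <;> linarith

theorem avg_small (φ : ℝ → ℝ≥0∞) (y A : ℝ) (hy : y ∈ T1) (h : avgLe φ y A) (t : ℝ) (ht : 0 < t)
    (htp : t ≤ Real.pi) :
    ∫⁻ v in {v : ℝ | |v| < t}, φ (y - v) ≤ ENNReal.ofReal (t * A) := by
  refine le_trans (le_of_eq ?_) (avg_ball φ y A h t ht)
  refine setLIntegral_congr_fun (measurableSet_lt (by fun_prop) (by fun_prop)) fun v hv => ?_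
  have hv' := abs_lt.1 (show |v| < t from hv)
  exact (cut_eq φ y v hy ⟨by linarith, by linarith⟩).symm

theorem kap_avg (φ : ℝ → ℝ≥0∞) (hφ : Measurable φ) (y A ε : ℝ) (hε : 0 < ε) (hy : y ∈ T1)
    (h : avgLe φ y A) :
    ∫⁻ u in Ioo (-Real.pi) Real.pi, ENNReal.ofReal (kap ε u) * φ (y - u) ≤ 2 * ENNReal.ofReal A := by
  have hc := cut_meas φ hφ
  calc _ = ∫⁻ u in Ioo (-Real.pi) Real.pi, ENNReal.ofReal (kap ε u) * cut φ (y - u) :=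
        setLIntegral_congr_fun measurableSet_Ioo fun u hu => by rw [cut_eq φ y u hy hu]
    _ ≤ ∫⁻ u, ENNReal.ofReal (kap ε u) * cut φ (y - u) := setLIntegral_le_lintegral _ _
    _ ≤ _ := by
      refine kap_bound (fun u => cut φ (y - u)) (by fun_prop) ε hε _ fun t ht => ?_
      have ht0 : 0 < t := hε.trans_le ht
      rw [← ENNReal.ofReal_mul ht0.le]
      exact avg_ball φ y A h t ht0

theorem avgLe_of (φ : ℝ → ℝ≥0∞) (y A : ℝ)
    (h : y ∉ {y : ℝ | ∃ t > 0, ENNReal.ofReal (t * A) < ∫⁻ u in Metric.closedBall y t, cut φ u}) :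
    avgLe φ y A := fun t ht => by
  by_contra hcon
  exact h ⟨t, ht, not_le.1 hcon⟩

theorem Fg_re (g : ℝ → ℝ) (hp : Function.Periodic g (2 * Real.pi)) (hi : IntegrableOn g T1)
    (r θ : ℝ) (h1 : 0 ≤ r) (h2 : r < 1) :
    (Fg g (circleMap 0 r θ)).re = (2 * Real.pi)⁻¹ * ∫ u in Ioo (-Real.pi) Real.pi, g (θ - u) * Pk r u := by
  rw [Fg_polar g hp hi r θ h1 h2, Complex.add_re, Complex.ofReal_re, Complex.I_mul_re, Complex.ofReal_im]
  ring

theorem Fg_im (g : ℝ → ℝ) (hp : Function.Periodic g (2 * Real.pi)) (hi : IntegrableOn g T1)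
    (r θ : ℝ) (h1 : 0 ≤ r) (h2 : r < 1) :
    (Fg g (circleMap 0 r θ)).im = (2 * Real.pi)⁻¹ * ∫ u in Ioo (-Real.pi) Real.pi, g (θ - u) * Qk r u := by
  rw [Fg_polar g hp hi r θ h1 h2, Complex.add_im, Complex.ofReal_im, Complex.I_mul_im, Complex.ofReal_re]
  ring

theorem Fg_re_nonneg' (g : ℝ → ℝ) (hp : Function.Periodic g (2 * Real.pi)) (hi : IntegrableOn g T1)
    (h0 : ∀ t, 0 ≤ g t)
    (r θ : ℝ) (h1 : 0 ≤ r) (h2 : r < 1) : 0 ≤ (Fg g (circleMap 0 r θ)).re := by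
  rw [Fg_re g hp hi r θ h1 h2]
  have : 0 ≤ ∫ u in Ioo (-Real.pi) Real.pi, g (θ - u) * Pk r u :=
    integral_nonneg fun u => mul_nonneg (h0 _) (Pk_nonneg r u h1 h2)
  have := Real.pi_pos
  positivity

theorem polar_ball (z : ℂ) (hz : z ∈ Metric.ball (0:ℂ) 1) :
    ∃ r θ : ℝ, 0 ≤ r ∧ r < 1 ∧ z = circleMap 0 r θ := by
  refine ⟨‖z‖, Complex.arg z, norm_nonneg _, by simpa using hz, ?_⟩
  simp [circleMap, Complex.norm_mul_exp_arg_mul_I]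

theorem Fg_re_nonneg (g : ℝ → ℝ) (hp : Function.Periodic g (2 * Real.pi)) (hi : IntegrableOn g T1)
    (h0 : ∀ t, 0 ≤ g t) (z : ℂ) (hz : z ∈ Metric.ball (0:ℂ) 1) : 0 ≤ (Fg g z).re := by
  obtain ⟨r, θ, h1, h2, rfl⟩ := polar_ball z hz
  exact Fg_re_nonneg' g hp hi h0 r θ h1 h2

theorem Fg_zero (g : ℝ → ℝ) (hp : Function.Periodic g (2 * Real.pi)) (hi : IntegrableOn g T1)
    (h0 : ∀ t, 0 ≤ g t) :
    Fg g 0 = (((2 * Real.pi)⁻¹ * (∫⁻ u in T1, ENNReal.ofReal (g u)).toReal : ℝ) : ℂ) := by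
  have h := Fg_polar g hp hi 0 0 le_rfl one_pos
  rw [circleMap_zero_radius] at h
  have hP : ∀ u, Pk 0 u = 1 := fun u => by simp [Pk]
  have hQ : ∀ u, Qk 0 u = 0 := fun u => by simp [Qk]
  simp only [hP, hQ, mul_one, mul_zero, integral_zero] at h
  have h2 := per_sub (fun u => ENNReal.ofReal (g u)) (fun u => by simp only [hp u]) 0
  rw [Function.const_apply, integral_eq_lintegral_of_nonneg_ae (Eventually.of_forall fun u => h0 _)
    (per_int_sub g hp hi 0).aestronglyMeasurable, h2] at h
  rw [h]; simp

/-- the transform F/(F+l) -/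
def Wt (g : ℝ → ℝ) (l : ℝ) (z : ℂ) : ℂ := Fg g z / (Fg g z + l)

theorem Wt_re (z : ℂ) (l : ℝ) (hl : 0 < l) (hz : 0 ≤ z.re) :
    0 ≤ (z / (z + l)).re ∧ (l ≤ ‖z‖ → 1 / 2 ≤ (z / (z + l)).re) := by
  have hn : 0 < (z.re + l) ^ 2 + z.im ^ 2 := by positivity
  have e : (z / (z + l)).re = (z.re ^ 2 + z.im ^ 2 + l * z.re) / ((z.re + l) ^ 2 + z.im ^ 2) := by
    rw [Complex.div_re, Complex.normSq_apply]
    simp only [Complex.add_re, Complex.ofReal_re, Complex.add_im, Complex.ofReal_im, add_zero]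
    rw [← add_div]; congr 1 <;> ring
  rw [e]
  refine ⟨by positivity, fun h => ?_⟩
  have h2 : l ^ 2 ≤ z.re ^ 2 + z.im ^ 2 := by
    have h3 : ‖z‖ ^ 2 = z.re ^ 2 + z.im ^ 2 := by
      rw [← Complex.normSq_eq_norm_sq, Complex.normSq_apply]; ring
    rw [← h3]; gcongr
  rw [div_le_div_iff₀ (by norm_num) hn]
  nlinarith

theorem weak_rho (g : ℝ → ℝ) (hp : Function.Periodic g (2 * Real.pi)) (hi : IntegrableOn g T1)
    (h0 : ∀ t, 0 ≤ g t) (l : ℝ) (hl : 0 < l) (ρ : ℝ) (hρ0 : 0 < ρ) (hρ : ρ < 1) :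
    volume {θ : ℝ | θ ∈ T1 ∧ ∃ r, 1 / 2 ≤ r ∧ r < ρ ∧ l ≤ ‖Fg g (circleMap 0 r θ)‖} ≤
      ENNReal.ofReal (144 / l) * ∫⁻ t in T1, ENNReal.ofReal (g t) := by
  have hpi := Real.pi_pos
  have hne : ∀ z ∈ Metric.ball (0:ℂ) 1, Fg g z + l ≠ 0 := by
    intro z hz h
    have h1 := Fg_re_nonneg g hp hi h0 z hz
    have h2 := congrArg Complex.re h
    simp at h2
    linarith
  have hWd : DifferentiableOn ℂ (Wt g l) (Metric.ball 0 1) :=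
    (Fg_diff g hp hi).div ((Fg_diff g hp hi).add_const _) hne
  have hWp : ∀ z ∈ Metric.ball (0:ℂ) 1, 0 ≤ (Wt g l z).re := fun z hz =>
    (Wt_re _ l hl (Fg_re_nonneg g hp hi h0 z hz)).1
  have hmem : ∀ r θ : ℝ, 0 ≤ r → r < 1 → circleMap 0 r θ ∈ Metric.ball (0:ℂ) 1 := by
    intro r θ h1 h2; simpa [abs_of_nonneg h1] using h2
  set φ : ℝ → ℝ≥0∞ := fun t => ENNReal.ofReal (Wt g l (circleMap 0 ρ t)).re with hφ
  have hcW : Continuous fun t : ℝ => Wt g l (circleMap 0 ρ t) :=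
    hWd.continuousOn.comp_continuous (by fun_prop) fun u => hmem ρ u hρ0.le hρ
  have hφm : Measurable φ := by
    have : Measurable fun t : ℝ => (Wt g l (circleMap 0 ρ t)).re :=
      (Complex.continuous_re.comp hcW).measurable
    fun_prop
  have hφp : Function.Periodic φ (2 * Real.pi) := fun t => by
    simp only [hφ, periodic_circleMap 0 ρ t]
  set a : ℝ := (∫⁻ t in T1, ENNReal.ofReal (g t)).toReal with ha
  have hfin : ∫⁻ t in T1, ENNReal.ofReal (g t) ≠ ⊤ := by
    refine ne_top_of_le_ne_top hi.2.ne (lintegral_mono fun t => ?_)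
    rw [← ofReal_norm]; exact ENNReal.ofReal_le_ofReal (Real.le_norm_self _)
  have hpo : ∀ r θ, 0 ≤ r → r < ρ → ENNReal.ofReal (2 * Real.pi * (Wt g l (circleMap 0 r θ)).re) =
      ∫⁻ u in Ioo (-Real.pi) Real.pi, ENNReal.ofReal (Pk (r / ρ) u) * φ (θ - u) := by
    intro r θ h1 h2
    obtain ⟨hA, hB⟩ := poisson_re (Wt g l) hWd r ρ θ h1 h2 hρ
    have hP : ∀ u, 0 ≤ Pk (r / ρ) u := fun u => Pk_nonneg _ u (by positivity) ((div_lt_one hρ0).2 h2)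
    rw [hB, ← mul_assoc, mul_inv_cancel₀ (by positivity), one_mul,
      ofReal_integral_eq_lintegral_ofReal hA (Eventually.of_forall fun u =>
        mul_nonneg (hWp _ (hmem ρ _ hρ0.le hρ)) (hP u))]
    refine lintegral_congr fun u => ?_
    rw [mul_comm, ENNReal.ofReal_mul (hP u)]
  have hφi : ∫⁻ t in T1, φ t ≤ ENNReal.ofReal (a / l) := by
    have h := hpo 0 0 le_rfl hρ0
    have hP : ∀ u, Pk 0 u = 1 := fun u => by simp [Pk]
    simp only [zero_div, hP, ENNReal.ofReal_one, one_mul, circleMap_zero_radius,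
      Function.const_apply] at h
    rw [per_sub φ hφp 0] at h
    rw [← h, Wt, Fg_zero g hp hi h0, ← ha]
    refine ENNReal.ofReal_le_ofReal ?_
    have ha0 : 0 ≤ a := ENNReal.toReal_nonneg
    rw [← Complex.ofReal_add, ← Complex.ofReal_div, Complex.ofReal_re]
    have h3 : (2 * Real.pi)⁻¹ * a / ((2 * Real.pi)⁻¹ * a + l) ≤ (2 * Real.pi)⁻¹ * a / l := by
      gcongr
      have : 0 ≤ (2 * Real.pi)⁻¹ * a := by positivity
      linarith
    calc _ ≤ 2 * Real.pi * ((2 * Real.pi)⁻¹ * a / l) := by gcongr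
      _ = a / l := by field_simp
  have hHL := hl_weak (cut φ) (1 / 9) (by norm_num)
  rw [cut_int φ hφp] at hHL
  refine (measure_mono ?_).trans (hHL.trans ?_)
  · rintro θ ⟨hθ, r, h1, h2, h3⟩
    by_contra hcon
    have hav := avgLe_of φ θ _ hcon
    have hq2 : r / ρ < 1 := (div_lt_one hρ0).2 h2
    have hq1 : 1 / 2 ≤ r / ρ := h1.trans (by rw [le_div_iff₀ hρ0]; nlinarith)
    have hk := kap_avg φ hφm θ (1 / 9) (1 - r / ρ) (by linarith) hθ hav
    have hlow := (Wt_re _ l hl (Fg_re_nonneg g hp hi h0 _ (hmem r θ (by linarith) (by linarith)))).2 h3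
    have h4 : ENNReal.ofReal (2 * Real.pi * (Wt g l (circleMap 0 r θ)).re) ≤
        ENNReal.ofReal 10 * (2 * ENNReal.ofReal (1 / 9)) := by
      rw [hpo r θ (by linarith) h2]
      refine le_trans ?_ (mul_le_mul_right hk _)
      rw [← lintegral_const_mul' _ _ ENNReal.ofReal_ne_top]
      refine setLIntegral_mono' measurableSet_Ioo fun u hu => ?_
      rw [← mul_assoc, ← ENNReal.ofReal_mul (p := 10) (by norm_num)]
      refine mul_le_mul_left (ENNReal.ofReal_le_ofReal ?_) _
      exact Pk_le _ u hq1 hq2 (abs_le.2 ⟨hu.1.le, hu.2.le⟩)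
    rw [show (2 : ℝ≥0∞) = ENNReal.ofReal 2 by simp, ← ENNReal.ofReal_mul (by norm_num),
      ← ENNReal.ofReal_mul (by norm_num), ENNReal.ofReal_le_ofReal_iff (by norm_num)] at h4
    have h5 : 1 / 2 ≤ (Wt g l (circleMap 0 r θ)).re := hlow
    nlinarith [Real.pi_gt_three]
  · have e : ∫⁻ t in T1, ENNReal.ofReal (g t) = ENNReal.ofReal a := (ENNReal.ofReal_toReal hfin).symm
    have ha0 : 0 ≤ a := ENNReal.toReal_nonneg
    rw [e, ← ENNReal.ofReal_mul (by positivity)]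
    calc _ ≤ ENNReal.ofReal (8 / (1 / 9)) * (2 * ENNReal.ofReal (a / l)) := by gcongr
      _ = _ := by
        rw [show (2 : ℝ≥0∞) = ENNReal.ofReal 2 by simp, ← ENNReal.ofReal_mul (by norm_num),
          ← ENNReal.ofReal_mul (by norm_num)]
        congr 1; ring

theorem weak_conj (g : ℝ → ℝ) (hp : Function.Periodic g (2 * Real.pi)) (hi : IntegrableOn g T1)
    (h0 : ∀ t, 0 ≤ g t) (l : ℝ) (hl : 0 < l) :
    volume {θ : ℝ | θ ∈ T1 ∧ ∃ r, 1 / 2 ≤ r ∧ r < 1 ∧ l ≤ ‖Fg g (circleMap 0 r θ)‖} ≤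
      ENNReal.ofReal (144 / l) * ∫⁻ t in T1, ENNReal.ofReal (g t) := by
  set S : ℕ → Set ℝ := fun n => {θ : ℝ | θ ∈ T1 ∧ ∃ r, 1 / 2 ≤ r ∧ r < 1 - 1 / ((n : ℝ) + 2) ∧
    l ≤ ‖Fg g (circleMap 0 r θ)‖} with hS
  have hmono : Monotone S := by
    rintro m n hmn θ ⟨h1, r, h2, h3, h4⟩
    refine ⟨h1, r, h2, h3.trans_le ?_, h4⟩
    have : (m : ℝ) ≤ n := by exact_mod_cast hmn
    gcongr
  have hU : {θ : ℝ | θ ∈ T1 ∧ ∃ r, 1 / 2 ≤ r ∧ r < 1 ∧ l ≤ ‖Fg g (circleMap 0 r θ)‖} ⊆ ⋃ n, S n := by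
    rintro θ ⟨h1, r, h2, h3, h4⟩
    obtain ⟨n, hn⟩ := exists_nat_one_div_lt (sub_pos.2 h3)
    refine mem_iUnion.2 ⟨n, h1, r, h2, ?_, h4⟩
    have : 1 / ((n : ℝ) + 2) ≤ 1 / ((n : ℝ) + 1) := by gcongr; norm_num
    linarith
  refine (measure_mono hU).trans ?_
  rw [hmono.measure_iUnion]
  refine iSup_le fun n => weak_rho g hp hi h0 l hl _ ?_ ?_
  · have : 1 / ((n : ℝ) + 2) ≤ 1 / 2 := by
      gcongr; have : (0:ℝ) ≤ n := n.cast_nonneg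
      linarith
    linarith
  · have : (0:ℝ) < 1 / ((n : ℝ) + 2) := by positivity
    linarith

theorem arctan_ineq (w : ℝ) (hw : 0 ≤ w) :
    w ≤ 2 * (w * Real.arctan w) - Real.log (1 + w ^ 2) + 5 := by
  rcases le_total w 1 with h | h
  · have h1 : Real.log (1 + w ^ 2) ≤ w ^ 2 := by
      have := Real.log_le_sub_one_of_pos (show 0 < 1 + w ^ 2 by positivity); linarith
    have h2 : 0 ≤ w * Real.arctan w := mul_nonneg hw (Real.arctan_nonneg.2 hw)
    nlinarith
  · have h1 : Real.log (1 + w ^ 2) ≤ 2 * Real.log (1 + w) := by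
      rw [← Real.log_rpow (by linarith)]
      apply Real.log_le_log (by positivity)
      norm_num; nlinarith
    have h2 : Real.log (1 + w) ≤ 3 * 0.7 + ((1 + w) / 8 - 1) := by
      have e : Real.log (1 + w) = 3 * Real.log 2 + Real.log ((1 + w) / 8) := by
        rw [show (3 : ℝ) * Real.log 2 = Real.log (2 ^ (3:ℕ)) by rw [Real.log_pow]; norm_num,
          ← Real.log_mul (by norm_num) (by positivity)]
        congr 1; ring
      have := Real.log_le_sub_one_of_pos (show 0 < (1 + w) / 8 by positivity)
      have := Real.log_two_lt_d9
      rw [e]; linarith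
    have h3 : 3 / 4 ≤ Real.arctan w := by
      have : Real.arctan 1 ≤ Real.arctan w := Real.arctan_le_arctan_iff.2 h
      rw [Real.arctan_one] at this
      linarith [Real.pi_gt_three]
    nlinarith

theorem log_pt (z : ℂ) (hz : 1 ≤ z.re) :
    |z.im| ≤ -2 * (z * Complex.log z).re + 2 * (z.re * Real.log z.re) + 5 * z.re := by
  have hu : 0 < z.re := by linarith
  set w := |z.im| / z.re with hw
  have hw0 : 0 ≤ w := by positivity
  have h := arctan_ineq w hw0
  have harg : Complex.arg z = Real.arctan (z.im / z.re) := by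
    rw [← Complex.tan_arg, Real.arctan_tan]
    · exact (abs_lt.1 (Complex.abs_arg_lt_pi_div_two_iff.2 (Or.inl hu))).1
    · exact (abs_lt.1 (Complex.abs_arg_lt_pi_div_two_iff.2 (Or.inl hu))).2
  have h1 : z.im * Complex.arg z = z.re * (w * Real.arctan w) := by
    rw [harg, hw]
    rcases abs_cases z.im with h | h <;> rw [h.1]
    · field_simp
    · rw [neg_div, Real.arctan_neg]; field_simp
  have h2 : 2 * Real.log ‖z‖ = 2 * Real.log z.re + Real.log (1 + w ^ 2) := by
    rw [show (2:ℝ) * Real.log ‖z‖ = Real.log (‖z‖ ^ 2) by rw [Real.log_pow]; norm_num,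
      show (2:ℝ) * Real.log z.re = Real.log (z.re ^ 2) by rw [Real.log_pow]; norm_num,
      ← Real.log_mul (by positivity) (by positivity)]
    congr 1
    rw [← Complex.normSq_eq_norm_sq, Complex.normSq_apply, hw, div_pow, sq_abs]
    field_simp
  rw [Complex.mul_re, Complex.log_re, Complex.log_im, h1]
  have h3 : |z.im| = z.re * w := by rw [hw]; field_simp
  rw [h3]
  have h4 : z.re * Real.log ‖z‖ = z.re * (Real.log z.re + Real.log (1 + w ^ 2) / 2) := by
    congr 1; linarith
  rw [h4]
  nlinarith

/-- `(b+1) log (b+1)` -/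
def Phi1 (b : ℝ) : ℝ := (b + 1) * Real.log (b + 1)

theorem Phi1_nonneg (b : ℝ) (hb : 0 ≤ b) : 0 ≤ Phi1 b :=
  mul_nonneg (by linarith) (Real.log_nonneg (by linarith))

theorem le_logPlus (b : ℝ) : b ≤ 3 + b * logPlus b := by
  unfold logPlus
  split_ifs with h
  · rcases le_total b 3 with h3 | h3
    · have : 0 ≤ b * Real.log b := mul_nonneg (by linarith) (Real.log_nonneg h.le)
      linarith
    · have : 1 ≤ Real.log b := by
        rw [Real.le_log_iff_exp_le (by linarith)]
        linarith [Real.exp_one_lt_d9]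
      nlinarith
  · simp; linarith

theorem Phi1_le (b : ℝ) (hb : 0 ≤ b) : Phi1 b ≤ 6 + 4 * (b * logPlus b) := by
  have h3 := le_logPlus b
  unfold Phi1 logPlus at *
  split_ifs at * with h
  · have h1 : Real.log (b + 1) ≤ 1 + Real.log b := by
      calc Real.log (b + 1) ≤ Real.log (2 * b) := Real.log_le_log (by linarith) (by linarith)
        _ = Real.log 2 + Real.log b := Real.log_mul (by norm_num) (by linarith)
        _ ≤ _ := by linarith [Real.log_two_lt_d9]
    have h0 : 0 ≤ Real.log b := Real.log_nonneg h.le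
    calc (b + 1) * Real.log (b + 1) ≤ (2 * b) * (1 + Real.log b) := by
          apply mul_le_mul (by linarith) h1 (Real.log_nonneg (by linarith)) (by linarith)
      _ ≤ _ := by nlinarith
  · have : Real.log (b + 1) ≤ b := by
      have := Real.log_le_sub_one_of_pos (show 0 < b + 1 by positivity); linarith
    have h0 : 0 ≤ Real.log (b + 1) := Real.log_nonneg (by linarith)
    nlinarith

theorem logPlus_nonneg (b : ℝ) : 0 ≤ logPlus b := by
  unfold logPlus; split_ifs with h
  · exact Real.log_nonneg h.le
  · exact le_rfl

theorem logPlus_meas : Measurable logPlus := by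
  unfold logPlus
  exact Measurable.ite measurableSet_Ioi Real.measurable_log measurable_const

theorem tangent_ineq (a b : ℝ) (ha : 1 ≤ a) (hb : 0 ≤ b) :
    (b + 1) * (1 + Real.log a) - a ≤ Phi1 b := by
  unfold Phi1
  have h := Real.log_le_sub_one_of_pos (show 0 < a / (b + 1) by positivity)
  rw [Real.log_div (by linarith) (by linarith)] at h
  have h2 : (b + 1) * (Real.log a - Real.log (b + 1)) ≤ (b + 1) * (a / (b + 1) - 1) := by gcongr
  have h3 : (b + 1) * (a / (b + 1) - 1) = a - (b + 1) := by field_simp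
  linarith

theorem Pk_mean (r : ℝ) (h1 : 0 ≤ r) (h2 : r < 1) :
    (2 * Real.pi)⁻¹ * ∫ u in Ioo (-Real.pi) Real.pi, Pk r u = 1 := by
  have h := (poisson_re (fun _ => 1) (by fun_prop) (r * ((1 + r) / 2)) ((1 + r) / 2) 0
    (by positivity) (by nlinarith) (by linarith)).2
  have hq : r * ((1 + r) / 2) / ((1 + r) / 2) = r := by field_simp
  rw [hq] at h
  simpa using h.symm

/-- mean of real part of analytic function -/
theorem mean_re (W : ℂ → ℂ) (hW : DifferentiableOn ℂ W (Metric.ball 0 1)) (r : ℝ)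
    (hr : 0 < r) (hr1 : r < 1) :
    (W 0).re = (2 * Real.pi)⁻¹ * ∫ u in Ioo (-Real.pi) Real.pi, (W (circleMap 0 r (0 - u))).re := by
  have h := (poisson_re W hW 0 r 0 le_rfl hr hr1).2
  have hP : ∀ u, Pk 0 u = 1 := fun u => by simp [Pk]
  simpa [hP] using h

theorem lin3 (a b c : ℝ → ℝ) (ha : IntegrableOn a (Ioo (-Real.pi) Real.pi))
    (hb : IntegrableOn b (Ioo (-Real.pi) Real.pi)) (hc : IntegrableOn c (Ioo (-Real.pi) Real.pi)) :
    ∫ u in Ioo (-Real.pi) Real.pi, ((-2) * a u + 2 * b u + 5 * c u) =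
      (-2) * (∫ u in Ioo (-Real.pi) Real.pi, a u) + 2 * (∫ u in Ioo (-Real.pi) Real.pi, b u) +
        5 * (∫ u in Ioo (-Real.pi) Real.pi, c u) := by
  have i12 : IntegrableOn (fun u => (-2) * a u + 2 * b u) (Ioo (-Real.pi) Real.pi) :=
    (ha.const_mul (-2)).add (hb.const_mul 2)
  rw [integral_add i12 (hc.const_mul 5), integral_add (ha.const_mul (-2)) (hb.const_mul 2),
    integral_const_mul, integral_const_mul, integral_const_mul]

theorem llogl_nonneg (g : ℝ → ℝ) (hgm : Measurable g) (hp : Function.Periodic g (2 * Real.pi))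
    (hi : IntegrableOn g T1)
    (h0 : ∀ t, 0 ≤ g t) (hL : IntegrableOn (fun t => g t * logPlus (g t)) T1) (r : ℝ)
    (hr : 0 < r) (hr1 : r < 1) :
    ∫ u in Ioo (-Real.pi) Real.pi, |(Fg g (circleMap 0 r (0 - u))).im| ≤
      300 * (1 + ∫ t in T1, g t * logPlus (g t)) := by
  have hpi := Real.pi_pos
  have hfinv : volume T1 ≠ ⊤ := by rw [T1, Real.volume_Ico]; exact ENNReal.ofReal_ne_top
  have hvol : volume.real T1 = 2 * Real.pi := by
    rw [measureReal_def, T1, Real.volume_Ico, ENNReal.toReal_ofReal (by linarith)]; ring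
  have hci : ∀ c : ℝ, IntegrableOn (fun _ : ℝ => c) T1 := fun c => integrableOn_const hfinv
  -- the auxiliary function Phi1 ∘ g
  have hPm : Measurable fun t => Phi1 (g t) := by unfold Phi1; fun_prop
  have hPp : Function.Periodic (fun t => Phi1 (g t)) (2 * Real.pi) := fun t => by simp only [hp t]
  have hP0 : ∀ t, 0 ≤ Phi1 (g t) := fun t => Phi1_nonneg _ (h0 t)
  have hPi : IntegrableOn (fun t => Phi1 (g t)) T1 := by
    refine Integrable.mono' ((hci 6).add (hL.const_mul 4)) hPm.aestronglyMeasurable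
      (Eventually.of_forall fun t => ?_)
    rw [Real.norm_of_nonneg (hP0 t)]
    exact Phi1_le _ (h0 t)
  have hmem : ∀ r θ : ℝ, 0 ≤ r → r < 1 → circleMap 0 r θ ∈ Metric.ball (0:ℂ) 1 := by
    intro r θ h1 h2; simpa [abs_of_nonneg h1] using h2
  set F : ℂ → ℂ := fun z => Fg g z + 1 with hF
  have hFd : DifferentiableOn ℂ F (Metric.ball 0 1) := (Fg_diff g hp hi).add_const _
  have hFre : ∀ z ∈ Metric.ball (0:ℂ) 1, 1 ≤ (F z).re := fun z hz => by
    have := Fg_re_nonneg g hp hi h0 z hz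
    simp [hF, this]
  have hGd : DifferentiableOn ℂ (fun z => F z * Complex.log (F z)) (Metric.ball 0 1) :=
    hFd.mul (hFd.clog fun z hz => Or.inl (by linarith [hFre z hz]))
  have hz : Fg g 0 = (((2 * Real.pi)⁻¹ * ∫ u in T1, g u : ℝ) : ℂ) := by
    rw [Fg_zero g hp hi h0, integral_eq_lintegral_of_nonneg_ae (Eventually.of_forall h0) hi.1]
  have hzP : Fg (fun t => Phi1 (g t)) 0 = (((2 * Real.pi)⁻¹ * ∫ u in T1, Phi1 (g u) : ℝ) : ℂ) := by
    rw [Fg_zero _ hPp hPi hP0, integral_eq_lintegral_of_nonneg_ae (Eventually.of_forall hP0) hPi.1]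
  have hg0 : 0 ≤ ∫ u in T1, g u := integral_nonneg h0
  have hm1 := mean_re _ hGd r hr hr1
  have hm2 := mean_re F hFd r hr hr1
  have hm3 := mean_re _ (Fg_diff _ hPp hPi) r hr hr1
  have hG0 : 0 ≤ ((fun z => F z * Complex.log (F z)) 0).re := by
    simp only [hF, hz]
    rw [← Complex.ofReal_one, ← Complex.ofReal_add, ← Complex.ofReal_log (by positivity),
      ← Complex.ofReal_mul, Complex.ofReal_re]
    refine mul_nonneg (by positivity) (Real.log_nonneg ?_)
    have : 0 ≤ (2 * Real.pi)⁻¹ * ∫ u in T1, g u := by positivity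
    linarith
  have hjen : ∀ θ, (F (circleMap 0 r θ)).re * Real.log (F (circleMap 0 r θ)).re ≤
      (Fg (fun t => Phi1 (g t)) (circleMap 0 r θ)).re := by
    intro θ
    set a := (F (circleMap 0 r θ)).re with ha
    have ha1 : 1 ≤ a := hFre _ (hmem r θ hr.le hr1)
    have hPc := Pk_cont r hr.le hr1
    have i1 := mul_ker_int g hp hi θ _ hPc
    have i2 := mul_ker_int _ hPp hPi θ _ hPc
    have i3 : IntegrableOn (Pk r) (Ioo (-Real.pi) Real.pi) :=
      (hPc.integrableOn_Icc).mono_set Ioo_subset_Icc_self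
    have haeq : a = (2 * Real.pi)⁻¹ * (∫ u in Ioo (-Real.pi) Real.pi, g (θ - u) * Pk r u) + 1 := by
      rw [ha, hF, ← Fg_re g hp hi r θ hr.le hr1]; simp
    rw [Fg_re _ hPp hPi r θ hr.le hr1]
    have hmono : ∫ u in Ioo (-Real.pi) Real.pi, ((1 + Real.log a) * (g (θ - u) * Pk r u) +
        (1 + Real.log a - a) * Pk r u) ≤ ∫ u in Ioo (-Real.pi) Real.pi, Phi1 (g (θ - u)) * Pk r u := by
      refine integral_mono ((i1.const_mul _).add (i3.const_mul _)) i2 fun u => ?_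
      have := mul_le_mul_of_nonneg_right (tangent_ineq a _ ha1 (h0 (θ - u))) (Pk_nonneg r u hr.le hr1)
      simp only
      linarith
    rw [integral_add (i1.const_mul _) (i3.const_mul _), integral_const_mul, integral_const_mul] at hmono
    have hmean := Pk_mean r hr.le hr1
    have h5 := mul_le_mul_of_nonneg_left hmono (show 0 ≤ (2 * Real.pi)⁻¹ by positivity)
    refine le_trans (le_of_eq ?_) h5
    have h6 : (2 * Real.pi)⁻¹ * (∫ u in Ioo (-Real.pi) Real.pi, g (θ - u) * Pk r u) = a - 1 := by linarith
    linear_combination (-(1 + Real.log a)) * h6 - (1 + Real.log a - a) * hmean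
  -- continuity
  have hcont : ∀ W : ℂ → ℂ, DifferentiableOn ℂ W (Metric.ball 0 1) →
      Continuous fun u : ℝ => W (circleMap 0 r (0 - u)) := fun W hW =>
    hW.continuousOn.comp_continuous (by fun_prop) fun u => hmem r _ hr.le hr1
  have hintc : ∀ q : ℝ → ℝ, Continuous q → IntegrableOn q (Ioo (-Real.pi) Real.pi) := fun q hq =>
    (hq.integrableOn_Icc).mono_set Ioo_subset_Icc_self
  have c1 := Complex.continuous_re.comp (hcont _ hGd)
  have c2 := Complex.continuous_re.comp (hcont _ hFd)
  have c3 := Complex.continuous_re.comp (hcont _ (Fg_diff _ hPp hPi))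
  have c4 := (Complex.continuous_im.comp (hcont _ (Fg_diff _ hp hi))).abs
  have hmain : ∫ u in Ioo (-Real.pi) Real.pi, |(Fg g (circleMap 0 r (0 - u))).im| ≤
      ∫ u in Ioo (-Real.pi) Real.pi, ((-2) * ((fun z => F z * Complex.log (F z)) (circleMap 0 r (0 - u))).re
        + 2 * (Fg (fun t => Phi1 (g t)) (circleMap 0 r (0 - u))).re
        + 5 * (F (circleMap 0 r (0 - u))).re) := by
    refine integral_mono (hintc _ c4) (hintc _ ((((continuous_const.mul c1).add
      (continuous_const.mul c3))).add (continuous_const.mul c2))) fun u => ?_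
    have h := log_pt (F (circleMap 0 r (0 - u))) (hFre _ (hmem r _ hr.le hr1))
    have h' : (F (circleMap 0 r (0 - u))).im = (Fg g (circleMap 0 r (0 - u))).im := by simp [hF]
    rw [h'] at h
    have := hjen (0 - u)
    simp only
    linarith
  have hmain := hmain.trans_eq (lin3 _ _ _ (hintc _ c1) (hintc _ c3) (hintc _ c2))
  have hinv : ∀ a b : ℝ, a = (2 * Real.pi)⁻¹ * b → b = 2 * Real.pi * a := by
    intro a b h; rw [h]; field_simp
  have e1 := hinv _ _ hm1
  have e2 := hinv _ _ hm2
  have e3 := hinv _ _ hm3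
  simp only [Function.comp_def] at hmain
  rw [e1, e2, e3] at hmain
  have e2' : 2 * Real.pi * (F 0).re = (∫ u in T1, g u) + 2 * Real.pi := by
    simp only [hF, hz, Complex.add_re, Complex.ofReal_re, Complex.one_re]; field_simp
  have e3' : 2 * Real.pi * (Fg (fun t => Phi1 (g t)) 0).re = ∫ u in T1, Phi1 (g u) := by
    rw [hzP, Complex.ofReal_re]; field_simp
  rw [e2', e3'] at hmain
  have b1 : ∫ u in T1, g u ≤ 3 * (2 * Real.pi) + ∫ t in T1, g t * logPlus (g t) := by
    have := integral_mono hi ((hci 3).add hL) (fun t => le_logPlus (g t))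
    simp only [Pi.add_apply] at this
    rw [integral_add (hci 3) hL, setIntegral_const, hvol, smul_eq_mul] at this
    linarith
  have b2 : ∫ u in T1, Phi1 (g u) ≤ 6 * (2 * Real.pi) + 4 * ∫ t in T1, g t * logPlus (g t) := by
    have := integral_mono hPi ((hci 6).add (hL.const_mul 4)) (fun t => Phi1_le (g t) (h0 t))
    simp only [Pi.add_apply] at this
    rw [integral_add (hci 6) (hL.const_mul 4), setIntegral_const, hvol, smul_eq_mul,
      integral_const_mul] at this
    linarith
  have hL0 : 0 ≤ ∫ t in T1, g t * logPlus (g t) :=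
    integral_nonneg fun t => mul_nonneg (h0 t) (logPlus_nonneg _)
  have hG0' := mul_nonneg (show 0 ≤ 2 * Real.pi by positivity) hG0
  have := Real.pi_lt_d2
  simp only at hG0' hmain
  linarith

theorem kap_tendsto (φ : ℝ → ℝ≥0∞) (hφ : Measurable φ) (hfin : ∫⁻ u, φ u ≠ ⊤)
    (h : ∀ η : ℝ, 0 < η → ∃ δ > 0, ∀ t, 0 < t → t ≤ δ →
      ∫⁻ u in {u | |u| < t}, φ u ≤ ENNReal.ofReal (t * η)) :
    Tendsto (fun ε => ∫⁻ u, ENNReal.ofReal (kap ε u) * φ u) (𝓝[>] 0) (𝓝 0) := by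
  rw [ENNReal.tendsto_nhds_zero]
  intro e he
  have he3 : 0 < e / 3 := ENNReal.div_pos he.ne' (by simp)
  obtain ⟨η, hη0, hη⟩ := ENNReal.lt_iff_exists_nnreal_btwn.1 he3
  have hη0' : 0 < (η : ℝ) := by exact_mod_cast hη0
  obtain ⟨δ, hδ, hd⟩ := h η hη0'
  have h2 : Tendsto (fun ε : ℝ => ENNReal.ofReal (ε / δ ^ 2) * ∫⁻ u, φ u) (𝓝[>] 0) (𝓝 0) := by
    have h3 : Tendsto (fun ε : ℝ => ENNReal.ofReal (ε / δ ^ 2)) (𝓝[>] 0) (𝓝 (ENNReal.ofReal (0 / δ ^ 2))) :=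
      (ENNReal.continuous_ofReal.tendsto _).comp
        ((continuous_id.div_const (δ^2)).tendsto 0 |>.mono_left nhdsWithin_le_nhds)
    have := ENNReal.Tendsto.mul_const h3 (Or.inr hfin)
    simpa using this
  rw [ENNReal.tendsto_nhds_zero] at h2
  filter_upwards [h2 η hη0, self_mem_nhdsWithin] with ε hε hε0
  have hε0 : 0 < ε := hε0
  have hm1 : MeasurableSet {u : ℝ | |u| < δ} := measurableSet_lt (by fun_prop) (by fun_prop)
  have hkm : Measurable fun u => ENNReal.ofReal (ε / (max ε |u|) ^ 2) := by fun_prop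
  have hb := kap_bound ({u : ℝ | |u| < δ}.indicator φ) (hφ.indicator hm1) ε hε0 η (by
    intro t ht
    have ht0 : 0 < t := hε0.trans_le ht
    rw [setLIntegral_indicator hm1]
    have : {u : ℝ | |u| < δ} ∩ {u | |u| < t} = {u | |u| < min t δ} := by
      ext u; simp only [mem_inter_iff, mem_ofPred_eq, lt_min_iff]; tauto
    rw [this]
    refine (hd _ (lt_min ht0 hδ) (min_le_right _ _)).trans ?_
    rw [ENNReal.ofReal_mul (by positivity), ENNReal.ofReal_coe_nnreal]
    gcongr
    exact min_le_left _ _)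
  have hle : ∀ u, ENNReal.ofReal (kap ε u) * φ u ≤
      ENNReal.ofReal (ε / (max ε |u|) ^ 2) * {u : ℝ | |u| < δ}.indicator φ u +
        ENNReal.ofReal (ε / δ ^ 2) * φ u := by
    intro u
    by_cases hu : |u| < δ
    · rw [indicator_of_mem (by simpa using hu)]
      exact le_self_add
    · refine le_trans ?_ le_add_self
      have : δ ≤ |u| := not_lt.1 hu
      unfold kap
      gcongr
      exact this.trans (le_max_right _ _)
  calc _ ≤ ∫⁻ u, (ENNReal.ofReal (ε / (max ε |u|) ^ 2) * {u : ℝ | |u| < δ}.indicator φ u +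
        ENNReal.ofReal (ε / δ ^ 2) * φ u) := lintegral_mono hle
    _ = (∫⁻ u, ENNReal.ofReal (ε / (max ε |u|) ^ 2) * {u : ℝ | |u| < δ}.indicator φ u) +
        ENNReal.ofReal (ε / δ ^ 2) * ∫⁻ u, φ u := by
      have hkm' : Measurable fun u => ENNReal.ofReal (ε / (max ε |u|) ^ 2) *
        {u : ℝ | |u| < δ}.indicator φ u := hkm.mul (hφ.indicator hm1)
      rw [lintegral_add_left hkm', lintegral_const_mul _ hφ]
    _ ≤ 2 * η + η := add_le_add hb hε
    _ = 3 * (η : ℝ≥0∞) := by ring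
    _ ≤ e := by
      have := ENNReal.mul_le_of_le_div hη.le
      rwa [mul_comm] at this

theorem leb_pt (h : ℝ → ℝ) (hl : LocallyIntegrable h) :
    ∀ᵐ x : ℝ, ∀ η : ℝ, 0 < η → ∃ δ > 0, ∀ t, 0 < t → t ≤ δ →
      ∫⁻ u in {u | |u| < t}, ‖h (x - u) - h x‖ₑ ≤ ENNReal.ofReal (t * η) := by
  filter_upwards [VitaliFamily.ae_tendsto_lintegral_enorm_sub_div
    (IsUnifLocDoublingMeasure.vitaliFamily volume 1) hl] with x hx η hη
  have h1 := hx.comp (IsUnifLocDoublingMeasure.tendsto_closedBall_filterAt volume (K := 1) (x := x)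
    (fun _ : ℝ => x) (fun t => t) (l := 𝓝[>] 0) tendsto_id (by
      filter_upwards [self_mem_nhdsWithin] with t ht
      exact Metric.mem_closedBall_self (by simpa using le_of_lt ht)))
  rw [ENNReal.tendsto_nhds_zero] at h1
  have h2 := h1 (ENNReal.ofReal (η / 2)) (by simpa using hη)
  obtain ⟨δ, hδ, hd⟩ := (nhdsGT_basis (0:ℝ)).eventually_iff.1 h2
  refine ⟨δ / 2, by positivity, fun t ht htd => ?_⟩
  have h3 := hd (show t ∈ Ioo 0 δ from ⟨ht, by linarith⟩)
  simp only [Function.comp_apply, Real.volume_closedBall] at h3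
  rw [ENNReal.div_le_iff (by simpa using ht) ENNReal.ofReal_ne_top, ← ENNReal.ofReal_mul (by positivity)] at h3
  have h4 : ∫⁻ u in {u | |u| < t}, ‖h (x - u) - h x‖ₑ ≤ ∫⁻ y in Metric.closedBall x t, ‖h y - h x‖ₑ := by
    rw [← lintegral_indicator (measurableSet_lt (by fun_prop) (by fun_prop)),
      ← lintegral_indicator Metric.isClosed_closedBall.measurableSet,
      ← lintegral_sub_left_eq_self ((Metric.closedBall x t).indicator fun y => ‖h y - h x‖ₑ) x]
    refine lintegral_mono fun u => ?_
    by_cases hu : |u| < t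
    · rw [indicator_of_mem (by simpa using hu), indicator_of_mem (by
        simp only [Metric.mem_closedBall, Real.dist_eq]; rw [sub_sub_cancel_left, abs_neg]; exact hu.le)]
    · rw [indicator_of_notMem (by simpa using hu)]; exact zero_le
  refine (h4.trans h3).trans (le_of_eq ?_)
  congr 1; ring

theorem odd_int (q : ℝ → ℝ) (hq : ∀ u, q (-u) = -q u) :
    ∫ u in Ioo (-Real.pi) Real.pi, q u = 0 := by
  rw [← integral_indicator measurableSet_Ioo]
  have h := integral_neg_eq_self ((Ioo (-Real.pi) Real.pi).indicator q) volume
  have h2 : ∀ u, (Ioo (-Real.pi) Real.pi).indicator q (-u) = -(Ioo (-Real.pi) Real.pi).indicator q u := by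
    intro u
    by_cases hu : u ∈ Ioo (-Real.pi) Real.pi
    · rw [indicator_of_mem hu, indicator_of_mem (by
        rw [mem_Ioo] at hu ⊢; constructor <;> linarith [hu.1, hu.2]), hq]
    · rw [indicator_of_notMem hu, indicator_of_notMem (by
        rw [mem_Ioo] at hu ⊢; intro h; exact hu ⟨by linarith [h.2], by linarith [h.1]⟩), neg_zero]
  simp only [h2, integral_neg] at h
  linarith

theorem bdd_ker_int (g : ℝ → ℝ) (hp : Function.Periodic g (2 * Real.pi)) (hi : IntegrableOn g T1)
    (θ : ℝ) (k : ℝ → ℝ) (hk : Measurable k) (C : ℝ) (hC : ∀ u ∈ Ioo (-Real.pi) Real.pi, |k u| ≤ C) :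
    IntegrableOn (fun u => g (θ - u) * k u) (Ioo (-Real.pi) Real.pi) := by
  refine Integrable.mul_bdd (c := C) (per_int_sub g hp hi θ) hk.aestronglyMeasurable ?_
  exact (ae_restrict_iff' measurableSet_Ioo).2 (Eventually.of_forall hC)

/-- difference of conjugate Poisson kernel and truncated kernel -/
def Dk (r u : ℝ) : ℝ := Qk r u - {u : ℝ | 1 - r < |u|}.indicator (fun u => 2 * kk u) u

theorem Dk_neg (r u : ℝ) : Dk r (-u) = - Dk r u := by
  unfold Dk Qk
  have : {u : ℝ | 1 - r < |u|}.indicator (fun u => 2 * kk u) (-u) =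
      - {u : ℝ | 1 - r < |u|}.indicator (fun u => 2 * kk u) u := by
    simp only [indicator, mem_ofPred_eq, abs_neg, kk_neg]
    split_ifs <;> ring
  rw [this, Real.sin_neg, Real.cos_neg]; ring

theorem tr_meas (ε : ℝ) : MeasurableSet {u : ℝ | ε < |u|} := measurableSet_lt (by fun_prop) (by fun_prop)

theorem mem_Ioo_abs (u : ℝ) : u ∈ Ioo (-Real.pi) Real.pi ↔ |u| < Real.pi := by
  rw [mem_Ioo, abs_lt]

theorem Dk_meas (r : ℝ) (h1 : 0 ≤ r) (h2 : r < 1) : Measurable (Dk r) := by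
  unfold Dk
  exact (Qk_cont r h1 h2).measurable.sub ((kk_meas.const_mul 2).indicator (tr_meas _))

theorem Dk_bdd (r : ℝ) (h1 : 1/2 ≤ r) (h2 : r < 1) (u : ℝ) (hu : u ∈ Ioo (-Real.pi) Real.pi) :
    |Dk r u| ≤ 10 / (1 - r) := by
  refine (Qk_le r u h1 h2 ((mem_Ioo_abs u).1 hu)).trans ?_
  have : 0 < 1 - r := by linarith
  unfold kap
  have h3 : (1 - r) / (max (1 - r) |u|) ^ 2 ≤ (1 - r) / (1 - r) ^ 2 := by
    gcongr; exact le_max_left _ _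
  calc 10 * ((1 - r) / (max (1 - r) |u|) ^ 2) ≤ 10 * ((1 - r) / (1 - r) ^ 2) := by gcongr
    _ = 10 / (1 - r) := by field_simp

theorem pvset_eq (ε : ℝ) : {t : ℝ | ε < |t| ∧ |t| < Real.pi} = {u : ℝ | ε < |u|} ∩ Ioo (-Real.pi) Real.pi := by
  ext u; simp only [mem_inter_iff, mem_ofPred_eq, mem_Ioo_abs]

theorem tr_bdd (ε : ℝ) (hε : 0 < ε) (u : ℝ) (hu : u ∈ Ioo (-Real.pi) Real.pi) :
    |{u : ℝ | ε < |u|}.indicator kk u| ≤ 1 / ε := by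
  by_cases h : ε < |u|
  · rw [indicator_of_mem (by simpa using h)]
    exact (kk_bound u ((mem_Ioo_abs u).1 hu)).trans (one_div_le_one_div_of_le hε h.le)
  · rw [indicator_of_notMem (by simpa using h), abs_zero]; positivity

theorem setIntegral_indicator' {s t : Set ℝ} (hs : MeasurableSet s) {q : ℝ → ℝ} :
    ∫ u in t, s.indicator q u = ∫ u in s ∩ t, q u := by
  rw [setIntegral_indicator hs, inter_comm]

theorem indicator_const_mul' {s : Set ℝ} (q : ℝ → ℝ) (u : ℝ) :
    s.indicator (fun u => 2 * q u) u = 2 * s.indicator q u := by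
  simp only [indicator]; split_ifs <;> simp

theorem pv_split (g : ℝ → ℝ) (hp : Function.Periodic g (2 * Real.pi)) (hi : IntegrableOn g T1)
    (r θ : ℝ) (h1 : 1/2 ≤ r) (h2 : r < 1) :
    (Fg g (circleMap 0 r θ)).im =
      (1 / Real.pi) * (∫ u in {t : ℝ | 1 - r < |t| ∧ |t| < Real.pi}, g (θ - u) * kk u) +
      (2 * Real.pi)⁻¹ * ∫ u in Ioo (-Real.pi) Real.pi, g (θ - u) * Dk r u := by
  rw [Fg_im g hp hi r θ (by linarith) h2, pvset_eq, ← setIntegral_indicator' (tr_meas _)]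
  have i1 : IntegrableOn (fun u => g (θ - u) * {u : ℝ | 1 - r < |u|}.indicator kk u)
      (Ioo (-Real.pi) Real.pi) := bdd_ker_int g hp hi θ _ (kk_meas.indicator (tr_meas _)) _
        (tr_bdd (1 - r) (by linarith))
  have i2 : IntegrableOn (fun u => g (θ - u) * Dk r u) (Ioo (-Real.pi) Real.pi) :=
    bdd_ker_int g hp hi θ _ (Dk_meas r (by linarith) h2) _ (Dk_bdd r h1 h2)
  have e : ∀ u, g (θ - u) * Qk r u =
      2 * (g (θ - u) * {u : ℝ | 1 - r < |u|}.indicator kk u) + g (θ - u) * Dk r u := by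
    intro u
    unfold Dk
    rw [indicator_const_mul']
    ring
  simp only [e]
  rw [integral_add (i1.const_mul 2) i2, integral_const_mul]
  have : ∀ u, {u : ℝ | 1 - r < |u|}.indicator (fun u => g (θ - u) * kk u) u =
    g (θ - u) * {u : ℝ | 1 - r < |u|}.indicator kk u := by
    intro u; simp only [indicator]; split_ifs <;> simp
  simp only [this]
  field_simp

theorem Dk_enorm_le (q : ℝ → ℝ) (r : ℝ) (h1 : 1/2 ≤ r) (h2 : r < 1) :
    ‖∫ u in Ioo (-Real.pi) Real.pi, q u * Dk r u‖ₑ ≤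
      10 * ∫⁻ u in Ioo (-Real.pi) Real.pi, ENNReal.ofReal (kap (1 - r) u) * ‖q u‖ₑ := by
  refine (enorm_integral_le_lintegral_enorm _).trans ?_
  rw [← lintegral_const_mul' _ _ (by simp)]
  refine setLIntegral_mono' measurableSet_Ioo fun u hu => ?_
  have h := Qk_le r u h1 h2 ((mem_Ioo_abs u).1 hu)
  rw [enorm_mul]
  have : ‖Dk r u‖ₑ ≤ 10 * ENNReal.ofReal (kap (1 - r) u) := by
    rw [← ofReal_norm, Real.norm_eq_abs, show (10 : ℝ≥0∞) = ENNReal.ofReal 10 by simp,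
      ← ENNReal.ofReal_mul (by norm_num)]
    exact ENNReal.ofReal_le_ofReal h
  calc ‖q u‖ₑ * ‖Dk r u‖ₑ ≤ ‖q u‖ₑ * (10 * ENNReal.ofReal (kap (1 - r) u)) := by gcongr
    _ = _ := by ring

theorem Dk_tendsto (g : ℝ → ℝ) (hm : Measurable g) (hp : Function.Periodic g (2 * Real.pi))
    (hi : IntegrableOn g T1) (x : ℝ)
    (hx : ∀ η : ℝ, 0 < η → ∃ δ > 0, ∀ t, 0 < t → t ≤ δ →
      ∫⁻ u in {u | |u| < t}, ‖g (x - u) - g x‖ₑ ≤ ENNReal.ofReal (t * η)) :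
    Tendsto (fun ε => ∫ u in Ioo (-Real.pi) Real.pi, g (x - u) * Dk (1 - ε) u) (𝓝[>] 0) (𝓝 0) := by
  rw [tendsto_zero_iff_norm_tendsto_zero]
  set φ : ℝ → ℝ≥0∞ := (Ioo (-Real.pi) Real.pi).indicator fun u => ‖g (x - u) - g x‖ₑ with hφ
  have hqm : Measurable fun u => ‖g (x - u) - g x‖ₑ := by fun_prop
  have hφm : Measurable φ := hqm.indicator measurableSet_Ioo
  have hφi : ∫⁻ u, φ u ≠ ⊤ := by
    rw [hφ, lintegral_indicator measurableSet_Ioo]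
    have hc : IntegrableOn (fun _ : ℝ => g x) (Ioo (-Real.pi) Real.pi) :=
      integrableOn_const (by rw [Real.volume_Ioo]; exact ENNReal.ofReal_ne_top)
    exact ((per_int_sub g hp hi x).sub hc).2.ne
  have hk := kap_tendsto φ hφm hφi (by
    intro η hη
    obtain ⟨δ, hδ, hd⟩ := hx η hη
    refine ⟨δ, hδ, fun t ht htd => le_trans (lintegral_mono fun u => ?_) (hd t ht htd)⟩
    exact indicator_le_self _ _ _)
  have hk10 : Tendsto (fun ε => (10 * ∫⁻ u, ENNReal.ofReal (kap ε u) * φ u).toReal) (𝓝[>] 0) (𝓝 0) := by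
    have := ENNReal.Tendsto.const_mul (a := 10) hk (Or.inr (by simp))
    rw [mul_zero] at this
    have h9 := (ENNReal.tendsto_toReal ENNReal.zero_ne_top).comp this
    rw [ENNReal.toReal_zero] at h9
    exact h9
  have hfe : ∀ᶠ ε : ℝ in 𝓝[>] 0, 10 * ∫⁻ u, ENNReal.ofReal (kap ε u) * φ u < ⊤ := by
    have := ENNReal.Tendsto.const_mul (a := 10) hk (Or.inr (by simp))
    rw [mul_zero] at this
    exact this.eventually_lt_const (by simp)
  refine squeeze_zero' (Eventually.of_forall fun _ => norm_nonneg _) ?_ hk10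
  have hsm : ∀ᶠ ε : ℝ in 𝓝[>] 0, ε < 1/2 := nhdsWithin_le_nhds (eventually_lt_nhds (by norm_num))
  filter_upwards [hfe, hsm, self_mem_nhdsWithin] with ε h1 h2 h3
  have h3 : 0 < ε := h3
  have e1 : ∫ u in Ioo (-Real.pi) Real.pi, g (x - u) * Dk (1 - ε) u =
      ∫ u in Ioo (-Real.pi) Real.pi, (g (x - u) - g x) * Dk (1 - ε) u := by
    have i1 := bdd_ker_int g hp hi x _ (Dk_meas (1 - ε) (by linarith) (by linarith)) _
      (Dk_bdd (1 - ε) (by linarith) (by linarith))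
    have i2 : IntegrableOn (Dk (1 - ε)) (Ioo (-Real.pi) Real.pi) := by
      refine Integrable.of_bound (C := 10 / (1 - (1 - ε))) (Dk_meas (1 - ε) (by linarith) (by linarith)).aestronglyMeasurable ?_
      exact (ae_restrict_iff' measurableSet_Ioo).2 (Eventually.of_forall (Dk_bdd (1 - ε) (by linarith) (by linarith)))
    simp only [sub_mul]
    rw [integral_sub i1 (i2.const_mul _), integral_const_mul, odd_int _ (Dk_neg (1 - ε))]
    simp
  have h4 := Dk_enorm_le (fun u => g (x - u) - g x) (1 - ε) (by linarith) (by linarith)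
  rw [sub_sub_cancel, ← lintegral_indicator measurableSet_Ioo] at h4
  have e2 : ∀ u, (Ioo (-Real.pi) Real.pi).indicator
      (fun u => ENNReal.ofReal (kap ε u) * ‖g (x - u) - g x‖ₑ) u = ENNReal.ofReal (kap ε u) * φ u := by
    intro u; simp only [hφ, indicator]; split_ifs <;> simp
  simp only [e2] at h4
  rw [e1, ← toReal_enorm]
  exact ENNReal.toReal_mono h1.ne h4

theorem loc_int (g : ℝ → ℝ) (hp : Function.Periodic g (2 * Real.pi)) (hi : IntegrableOn g T1) :
    LocallyIntegrable g := by
  rw [locallyIntegrable_iff]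
  intro k hk
  obtain ⟨R, hR⟩ := hk.isBounded.subset_closedBall 0
  rw [Real.closedBall_eq_Icc] at hR
  refine IntegrableOn.mono_set ?_ hR
  by_cases h : (0 - R) ≤ 0 + R
  · exact (intervalIntegrable_iff_integrableOn_Icc_of_le h).1 (per_int g hp hi _ _)
  · rw [Icc_eq_empty h]; exact integrableOn_empty

theorem neg_pv (g : ℝ → ℝ) (x ε : ℝ) :
    ∫ v in {t : ℝ | ε < |t| ∧ |t| < Real.pi}, (1 / Real.pi) * (g (x + v) / (2 * Real.tan (v / 2))) =
    -((1 / Real.pi) * (∫ u in {t : ℝ | ε < |t| ∧ |t| < Real.pi}, g (x - u) * kk u)) := by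
  have hms : MeasurableSet {t : ℝ | ε < |t| ∧ |t| < Real.pi} := by
    rw [pvset_eq]; exact (tr_meas _).inter measurableSet_Ioo
  rw [integral_const_mul, ← mul_neg, ← integral_neg, ← integral_indicator hms, ← integral_indicator hms,
    ← integral_neg_eq_self]
  congr 2
  ext u
  simp only [indicator, mem_ofPred_eq, abs_neg]
  split_ifs
  · have := kk_neg u
    simp only [kk] at this ⊢
    rw [div_eq_mul_one_div, this, sub_eq_add_neg]; ring
  · rfl

theorem Fg_im_tendsto (g : ℝ → ℝ) (hm : Measurable g) (hp : Function.Periodic g (2 * Real.pi))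
    (hi : IntegrableOn g T1) (H : ℝ → ℝ)
    (hH : ∀ᵐ x, pvT1 (fun v => (1 / Real.pi) * (g (x + v) / (2 * Real.tan (v / 2)))) (H x)) :
    ∀ᵐ x, Tendsto (fun ε => (Fg g (circleMap 0 (1 - ε) x)).im) (𝓝[>] 0) (𝓝 (-H x)) := by
  filter_upwards [hH, leb_pt g (loc_int g hp hi)] with x h1 h2
  have h3 := Dk_tendsto g hm hp hi x h2
  have h4 := h1.neg.add (h3.const_mul (2 * Real.pi)⁻¹)
  rw [mul_zero, add_zero] at h4
  refine h4.congr' ?_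
  have hsm : ∀ᶠ ε : ℝ in 𝓝[>] 0, ε < 1/2 := nhdsWithin_le_nhds (eventually_lt_nhds (by norm_num))
  filter_upwards [hsm, self_mem_nhdsWithin] with ε h5 h6
  have h6 : 0 < ε := h6
  rw [pv_split g hp hi (1 - ε) x (by linarith) (by linarith), neg_pv, neg_neg, sub_sub_cancel]

theorem llogl_sub (g : ℝ → ℝ) (hgm : Measurable g) (hp : Function.Periodic g (2 * Real.pi))
    (hi : IntegrableOn g T1) (hL : IntegrableOn (fun t => |g t| * logPlus |g t|) T1) (r : ℝ)
    (hr : 0 < r) (hr1 : r < 1) :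
    ∫ u in Ioo (-Real.pi) Real.pi, |(Fg g (circleMap 0 r (0 - u))).im| ≤
      600 * (1 + ∫ t in T1, |g t| * logPlus |g t|) := by
  have key : ∀ k : ℝ → ℝ, Measurable k → Function.Periodic k (2 * Real.pi) → (∀ t, 0 ≤ k t) →
      (∀ t, k t ≤ |g t|) → IntegrableOn k T1 ∧ ∫ u in Ioo (-Real.pi) Real.pi, |(Fg k (circleMap 0 r (0 - u))).im| ≤
      300 * (1 + ∫ t in T1, |g t| * logPlus |g t|) := by
    intro k hk hkp hk0 hkg
    have hki : IntegrableOn k T1 := hi.abs.mono' hk.aestronglyMeasurable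
      (Eventually.of_forall fun t => by rw [Real.norm_of_nonneg (hk0 t)]; exact hkg t)
    have hle : ∀ t, k t * logPlus (k t) ≤ |g t| * logPlus |g t| := by
      intro t
      refine mul_le_mul (hkg t) ?_ (logPlus_nonneg _) (abs_nonneg _)
      unfold logPlus
      split_ifs with h1 h2 h2
      · exact Real.log_le_log (by linarith) (hkg t)
      · exact absurd (h1.trans_le (hkg t)) h2
      · exact Real.log_nonneg h2.le
      · exact le_rfl
    have hkL : IntegrableOn (fun t => k t * logPlus (k t)) T1 := hL.mono'
      (hk.mul (logPlus_meas.comp hk)).aestronglyMeasurable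
      (Eventually.of_forall fun t => by
        rw [Real.norm_of_nonneg (mul_nonneg (hk0 t) (logPlus_nonneg _))]; exact hle t)
    refine ⟨hki, (llogl_nonneg k hk hkp hki hk0 hkL r hr hr1).trans ?_⟩
    have := integral_mono hkL hL hle
    linarith
  have hpp : Function.Periodic (fun t => max (g t) 0) (2 * Real.pi) := fun t => by simp only [hp t]
  have hnp : Function.Periodic (fun t => max (-g t) 0) (2 * Real.pi) := fun t => by simp only [hp t]
  obtain ⟨ip, hbp⟩ := key (fun t => max (g t) 0) (by fun_prop) hpp (fun t => le_max_right _ _)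
    (fun t => max_le (le_abs_self _) (abs_nonneg _))
  obtain ⟨im, hbm⟩ := key (fun t => max (-g t) 0) (by fun_prop) hnp (fun t => le_max_right _ _)
    (fun t => max_le (neg_le_abs _) (abs_nonneg _))
  have hdec : ∀ θ, (Fg g (circleMap 0 r θ)).im = (Fg (fun t => max (g t) 0) (circleMap 0 r θ)).im -
      (Fg (fun t => max (-g t) 0) (circleMap 0 r θ)).im := by
    intro θ
    rw [Fg_im g hp hi r θ hr.le hr1, Fg_im _ hpp ip r θ hr.le hr1, Fg_im _ hnp im r θ hr.le hr1, ← mul_sub,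
      ← integral_sub (mul_ker_int _ hpp ip θ _ (Qk_cont r hr.le hr1)) (mul_ker_int _ hnp im θ _ (Qk_cont r hr.le hr1))]
    congr 2
    ext u
    rw [← sub_mul]
    congr 1
    have := max_zero_sub_max_neg_zero_eq_self (g (θ - u))
    linarith
  have hcont : ∀ k : ℝ → ℝ, Function.Periodic k (2 * Real.pi) → IntegrableOn k T1 →
      IntegrableOn (fun u => |(Fg k (circleMap 0 r (0 - u))).im|) (Ioo (-Real.pi) Real.pi) := by
    intro k h1 h2
    have : Continuous fun u : ℝ => Fg k (circleMap 0 r (0 - u)) :=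
      (Fg_diff k h1 h2).continuousOn.comp_continuous (by fun_prop) fun u => by
        simpa [abs_of_pos hr] using hr1
    exact ((Complex.continuous_im.comp this).abs.integrableOn_Icc).mono_set Ioo_subset_Icc_self
  have := integral_mono (hcont g hp hi) ((hcont _ hpp ip).add (hcont _ hnp im)) (fun u => by
    simp only [Pi.add_apply, hdec]
    exact abs_sub _ _)
  rw [integral_add' (hcont _ hpp ip) (hcont _ hnp im)] at this
  linarith

theorem zyg (g : ℝ → ℝ) (hm : Measurable g) (hp : Function.Periodic g (2 * Real.pi))
    (hi : IntegrableOn g T1) (hL : IntegrableOn (fun t => |g t| * logPlus |g t|) T1) (H : ℝ → ℝ)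
    (hH : ∀ᵐ x, pvT1 (fun v => (1 / Real.pi) * (g (x + v) / (2 * Real.tan (v / 2)))) (H x)) :
    ∫⁻ x in T1, ‖H x‖ₑ ≤ ENNReal.ofReal (600 * (1 + ∫ t in T1, |g t| * logPlus |g t|)) := by
  have hlim := Fg_im_tendsto g hm hp hi H hH
  set ε : ℕ → ℝ := fun n => 1 / ((n : ℝ) + 2) with hε
  have hε0 : ∀ n, 0 < ε n := fun n => by simp only [hε]; positivity
  have hε1 : ∀ n, ε n < 1 := fun n => by
    simp only [hε]; rw [div_lt_one (by positivity)]; have : (0:ℝ) ≤ n := n.cast_nonneg; linarith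
  have hεl : Tendsto ε atTop (𝓝[>] 0) := by
    refine tendsto_nhdsWithin_iff.2 ⟨?_, Eventually.of_forall hε0⟩
    exact tendsto_const_nhds.div_atTop (tendsto_natCast_atTop_atTop.atTop_add tendsto_const_nhds)
  set W : ℕ → ℝ → ℝ := fun n x => (Fg g (circleMap 0 (1 - ε n) x)).im with hW
  have hWc : ∀ n, Continuous (W n) := fun n => by
    have h1 := hε0 n
    have h2 := hε1 n
    have : Continuous fun u : ℝ => Fg g (circleMap 0 (1 - ε n) u) :=
      (Fg_diff g hp hi).continuousOn.comp_continuous (by fun_prop) fun u => by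
        simp [abs_lt]; constructor <;> linarith
    exact Complex.continuous_im.comp this
  have hWb : ∀ n, ∫⁻ x in T1, ‖W n x‖ₑ ≤ ENNReal.ofReal (600 * (1 + ∫ t in T1, |g t| * logPlus |g t|)) := by
    intro n
    have h1 := hε0 n
    have h2 := hε1 n
    rw [← per_sub (fun x => ‖W n x‖ₑ) (fun x => by
      simp only [hW]; rw [show circleMap 0 (1 - ε n) (x + 2 * Real.pi) = circleMap 0 (1 - ε n) x from
        periodic_circleMap _ _ x]) 0]
    have h3 := llogl_sub g hm hp hi hL (1 - ε n) (by linarith) (by linarith)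
    refine le_trans (le_of_eq ?_) (ENNReal.ofReal_le_ofReal h3)
    have hci : IntegrableOn (fun u => |(Fg g (circleMap 0 (1 - ε n) (0 - u))).im|) (Ioo (-Real.pi) Real.pi) := 
      (((hWc n).comp (continuous_const.sub continuous_id)).abs.integrableOn_Icc).mono_set Ioo_subset_Icc_self
    rw [ofReal_integral_eq_lintegral_ofReal hci (Eventually.of_forall fun u => abs_nonneg _)]
    refine lintegral_congr fun u => ?_
    rw [← ofReal_norm, Real.norm_eq_abs]
  calc ∫⁻ x in T1, ‖H x‖ₑ = ∫⁻ x in T1, liminf (fun n => ‖W n x‖ₑ) atTop := by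
        refine lintegral_congr_ae (ae_restrict_of_ae ?_)
        filter_upwards [hlim] with x hx
        have := ((hx.comp hεl).enorm).liminf_eq
        rw [enorm_neg] at this
        exact this.symm
    _ ≤ liminf (fun n => ∫⁻ x in T1, ‖W n x‖ₑ) atTop :=
        lintegral_liminf_le fun n => (hWc n).measurable.enorm
    _ ≤ _ := liminf_le_of_le (by isBoundedDefault) fun b hb => by
        obtain ⟨n, hn⟩ := hb.exists
        exact hn.trans (hWb n)

theorem toReal_bd (x : ℝ) (B : ℝ) (hB : 0 ≤ B) (h : ‖x‖ₑ ≤ ENNReal.ofReal B) : |x| ≤ B := by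
  rw [← ofReal_norm, Real.norm_eq_abs] at h
  exact (ENNReal.ofReal_le_ofReal_iff hB).1 h

theorem est (g : ℝ → ℝ) (y A : ℝ) (hA : 0 < A) (hy : y ∈ T1) (h : avgLe (fun t => ‖g t‖ₑ) y A)
    (K : ℝ → ℝ) (B t : ℝ) (hB : 0 ≤ B) (ht : 0 < t)
    (hK : ∀ u ∈ Ioo (-Real.pi) Real.pi, |K u| ≤ {u : ℝ | |u| < t}.indicator (fun _ => B) u) :
    |∫ u in Ioo (-Real.pi) Real.pi, g (y - u) * K u| ≤ B * t * A := by
  have hpi := Real.pi_pos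
  have hms : ∀ t, MeasurableSet {u : ℝ | |u| < t} := fun t => measurableSet_lt (by fun_prop) (by fun_prop)
  refine toReal_bd _ _ (by positivity) ?_
  refine (enorm_integral_le_lintegral_enorm _).trans ?_
  have h1 : ∀ u ∈ Ioo (-Real.pi) Real.pi, ‖g (y - u) * K u‖ₑ ≤
      {u : ℝ | |u| < min t Real.pi}.indicator (fun u => ENNReal.ofReal B * ‖g (y - u)‖ₑ) u := by
    intro u hu
    have hk := hK u hu
    have hu' := (mem_Ioo_abs u).1 hu
    rw [enorm_mul]
    by_cases hc : |u| < t
    · rw [indicator_of_mem (by simpa using hc)] at hk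
      rw [indicator_of_mem (by simpa using ⟨hc, hu'⟩), mul_comm]
      gcongr
      rw [← ofReal_norm, Real.norm_eq_abs]
      exact ENNReal.ofReal_le_ofReal hk
    · rw [indicator_of_notMem (by simpa using hc)] at hk
      have : K u = 0 := abs_nonpos_iff.1 hk
      simp [this]
  calc _ ≤ ∫⁻ u in Ioo (-Real.pi) Real.pi,
      {u : ℝ | |u| < min t Real.pi}.indicator (fun u => ENNReal.ofReal B * ‖g (y - u)‖ₑ) u :=
        setLIntegral_mono' measurableSet_Ioo h1
    _ ≤ ∫⁻ u, {u : ℝ | |u| < min t Real.pi}.indicator (fun u => ENNReal.ofReal B * ‖g (y - u)‖ₑ) u :=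
        setLIntegral_le_lintegral _ _
    _ = ENNReal.ofReal B * ∫⁻ u in {u : ℝ | |u| < min t Real.pi}, ‖g (y - u)‖ₑ := by
        rw [lintegral_indicator (hms _), lintegral_const_mul' _ _ ENNReal.ofReal_ne_top]
    _ ≤ ENNReal.ofReal B * ENNReal.ofReal (min t Real.pi * A) := by
        gcongr
        exact avg_small _ y A hy h _ (lt_min ht hpi) (min_le_right _ _)
    _ ≤ ENNReal.ofReal (B * t * A) := by
        rw [← ENNReal.ofReal_mul hB]
        apply ENNReal.ofReal_le_ofReal
        rw [mul_assoc]
        gcongr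
        exact min_le_left _ _

theorem estk (g : ℝ → ℝ) (hg : Measurable g) (y A : ℝ) (hA : 0 < A) (hy : y ∈ T1)
    (h : avgLe (fun t => ‖g t‖ₑ) y A)
    (K : ℝ → ℝ) (B ε : ℝ) (hB : 0 ≤ B) (hε : 0 < ε)
    (hK : ∀ u ∈ Ioo (-Real.pi) Real.pi, |K u| ≤ B * kap ε u) :
    |∫ u in Ioo (-Real.pi) Real.pi, g (y - u) * K u| ≤ 2 * B * A := by
  refine toReal_bd _ _ (by positivity) ?_
  refine (enorm_integral_le_lintegral_enorm _).trans ?_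
  calc _ ≤ ∫⁻ u in Ioo (-Real.pi) Real.pi, ENNReal.ofReal B * (ENNReal.ofReal (kap ε u) * ‖g (y - u)‖ₑ) := by
        refine setLIntegral_mono' measurableSet_Ioo fun u hu => ?_
        rw [enorm_mul, mul_comm, ← mul_assoc, ← ENNReal.ofReal_mul hB]
        gcongr
        rw [← ofReal_norm, Real.norm_eq_abs]
        exact ENNReal.ofReal_le_ofReal (hK u hu)
    _ = ENNReal.ofReal B * ∫⁻ u in Ioo (-Real.pi) Real.pi, (ENNReal.ofReal (kap ε u) * ‖g (y - u)‖ₑ) :=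
        lintegral_const_mul' _ _ ENNReal.ofReal_ne_top
    _ ≤ ENNReal.ofReal B * (2 * ENNReal.ofReal A) := by
        gcongr
        exact kap_avg (fun t => ‖g t‖ₑ) hg.enorm y A ε hε hy h
    _ = _ := by
        rw [show (2 : ℝ≥0∞) = ENNReal.ofReal 2 by simp, ← ENNReal.ofReal_mul (by norm_num),
          ← ENNReal.ofReal_mul hB]
        congr 1; ring

theorem tr_tendsto (q : ℝ → ℝ) (hq : IntegrableOn q (Ioo (-Real.pi) Real.pi)) :
    Tendsto (fun ε : ℝ => ∫ u in {t : ℝ | ε < |t| ∧ |t| < Real.pi}, q u) (𝓝[>] 0)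
      (𝓝 (∫ u in Ioo (-Real.pi) Real.pi, q u)) := by
  have e : ∀ ε : ℝ, ∫ u in {t : ℝ | ε < |t| ∧ |t| < Real.pi}, q u =
      ∫ u in Ioo (-Real.pi) Real.pi, {u : ℝ | ε < |u|}.indicator q u := by
    intro ε; rw [pvset_eq, setIntegral_indicator' (tr_meas _)]
  simp only [e]
  refine tendsto_integral_filter_of_dominated_convergence (fun u => ‖q u‖)
    (Eventually.of_forall fun ε => hq.1.indicator (tr_meas ε))
    (Eventually.of_forall fun ε => Eventually.of_forall fun u => norm_indicator_le_norm_self _ _) hq.norm ?_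
  have h0 : ∀ᵐ u : ℝ ∂volume.restrict (Ioo (-Real.pi) Real.pi), u ≠ 0 :=
    ae_restrict_of_ae (Measure.ae_ne volume 0)
  filter_upwards [h0] with u hu
  refine tendsto_const_nhds.congr' ?_
  have : ∀ᶠ ε : ℝ in 𝓝[>] 0, ε < |u| := nhdsWithin_le_nhds (eventually_lt_nhds (abs_pos.2 hu))
  filter_upwards [this] with ε hε
  rw [indicator_of_mem (by simpa using hε)]

theorem kk_lip (a b u : ℝ) (hu : u ∈ Ioo (-Real.pi) Real.pi) :
    |(Real.cos (a * u) - Real.cos (b * u)) * kk u| ≤ |a - b| := by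
  rw [abs_mul]
  have h1 := Real.abs_cos_sub_cos_le (a * u) (b * u)
  have h2 := kk_bound u ((mem_Ioo_abs u).1 hu)
  rw [← sub_mul, abs_mul] at h1
  by_cases h0 : u = 0
  · subst h0; simp
  have h3 : 0 < |u| := abs_pos.2 h0
  calc _ ≤ (|a - b| * |u|) * (1 / |u|) := by gcongr
    _ = |a - b| := by field_simp

theorem pv_one (g : ℝ → ℝ) (hp : Function.Periodic g (2 * Real.pi)) (hi : IntegrableOn g T1) (y : ℝ)
    (n : ℝ) (X : ℝ)
    (hX : pvT1 (fun u => (1 / (2 * Real.pi)) * (Real.cos (n * u) / (2 * Real.tan (u / 2))) * g (y - u)) X) :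
    Tendsto (fun ε : ℝ => (1 / (2 * Real.pi)) * ∫ u in {t : ℝ | ε < |t| ∧ |t| < Real.pi}, g (y - u) * kk u)
      (𝓝[>] 0) (𝓝 (X - (1 / (2 * Real.pi)) *
        ∫ u in Ioo (-Real.pi) Real.pi, g (y - u) * ((Real.cos (n * u) - 1) * kk u))) := by
  have hkm := kk_meas
  have i1 : IntegrableOn (fun u => g (y - u) * ((Real.cos (n * u) - 1) * kk u)) (Ioo (-Real.pi) Real.pi) := by
    refine bdd_ker_int g hp hi y _ (by fun_prop) |n - 0| fun u hu => ?_
    have := kk_lip n 0 u hu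
    simpa using this
  have h2 := hX.sub ((tr_tendsto _ i1).const_mul (1 / (2 * Real.pi)))
  refine h2.congr' ?_
  filter_upwards [self_mem_nhdsWithin] with ε hε
  have hε : 0 < ε := hε
  have i2 : IntegrableOn (fun u => g (y - u) * kk u) {t : ℝ | ε < |t| ∧ |t| < Real.pi} := by
    have := bdd_ker_int g hp hi y _ (kk_meas.indicator (tr_meas ε)) _ (tr_bdd ε hε)
    have hsub : {t : ℝ | ε < |t| ∧ |t| < Real.pi} ⊆ Ioo (-Real.pi) Real.pi := by
      rw [pvset_eq]; exact inter_subset_right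
    have hms : MeasurableSet {t : ℝ | ε < |t| ∧ |t| < Real.pi} := by
      rw [pvset_eq]; exact (tr_meas _).inter measurableSet_Ioo
    refine (this.mono_set hsub).congr_fun (fun u hu => ?_) hms
    simp only [mem_ofPred_eq] at hu
    simp only [indicator, mem_ofPred_eq, if_pos hu.1]
  have i1' := i1.mono_set (show {t : ℝ | ε < |t| ∧ |t| < Real.pi} ⊆ Ioo (-Real.pi) Real.pi by
    rw [pvset_eq]; exact inter_subset_right)
  rw [← integral_const_mul, ← integral_const_mul, ← integral_sub _ (i1'.const_mul _)]
  · congr 1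
    ext u
    simp only [kk]; ring
  · have := (i2.add i1').const_mul (1 / (2 * Real.pi))
    refine this.congr (Eventually.of_forall fun u => ?_)
    simp only [Pi.add_apply, kk]; ring

theorem step_meas (ξ : ℕ → ℝ) (n : ℕ) : Measurable (stepFun ξ n) := by
  unfold stepFun
  exact Finset.measurable_fun_sum _ fun k _ => measurable_const.indicator measurableSet_Icc

theorem step_bdd (ξ : ℕ → ℝ) (n : ℕ) (t : ℝ) : |stepFun ξ n t| ≤ ∑ k ∈ Finset.range (n + 1), |ξ k| := by
  unfold stepFun
  refine (Finset.abs_sum_le_sum_abs _ _).trans (Finset.sum_le_sum fun k _ => ?_)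
  simp only [indicator]
  split_ifs <;> simp

theorem step_int (ξ : ℕ → ℝ) (n : ℕ) (a b : ℝ) : IntegrableOn (stepFun ξ n) (Icc a b) :=
  IntegrableOn.of_bound (by simp) (step_meas ξ n).aestronglyMeasurable _
    (Eventually.of_forall fun t => step_bdd ξ n t)

theorem step_ae (ξ : ℕ → ℝ) (n : ℕ) : ∀ᵐ t : ℝ, t ∈ Icc (0:ℝ) 1 →
    ∃ k : ℕ, (k : ℝ) ≤ ((n : ℝ) + 1) * t ∧ ((n : ℝ) + 1) * t ≤ k + 1 ∧ stepFun ξ n t = ξ k := by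
  have hN : (0 : ℝ) < (n : ℝ) + 1 := by positivity
  have h1 : ∀ᵐ t : ℝ, ∀ j : ℕ, t ≠ (j : ℝ) / ((n : ℝ) + 1) :=
    ae_all_iff.2 fun j => Measure.ae_ne volume _
  filter_upwards [h1] with t ht h01
  have hne : ∀ j : ℕ, ((n : ℝ) + 1) * t ≠ j := fun j hj => ht j (by rw [← hj]; field_simp)
  have hpos : 0 ≤ ((n : ℝ) + 1) * t := mul_nonneg hN.le h01.1
  set k := ⌊((n : ℝ) + 1) * t⌋₊ with hk
  have hk1 : (k : ℝ) ≤ ((n : ℝ) + 1) * t := Nat.floor_le hpos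
  have hk2 : ((n : ℝ) + 1) * t < k + 1 := Nat.lt_floor_add_one _
  have hk1' : (k : ℝ) < ((n : ℝ) + 1) * t := lt_of_le_of_ne hk1 (hne k).symm
  have hkn : k < n + 1 := by
    have : (k : ℝ) < ((n + 1 : ℕ) : ℝ) := by
      push_cast
      refine hk1'.trans_le ?_
      have := h01.2
      nlinarith
    exact_mod_cast this
  refine ⟨k, hk1, hk2.le, ?_⟩
  unfold stepFun
  rw [Finset.sum_eq_single k]
  · rw [indicator_of_mem]
    constructor
    · rw [div_le_iff₀ hN]; linarith
    · rw [le_div_iff₀ hN]; linarith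
  · intro j _ hjk
    rw [indicator_of_notMem]
    rintro ⟨a, b⟩
    rw [div_le_iff₀ hN] at a
    rw [le_div_iff₀ hN] at b
    apply hjk
    have a' : (j : ℝ) < k + 1 := by linarith
    have b' : (k : ℝ) < j + 1 := by linarith
    have a'' : j < k + 1 := by exact_mod_cast a'
    have b'' : k < j + 1 := by exact_mod_cast b'
    omega
  · intro h; exact absurd (Finset.mem_range.2 hkn) h

theorem step_mean (ξ : ℕ → ℝ) (n : ℕ) :
    ∫ t in Icc (0:ℝ) 1, stepFun ξ n t = ((n : ℝ) + 1)⁻¹ * ∑ k ∈ Finset.range (n + 1), ξ k := by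
  have hN : (0 : ℝ) < (n : ℝ) + 1 := by positivity
  unfold stepFun
  rw [integral_finsetSum, Finset.mul_sum]
  · refine Finset.sum_congr rfl fun k hk => ?_
    have hkn : (k : ℝ) + 1 ≤ (n : ℝ) + 1 := by
      have := Finset.mem_range.1 hk
      exact_mod_cast this
    rw [setIntegral_indicator measurableSet_Icc, inter_eq_right.2, setIntegral_const, measureReal_def,
      Real.volume_Icc, ENNReal.toReal_ofReal, smul_eq_mul]
    · field_simp; ring
    · rw [← sub_div]; simp; positivity
    · refine Icc_subset_Icc (by positivity) ?_
      rw [div_le_one hN]; exact hkn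
  · intro k _
    exact (integrableOn_const (by simp)).indicator measurableSet_Icc

theorem osc_le (S : ℝ → ℝ) (α β c : ℝ) (hab : α < β) (hS : IntegrableOn S (Icc α β)) :
    (β - α)⁻¹ * ∫ t in Icc α β, |S t - (β - α)⁻¹ * ∫ s in Icc α β, S s| ≤
      2 * ((β - α)⁻¹ * ∫ t in Icc α β, |S t - c|) := by
  have hv : volume.real (Icc α β) = β - α := by
    rw [measureReal_def, Real.volume_Icc, ENNReal.toReal_ofReal (by linarith)]
  have hl : 0 < β - α := by linarith
  set m := (β - α)⁻¹ * ∫ s in Icc α β, S s with hm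
  have hc : ∀ c : ℝ, IntegrableOn (fun _ : ℝ => c) (Icc α β) := fun c => integrableOn_const (by simp)
  have i1 : IntegrableOn (fun t => |S t - c|) (Icc α β) := (hS.sub (hc c)).abs
  have i2 : IntegrableOn (fun t => |S t - m|) (Icc α β) := (hS.sub (hc m)).abs
  have h1 : |m - c| ≤ (β - α)⁻¹ * ∫ t in Icc α β, |S t - c| := by
    have : m - c = (β - α)⁻¹ * ∫ t in Icc α β, (S t - c) := by
      rw [integral_sub hS (hc c), setIntegral_const, hv, smul_eq_mul, mul_sub, ← hm]
      field_simp
    rw [this, abs_mul, abs_of_pos (inv_pos.2 hl)]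
    gcongr
    exact abs_integral_le_integral_abs
  have h2 : ∫ t in Icc α β, |S t - m| ≤ ∫ t in Icc α β, (|S t - c| + |m - c|) := by
    refine integral_mono i2 (i1.add (hc _)) fun t => ?_
    have := abs_sub_le (S t) c m
    rw [abs_sub_comm c m] at this
    exact this
  rw [integral_add i1 (hc _), setIntegral_const, hv, smul_eq_mul] at h2
  calc (β - α)⁻¹ * ∫ t in Icc α β, |S t - m| ≤ (β - α)⁻¹ * ((∫ t in Icc α β, |S t - c|) + (β - α) * |m - c|) := by
        gcongr
    _ = (β - α)⁻¹ * (∫ t in Icc α β, |S t - c|) + |m - c| := by field_simp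
    _ ≤ _ := by linarith

theorem bmo_of (S : ℝ → ℝ) (hS : ∀ a b, IntegrableOn S (Icc a b)) (B D : ℝ)
    (h : ∀ α β, 0 ≤ α → α < β → β ≤ 1 → ∃ c, ∫ t in Icc α β, |S t - c| ≤ B * (β - α))
    (hD : |∫ t in Icc (0:ℝ) 1, S t| ≤ D) : bmoNorm S ≤ 2 * B + D := by
  unfold bmoNorm
  refine add_le_add ?_ hD
  have : Nonempty {p : ℝ × ℝ // 0 ≤ p.1 ∧ p.1 < p.2 ∧ p.2 ≤ 1} := ⟨⟨(0, 1), by norm_num⟩⟩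
  refine ciSup_le fun I => ?_
  obtain ⟨⟨α, β⟩, h1, h2, h3⟩ := I
  simp only at h1 h2 h3 ⊢
  obtain ⟨c, hc⟩ := h α β h1 h2 h3
  refine (osc_le S α β c h2 (hS _ _)).trans ?_
  have : 0 < β - α := by linarith
  gcongr
  rw [inv_mul_le_iff₀ this]; linarith

theorem scale_lint (G : ℝ → ℝ≥0∞) (N α β : ℝ) (hN : 0 < N) :
    ENNReal.ofReal N * ∫⁻ t in Icc α β, G (N * t - N * α) = ∫⁻ s in Icc 0 (N * (β - α)), G s := by
  rw [← lintegral_indicator measurableSet_Icc, ← lintegral_indicator measurableSet_Icc,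
    ← lintegral_sub_right_eq_self ((Icc 0 (N * (β - α))).indicator G) (N * α)]
  conv_rhs => rw [← Real.smul_map_volume_mul_left hN.ne']
  have hme : MeasurableEmbedding (fun x : ℝ => N * x) := (Homeomorph.mulLeft₀ N hN.ne').measurableEmbedding
  rw [lintegral_smul_measure, abs_of_pos hN, smul_eq_mul, hme.lintegral_map]
  congr 1
  refine lintegral_congr fun t => ?_
  have : (N * t - N * α ∈ Icc 0 (N * (β - α))) ↔ t ∈ Icc α β := by
    rw [mem_Icc, mem_Icc]
    constructor
    · rintro ⟨a, b⟩; constructor <;> nlinarith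
    · rintro ⟨a, b⟩; constructor <;> nlinarith
  simp only [indicator, this]

theorem cs_lint (Ψ : ℝ → ℂ) (A h : ℝ) (hA : 0 < A) (hh : 0 < h)
    (hb : ∫⁻ s in Icc 0 h, ‖Ψ s‖ₑ ^ 2 ≤ ENNReal.ofReal (288 * A ^ 2 * h)) :
    ∫⁻ s in Icc 0 h, ‖Ψ s‖ₑ ≤ ENNReal.ofReal (289 * A * h) := by
  have hpt : ∀ z : ℂ, ‖z‖ₑ ≤ ENNReal.ofReal A + ENNReal.ofReal (1 / A) * ‖z‖ₑ ^ 2 := by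
    intro z
    rw [← ofReal_norm, ← ENNReal.ofReal_pow (norm_nonneg _), ← ENNReal.ofReal_mul (by positivity),
      ← ENNReal.ofReal_add hA.le (by positivity)]
    apply ENNReal.ofReal_le_ofReal
    have h1 : A * (A + 1 / A * ‖z‖ ^ 2) = A ^ 2 + ‖z‖ ^ 2 := by field_simp
    nlinarith [sq_nonneg (A - ‖z‖), norm_nonneg z]
  calc _ ≤ ∫⁻ s in Icc 0 h, (ENNReal.ofReal A + ENNReal.ofReal (1 / A) * ‖Ψ s‖ₑ ^ 2) :=
        lintegral_mono fun s => hpt _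
    _ = ENNReal.ofReal A * ENNReal.ofReal h + ENNReal.ofReal (1 / A) * ∫⁻ s in Icc 0 h, ‖Ψ s‖ₑ ^ 2 := by
        rw [lintegral_add_left measurable_const, lintegral_const_mul' _ _ ENNReal.ofReal_ne_top,
          setLIntegral_const, Real.volume_Icc, sub_zero]
    _ ≤ ENNReal.ofReal A * ENNReal.ofReal h + ENNReal.ofReal (1 / A) * ENNReal.ofReal (288 * A ^ 2 * h) := by
        gcongr
    _ = _ := by
        rw [← ENNReal.ofReal_mul hA.le, ← ENNReal.ofReal_mul (by positivity),
          ← ENNReal.ofReal_add (by positivity) (by positivity)]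
        congr 1
        field_simp; ring

/-- good points -/
def Good (g : ℝ → ℝ) (y A : ℝ) : Prop :=
  avgLe (fun t => ‖g t‖ₑ) y A ∧
  (∀ ε > 0, ∀ ψ : ℝ → ℂ, Integrable ψ →
        (∀ u, ‖ψ u‖ₑ ≤ {u : ℝ | ε ≤ |u|}.indicator
          (fun u => cut (fun t => ‖g t‖ₑ) (y - u) * ENNReal.ofReal (1 / |u|)) u) →
        ∫⁻ s in Icc 0 (1 / ε), ‖∫ u : ℝ, Complex.exp (Complex.I * s * u) * ψ u‖ₑ ^ 2 ≤
          ENNReal.ofReal (288 * A ^ 2 / ε)) ∧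
  ∀ r, 1 / 2 ≤ r → r < 1 → |(Fg g (circleMap 0 r y)).im| ≤ 2 * A

theorem tr_bound (g : ℝ → ℝ) (hg : Measurable g) (hp : Function.Periodic g (2 * Real.pi))
    (hi : IntegrableOn g T1) (y A : ℝ) (hA : 0 < A) (hy : y ∈ T1) (hG : Good g y A) (ε : ℝ)
    (hε : 0 < ε) (hε1 : ε ≤ 1 / 2) :
    |(1 / (2 * Real.pi)) * ∫ u in {t : ℝ | ε < |t| ∧ |t| < Real.pi}, g (y - u) * kk u| ≤ 3 * A := by
  have hpi := Real.pi_gt_three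
  have h1 := pv_split g hp hi (1 - ε) y (by linarith) (by linarith)
  have h2 := hG.2.2 (1 - ε) (by linarith) (by linarith)
  have h3 := estk g hg y A hA hy hG.1 (Dk (1 - ε)) 10 ε (by norm_num) hε (fun u hu => by
    have := Qk_le (1 - ε) u (by linarith) (by linarith) ((mem_Ioo_abs u).1 hu)
    have e : 1 - (1 - ε) = ε := by ring
    unfold Dk
    rw [e] at this ⊢
    exact this)
  rw [sub_sub_cancel] at h1
  set X := ∫ u in {t : ℝ | ε < |t| ∧ |t| < Real.pi}, g (y - u) * kk u
  set Y := ∫ u in Ioo (-Real.pi) Real.pi, g (y - u) * Dk (1 - ε) u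
  have e : (1 / (2 * Real.pi)) * X = (1/2) * (Fg g (circleMap 0 (1 - ε) y)).im - (1/2) * ((2 * Real.pi)⁻¹ * Y) := by
    rw [h1]; ring_nf
  have h4 : |(2 * Real.pi)⁻¹ * Y| ≤ 4 * A := by
    rw [abs_mul, abs_of_pos (by positivity), inv_mul_le_iff₀ (by positivity)]
    nlinarith
  rw [e]
  rw [abs_le] at h2 h4 ⊢
  constructor <;> linarith [h2.1, h2.2, h4.1, h4.2]

theorem dir_sum (N : ℕ) (u : ℝ) :
    2 * Real.sin (u / 2) * ∑ k ∈ Finset.range N, Real.cos (((k : ℝ) + 1) * u) =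
      Real.sin (((N : ℝ) + 1 / 2) * u) - Real.sin (u / 2) := by
  induction N with
  | zero => simp; ring_nf
  | succ n ih =>
    rw [Finset.sum_range_succ, mul_add, ih]
    have h := Real.sin_sub_sin (((n : ℝ) + 1 + 1 / 2) * u) (((n : ℝ) + 1 / 2) * u)
    rw [show ((((n : ℝ) + 1 + 1 / 2) * u) - (((n : ℝ) + 1 / 2) * u)) / 2 = u / 2 by ring,
      show ((((n : ℝ) + 1 + 1 / 2) * u) + (((n : ℝ) + 1 / 2) * u)) / 2 = ((n : ℝ) + 1) * u by ring] at h
    push_cast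
    linarith

theorem dir_bound (N : ℕ) (u : ℝ) (hu : |u| < Real.pi) (h0 : u ≠ 0) :
    |∑ k ∈ Finset.range N, Real.cos (((k : ℝ) + 1) * u)| ≤ Real.pi / |u| := by
  have hpi := Real.pi_pos
  have h := congrArg abs (dir_sum N u)
  have hs : |u| / Real.pi ≤ |Real.sin (u / 2)| := by
    have key := Real.mul_le_sin (x := |u| / 2) (by positivity) (by linarith)
    have e : Real.sin (|u| / 2) ≤ |Real.sin (u / 2)| := by
      rcases abs_cases u with ⟨h1, _⟩ | ⟨h1, _⟩
      · rw [h1]; exact le_abs_self _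
      · rw [h1, neg_div, Real.sin_neg]; exact neg_le_abs _
    refine le_trans (le_of_eq ?_) (key.trans e)
    field_simp
  have hu0 : 0 < |u| := abs_pos.2 h0
  rw [abs_mul, abs_mul, abs_two] at h
  have h2 : |Real.sin (((N : ℝ) + 1 / 2) * u) - Real.sin (u / 2)| ≤ 2 :=
    (abs_sub _ _).trans (by linarith [Real.abs_sin_le_one (((N : ℝ) + 1 / 2) * u), Real.abs_sin_le_one (u / 2)])
  set X := |∑ k ∈ Finset.range N, Real.cos (((k : ℝ) + 1) * u)|
  have hX : 0 ≤ X := abs_nonneg _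
  have h3 : |u| / Real.pi * X ≤ 1 := by
    have := mul_le_mul_of_nonneg_right hs hX
    linarith
  rw [le_div_iff₀ hu0]
  rw [div_mul_eq_mul_div, div_le_one hpi] at h3
  linarith

theorem mean_bound (g : ℝ → ℝ) (hg : Measurable g) (hp : Function.Periodic g (2 * Real.pi))
    (hi : IntegrableOn g T1) (y A : ℝ) (hA : 0 < A) (hy : y ∈ T1) (hG : Good g y A) (L0 : ℝ) (ξ : ℕ → ℝ)
    (hL : Tendsto (fun ε : ℝ => (1 / (2 * Real.pi)) *
      ∫ u in {t : ℝ | ε < |t| ∧ |t| < Real.pi}, g (y - u) * kk u) (𝓝[>] 0) (𝓝 L0))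
    (hξ : ∀ k : ℕ, ξ k = L0 + (1 / (2 * Real.pi)) *
      ∫ u in Ioo (-Real.pi) Real.pi, g (y - u) * ((Real.cos (((k : ℝ) + 1) * u) - 1) * kk u)) (n : ℕ) :
    |((n : ℝ) + 1)⁻¹ * ∑ k ∈ Finset.range (n + 1), ξ k| ≤ 9 * A := by
  have hpi := Real.pi_gt_three
  have hkm := kk_meas
  have hL0 : |L0| ≤ 3 * A := by
    refine le_of_tendsto hL.abs ?_
    have : ∀ᶠ ε : ℝ in 𝓝[>] 0, ε < 1/2 := nhdsWithin_le_nhds (eventually_lt_nhds (by norm_num))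
    filter_upwards [this, self_mem_nhdsWithin] with ε h1 h2
    exact tr_bound g hg hp hi y A hA hy hG ε h2 h1.le
  set N : ℝ := (n : ℝ) + 1 with hN
  have hN1 : 1 ≤ N := by rw [hN]; have : (0:ℝ) ≤ n := n.cast_nonneg; linarith
  set ε : ℝ := 1 / (N + 1) with hε
  have hε0 : 0 < ε := by positivity
  have hε1 : ε ≤ 1 / 2 := by rw [hε]; exact one_div_le_one_div_of_le (by norm_num) (by linarith)
  have hNε : N * ε ≤ 1 := by rw [hε, mul_one_div, div_le_one (by positivity)]; linarith
  have hNε' : 1 ≤ 2 * (N * ε) := by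
    rw [hε, mul_one_div, ← mul_div_assoc, le_div_iff₀ (by positivity)]; linarith
  have ht := tr_bound g hg hp hi y A hA hy hG ε hε0 hε1
  set p : ℝ → ℝ := fun u => N⁻¹ * ∑ k ∈ Finset.range (n + 1), Real.cos (((k : ℝ) + 1) * u) with hpd
  have hpm : Measurable p := by
    refine Measurable.const_mul (Finset.measurable_fun_sum _ fun k _ => ?_) _
    fun_prop
  have hpp : ∀ u ∈ Ioo (-Real.pi) Real.pi, |(p u - 1) * kk u| ≤ N := by
    intro u hu
    have e : (p u - 1) * kk u = N⁻¹ * ∑ k ∈ Finset.range (n + 1), (Real.cos (((k : ℝ) + 1) * u) - 1) * kk u := by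
      simp only [hpd]
      rw [← Finset.sum_mul, Finset.sum_sub_distrib]
      simp only [Finset.sum_const, Finset.card_range, nsmul_eq_mul, mul_one]
      push_cast
      rw [← hN]
      generalize (∑ k ∈ Finset.range (n + 1), Real.cos (((k : ℝ) + 1) * u)) = Q
      field_simp
    rw [e, abs_mul, abs_of_pos (by positivity), inv_mul_le_iff₀ (by positivity)]
    refine (Finset.abs_sum_le_sum_abs _ _).trans ?_
    calc _ ≤ ∑ k ∈ Finset.range (n + 1), N := by
          refine Finset.sum_le_sum fun k hk => ?_
          have h1 := kk_lip ((k : ℝ) + 1) 0 u hu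
          rw [zero_mul, Real.cos_zero, show |(k : ℝ) + 1 - 0| = k + 1 by
            rw [sub_zero, abs_of_pos (by positivity)]] at h1
          refine h1.trans ?_
          have := Finset.mem_range.1 hk
          rw [hN]
          exact_mod_cast this
      _ = N * N := by simp [hN]; ring
  have hNpos : 0 < N := by linarith
  -- decomposition
  have iK : ∀ k : ℕ, IntegrableOn (fun u => g (y - u) * ((Real.cos (((k : ℝ) + 1) * u) - 1) * kk u))
      (Ioo (-Real.pi) Real.pi) := fun k => by
    refine bdd_ker_int g hp hi y _ (by fun_prop) |(k : ℝ) + 1 - 0| fun u hu => ?_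
    have := kk_lip ((k : ℝ) + 1) 0 u hu
    rwa [zero_mul, Real.cos_zero] at this
  have e1 : N⁻¹ * ∑ k ∈ Finset.range (n + 1), ξ k = L0 + (1 / (2 * Real.pi)) *
      ∫ u in Ioo (-Real.pi) Real.pi, g (y - u) * ((p u - 1) * kk u) := by
    have e2 : ∫ u in Ioo (-Real.pi) Real.pi, g (y - u) * ((p u - 1) * kk u) = N⁻¹ *
        ∑ k ∈ Finset.range (n + 1), ∫ u in Ioo (-Real.pi) Real.pi, g (y - u) * ((Real.cos (((k : ℝ) + 1) * u) - 1) * kk u) := by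
      rw [← integral_finsetSum _ fun k _ => iK k, ← integral_const_mul]
      congr 1
      ext u
      simp only [hpd]
      rw [← Finset.mul_sum, ← Finset.sum_mul, Finset.sum_sub_distrib]
      simp only [Finset.sum_const, Finset.card_range, nsmul_eq_mul, mul_one]
      push_cast
      rw [← hN]; field_simp
    rw [e2]
    simp only [hξ]
    rw [Finset.sum_add_distrib, ← Finset.mul_sum]
    simp only [Finset.sum_const, Finset.card_range, nsmul_eq_mul]
    push_cast
    rw [← hN]; field_simp
  have hms := tr_meas ε
  set K2 : ℝ → ℝ := {u : ℝ | ε < |u|}ᶜ.indicator fun u => (p u - 1) * kk u with hK2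
  set K3 : ℝ → ℝ := {u : ℝ | ε < |u|}.indicator fun u => p u * kk u with hK3
  have b2 : ∀ u ∈ Ioo (-Real.pi) Real.pi, |K2 u| ≤ {u : ℝ | |u| < 2 * ε}.indicator (fun _ => N) u := by
    intro u hu
    by_cases hc : ε < |u|
    · rw [hK2, indicator_of_notMem (by simpa using hc), abs_zero]
      exact indicator_nonneg (fun _ _ => hNpos.le) _
    · have : |u| < 2 * ε := by linarith [not_lt.1 hc]
      rw [hK2, indicator_of_mem (by simpa using hc), indicator_of_mem (by simpa using this)]
      exact hpp u hu
  have b3 : ∀ u ∈ Ioo (-Real.pi) Real.pi, |K3 u| ≤ (2 * Real.pi) * kap ε u := by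
    intro u hu
    by_cases hc : ε < |u|
    · rw [hK3, indicator_of_mem (by simpa using hc), abs_mul]
      have hu' := (mem_Ioo_abs u).1 hu
      have hu0 : 0 < |u| := hε0.trans hc
      have h1 := kk_bound u hu'
      have h2 : |p u| ≤ N⁻¹ * (Real.pi / |u|) := by
        simp only [hpd]
        rw [abs_mul, abs_of_pos (inv_pos.2 hNpos)]
        gcongr
        exact dir_bound (n + 1) u hu' (abs_pos.1 hu0)
      unfold kap
      rw [max_eq_right hc.le]
      calc _ ≤ N⁻¹ * (Real.pi / |u|) * (1 / |u|) := by gcongr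
        _ = Real.pi * N⁻¹ / |u| ^ 2 := by field_simp
        _ ≤ Real.pi * (2 * ε) / |u| ^ 2 := by
          gcongr
          rw [inv_le_iff_one_le_mul₀ hNpos]; linarith
        _ = _ := by ring
    · rw [hK3, indicator_of_notMem (by simpa using hc), abs_zero]
      exact mul_nonneg (by positivity) (kap_nonneg _ _ hε0)
  have m2 : Measurable K2 := ((hpm.sub_const 1).mul hkm).indicator hms.compl
  have m3 : Measurable K3 := (hpm.mul hkm).indicator hms
  have j2 := bdd_ker_int g hp hi y K2 m2 N (fun u hu => (b2 u hu).trans (by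
    simp only [indicator]; split_ifs <;> linarith))
  have j3 := bdd_ker_int g hp hi y K3 m3 ((2 * Real.pi) * (1 / ε)) (fun u hu => (b3 u hu).trans (by
    unfold kap
    refine mul_le_mul_of_nonneg_left ?_ (by positivity)
    rw [div_le_div_iff₀ (by positivity) hε0]
    have : ε ≤ max ε |u| := le_max_left _ _
    nlinarith))
  have j1 := bdd_ker_int g hp hi y _ (hkm.indicator hms) _ (tr_bdd ε hε0)
  have e3 : ∫ u in Ioo (-Real.pi) Real.pi, g (y - u) * ((p u - 1) * kk u) =
      (∫ u in Ioo (-Real.pi) Real.pi, g (y - u) * K2 u) + (∫ u in Ioo (-Real.pi) Real.pi, g (y - u) * K3 u)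
      - ∫ u in {t : ℝ | ε < |t| ∧ |t| < Real.pi}, g (y - u) * kk u := by
    rw [pvset_eq, ← setIntegral_indicator' hms]
    have : ∀ u, {u : ℝ | ε < |u|}.indicator (fun u => g (y - u) * kk u) u =
      g (y - u) * {u : ℝ | ε < |u|}.indicator kk u := by
      intro u; simp only [indicator]; split_ifs <;> simp
    simp only [this]
    rw [← integral_add j2 j3, ← integral_sub _ j1]
    · congr 1
      ext u
      by_cases hc : ε < |u|
      · simp only [hK2, hK3, indicator, mem_compl_iff, mem_ofPred_eq, hc, not_true, if_true, if_false]; ring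
      · simp only [hK2, hK3, indicator, mem_compl_iff, mem_ofPred_eq, hc, not_false_eq_true, if_true, if_false]; ring
    · exact j2.add j3
  have f2 := est g y A hA hy hG.1 K2 N (2 * ε) hNpos.le (by positivity) b2
  have f3 := estk g hg y A hA hy hG.1 K3 (2 * Real.pi) ε (by positivity) hε0 b3
  rw [e1, e3]
  have hw : ∀ x c : ℝ, 0 ≤ c → |x| ≤ 2 * Real.pi * c → |1 / (2 * Real.pi) * x| ≤ c := by
    intro x c hc hx
    rw [abs_mul, abs_of_pos (by positivity), one_div, inv_mul_le_iff₀ (by positivity)]; exact hx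
  have g2 := hw _ A hA.le (f2.trans (by nlinarith))
  have g3 := hw _ (2 * A) (by positivity) (f3.trans (by nlinarith))
  rw [mul_sub, mul_add]
  rw [abs_le] at *
  constructor <;> linarith [g2.1, g2.2, g3.1, g3.2, ht.1, ht.2, hL0.1, hL0.2]

theorem farset_meas (ε : ℝ) : MeasurableSet {u : ℝ | ε ≤ |u|} :=
  measurableSet_le measurable_const (by fun_prop)

theorem far_bdd (ε : ℝ) (hε : 0 < ε) (u : ℝ) (hu : u ∈ Ioo (-Real.pi) Real.pi) :
    |{u : ℝ | ε ≤ |u|}.indicator kk u| ≤ 1 / ε := by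
  simp only [indicator, mem_ofPred_eq]
  split_ifs with h
  · refine (kk_bound u ((mem_Ioo_abs u).1 hu)).trans ?_
    exact one_div_le_one_div_of_le hε h
  · simp; positivity

/-- far part -/
def Wf (g : ℝ → ℝ) (y ε : ℝ) : ℝ → ℝ :=
  (Ioo (-Real.pi) Real.pi).indicator fun u => g (y - u) * {u : ℝ | ε ≤ |u|}.indicator kk u

/-- modulated far part -/
def Psf (g : ℝ → ℝ) (y ε a : ℝ) (s : ℝ) : ℂ :=
  ∫ u : ℝ, Complex.exp (Complex.I * s * u) * (Complex.exp (Complex.I * a * u) * (Wf g y ε u : ℂ))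

theorem Wf_int (g : ℝ → ℝ) (hp : Function.Periodic g (2 * Real.pi))
    (hi : IntegrableOn g T1) (y ε : ℝ) (hε : 0 < ε) : Integrable (Wf g y ε) :=
  (integrable_indicator_iff measurableSet_Ioo).2
    (bdd_ker_int g hp hi y _ (kk_meas.indicator (farset_meas ε)) _ (far_bdd ε hε))

theorem cexp_norm (s u : ℝ) : ‖Complex.exp (Complex.I * s * u)‖ = 1 := by
  have := Complex.norm_exp_ofReal_mul_I (s * u)
  rw [← this]; congr 2; push_cast; ring

theorem mod_int (W : ℝ → ℂ) (hW : Integrable W) (a : ℝ) :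
    Integrable fun u : ℝ => Complex.exp (Complex.I * a * u) * W u := by
  refine hW.mono ?_ (Eventually.of_forall fun u => ?_)
  · refine AEStronglyMeasurable.mul ?_ hW.aestronglyMeasurable
    exact Continuous.aestronglyMeasurable (by fun_prop)
  · rw [norm_mul, cexp_norm, one_mul]

theorem Psf_re (g : ℝ → ℝ) (hp : Function.Periodic g (2 * Real.pi))
    (hi : IntegrableOn g T1) (y ε : ℝ) (hε : 0 < ε) (a s : ℝ) :
    ∫ u in Ioo (-Real.pi) Real.pi, g (y - u) * (Real.cos ((s + a) * u) * {u : ℝ | ε ≤ |u|}.indicator kk u) =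
      (Psf g y ε a s).re := by
  have hW := Wf_int g hp hi y ε hε
  have h1 := mod_int _ (mod_int _ hW.ofReal a) s
  unfold Psf
  have := Complex.reCLM.integral_comp_comm h1
  simp only [Complex.reCLM_apply] at this
  refine Eq.trans ?_ this
  rw [← integral_indicator measurableSet_Ioo]
  congr 1
  ext u
  have e : Complex.exp (Complex.I * s * u) * (Complex.exp (Complex.I * a * u) * (Wf g y ε u : ℂ)) =
      Complex.exp (((s + a) * u : ℝ) * Complex.I) * (Wf g y ε u : ℂ) := by
    rw [← mul_assoc, ← Complex.exp_add]; congr 2; push_cast; ring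
  change _ = (Complex.exp (Complex.I * s * u) * (Complex.exp (Complex.I * a * u) * (Wf g y ε u : ℂ))).re
  rw [e, Complex.re_mul_ofReal, Complex.exp_ofReal_mul_I_re]
  unfold Wf
  by_cases hu : u ∈ Ioo (-Real.pi) Real.pi
  · rw [indicator_of_mem hu, indicator_of_mem hu]; ring
  · rw [indicator_of_notMem hu, indicator_of_notMem hu]; ring

theorem Psf_bound (g : ℝ → ℝ) (hp : Function.Periodic g (2 * Real.pi))
    (hi : IntegrableOn g T1) (y A : ℝ) (hA : 0 < A) (hy : y ∈ T1) (hG : Good g y A) (h : ℝ) (hh : 0 < h) (a : ℝ) :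
    ∫⁻ s in Icc 0 h, ‖Psf g y (1 / h) a s‖ₑ ≤ ENNReal.ofReal (289 * A * h) := by
  refine cs_lint _ A h hA hh ?_
  have hε : 0 < 1 / h := by positivity
  have hW := Wf_int g hp hi y (1 / h) hε
  have := hG.2.1 (1 / h) hε _ (mod_int _ hW.ofReal a) (fun u => ?_)
  · rw [one_div_one_div, show 288 * A ^ 2 / (1 / h) = 288 * A ^ 2 * h by field_simp] at this
    exact this
  · change ‖Complex.exp (Complex.I * a * u) * (Wf g y (1 / h) u : ℂ)‖ₑ ≤ _
    rw [← ofReal_norm, norm_mul, cexp_norm, one_mul, Complex.norm_real]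
    unfold Wf
    by_cases hu : u ∈ Ioo (-Real.pi) Real.pi
    · rw [indicator_of_mem hu]
      by_cases hc : 1 / h ≤ |u|
      · rw [indicator_of_mem (by simpa using hc), indicator_of_mem (by simpa using hc), cut_eq _ _ _ hy hu,
          norm_mul, ENNReal.ofReal_mul (norm_nonneg _), ofReal_norm]
        gcongr
        exact kk_bound u ((mem_Ioo_abs u).1 hu)
      · rw [indicator_of_notMem (by simpa using hc)]; simp
    · rw [indicator_of_notMem hu]; simp

/-- constant subtracted -/
def K0 (a h u : ℝ) : ℝ := ({u : ℝ | 1 / h ≤ |u|}ᶜ.indicator (fun u => Real.cos (a * u)) u - 1) * kk u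

theorem osc_pt (g : ℝ → ℝ) (hp : Function.Periodic g (2 * Real.pi))
    (hi : IntegrableOn g T1) (y A : ℝ) (hA : 0 < A) (hy : y ∈ T1) (hG : Good g y A) (h : ℝ) (hh : 0 < h)
    (a κ τ : ℝ) (h1 : |κ - τ| ≤ 1) (h2 : |τ - a| ≤ h) :
    |(1 / (2 * Real.pi)) * (∫ u in Ioo (-Real.pi) Real.pi, g (y - u) * ((Real.cos (κ * u) - 1) * kk u)) -
     (1 / (2 * Real.pi)) * (∫ u in Ioo (-Real.pi) Real.pi, g (y - u) * K0 a h u)| ≤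
      A + ‖Psf g y (1 / h) a (τ - a)‖ := by
  have hpi := Real.pi_gt_three
  have hkm := kk_meas
  have hε : 0 < 1 / h := by positivity
  have hms := farset_meas (1 / h)
  have bK1 : ∀ u ∈ Ioo (-Real.pi) Real.pi, |(Real.cos (κ * u) - Real.cos (τ * u)) * kk u| ≤ 1 :=
    fun u hu => (kk_lip κ τ u hu).trans h1
  set K2 : ℝ → ℝ := {u : ℝ | 1 / h ≤ |u|}ᶜ.indicator fun u => (Real.cos (τ * u) - Real.cos (a * u)) * kk u with hK2
  set K3 : ℝ → ℝ := fun u => Real.cos (τ * u) * {u : ℝ | 1 / h ≤ |u|}.indicator kk u with hK3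
  have bK2 : ∀ u ∈ Ioo (-Real.pi) Real.pi, |K2 u| ≤ {u : ℝ | |u| < 1 / h}.indicator (fun _ => h) u := by
    intro u hu
    by_cases hc : 1 / h ≤ |u|
    · rw [hK2, indicator_of_notMem (by simpa using hc), indicator_of_notMem (by simpa using hc), abs_zero]
    · rw [hK2, indicator_of_mem (by simpa using hc), indicator_of_mem (by simpa using hc)]
      exact (kk_lip τ a u hu).trans h2
  have m2 : Measurable K2 := by
    refine Measurable.indicator ?_ hms.compl
    fun_prop
  have m3 : Measurable K3 := by
    have := hkm.indicator hms
    rw [hK3]; fun_prop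
  have m0 : Measurable (K0 a h) := by
    refine Measurable.mul (Measurable.sub_const (Measurable.indicator ?_ hms.compl) 1) hkm
    fun_prop
  have bK0 : ∀ u ∈ Ioo (-Real.pi) Real.pi, |K0 a h u| ≤ |a - 0| + h := by
    intro u hu
    unfold K0
    by_cases hc : 1 / h ≤ |u|
    · rw [indicator_of_notMem (by simpa using hc)]
      have := kk_bound u ((mem_Ioo_abs u).1 hu)
      have h3 := one_div_le_one_div_of_le hε hc
      rw [one_div_one_div] at h3
      rw [zero_sub, neg_one_mul, abs_neg]
      linarith [abs_nonneg (a - 0)]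
    · rw [indicator_of_mem (by simpa using hc)]
      have := kk_lip a 0 u hu
      rw [zero_mul, Real.cos_zero] at this
      linarith
  have i0 := bdd_ker_int g hp hi y _ m0 _ bK0
  have i1 := bdd_ker_int g hp hi y (fun u => (Real.cos (κ * u) - Real.cos (τ * u)) * kk u) (by fun_prop) _ bK1
  have i2 := bdd_ker_int g hp hi y K2 m2 h (fun u hu => (bK2 u hu).trans (by
    simp only [indicator]; split_ifs <;> linarith))
  have i3 := bdd_ker_int g hp hi y K3 m3 (1 / (1 / h)) (fun u hu => by
    rw [hK3]
    simp only
    rw [abs_mul]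
    have := far_bdd _ hε u hu
    have h4 := Real.abs_cos_le_one (τ * u)
    nlinarith [abs_nonneg ({u : ℝ | 1 / h ≤ |u|}.indicator kk u)])
  have esum : ∫ u in Ioo (-Real.pi) Real.pi, g (y - u) * ((Real.cos (κ * u) - 1) * kk u) =
      (∫ u in Ioo (-Real.pi) Real.pi, g (y - u) * K0 a h u) +
      (∫ u in Ioo (-Real.pi) Real.pi, g (y - u) * ((Real.cos (κ * u) - Real.cos (τ * u)) * kk u)) +
      (∫ u in Ioo (-Real.pi) Real.pi, g (y - u) * K2 u) + ∫ u in Ioo (-Real.pi) Real.pi, g (y - u) * K3 u := by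
    rw [← integral_add' i0 i1, ← integral_add' (i0.add i1) i2, ← integral_add' ((i0.add i1).add i2) i3]
    congr 1
    ext u
    simp only [Pi.add_apply, hK2, hK3, K0]
    by_cases hc : 1 / h ≤ |u|
    · simp only [indicator, mem_compl_iff, mem_ofPred_eq, hc, not_true, if_true, if_false]; ring
    · simp only [indicator, mem_compl_iff, mem_ofPred_eq, hc, not_false_eq_true, if_true, if_false]; ring
  have f1 := est g y A hA hy hG.1 (fun u => (Real.cos (κ * u) - Real.cos (τ * u)) * kk u) 1 Real.pi (by norm_num)
    (by positivity) (fun u hu => by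
      rw [indicator_of_mem (by simpa using (mem_Ioo_abs u).1 hu)]; exact bK1 u hu)
  have f2 := est g y A hA hy hG.1 K2 h (1 / h) hh.le hε bK2
  rw [mul_one_div_cancel hh.ne', one_mul] at f2
  have f3 : |∫ u in Ioo (-Real.pi) Real.pi, g (y - u) * K3 u| ≤ ‖Psf g y (1 / h) a (τ - a)‖ := by
    have := Psf_re g hp hi y (1 / h) hε a (τ - a)
    rw [sub_add_cancel] at this
    rw [this]
    exact Complex.abs_re_le_norm _
  rw [← mul_sub, esum, abs_mul, abs_of_pos (by positivity), one_div, inv_mul_le_iff₀ (by positivity)]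
  set P := ‖Psf g y (1 / h) a (τ - a)‖
  have hP : 0 ≤ P := norm_nonneg _
  have : (∫ u in Ioo (-Real.pi) Real.pi, g (y - u) * K0 a h u) +
      (∫ u in Ioo (-Real.pi) Real.pi, g (y - u) * ((Real.cos (κ * u) - Real.cos (τ * u)) * kk u)) +
      (∫ u in Ioo (-Real.pi) Real.pi, g (y - u) * K2 u) + (∫ u in Ioo (-Real.pi) Real.pi, g (y - u) * K3 u) -
      (∫ u in Ioo (-Real.pi) Real.pi, g (y - u) * K0 a h u) =
      (∫ u in Ioo (-Real.pi) Real.pi, g (y - u) * ((Real.cos (κ * u) - Real.cos (τ * u)) * kk u)) +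
      (∫ u in Ioo (-Real.pi) Real.pi, g (y - u) * K2 u) + (∫ u in Ioo (-Real.pi) Real.pi, g (y - u) * K3 u) := by ring
  rw [this]
  refine (abs_add_three _ _ _).trans ?_
  nlinarith

theorem osc_bound (g : ℝ → ℝ) (hp : Function.Periodic g (2 * Real.pi))
    (hi : IntegrableOn g T1) (y A : ℝ) (hA : 0 < A) (hy : y ∈ T1) (hG : Good g y A) (L0 : ℝ) (ξ : ℕ → ℝ)
    (hξ : ∀ k : ℕ, ξ k = L0 + (1 / (2 * Real.pi)) *
      ∫ u in Ioo (-Real.pi) Real.pi, g (y - u) * ((Real.cos (((k : ℝ) + 1) * u) - 1) * kk u)) (n : ℕ)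
    (α β : ℝ) (h0 : 0 ≤ α) (hab : α < β) (h1 : β ≤ 1) :
    ∃ c, ∫ t in Icc α β, |stepFun ξ n t - c| ≤ (290 * A) * (β - α) := by
  set N : ℝ := (n : ℝ) + 1 with hN
  have hN0 : 0 < N := by positivity
  have hba : 0 < β - α := by linarith
  set h := N * (β - α) with hh
  have hh0 : 0 < h := by positivity
  set c := L0 + (1 / (2 * Real.pi)) * (∫ u in Ioo (-Real.pi) Real.pi, g (y - u) * K0 (N * α) h u) with hc
  refine ⟨c, ?_⟩
  have hpt : ∀ᵐ t : ℝ, t ∈ Icc α β → ‖stepFun ξ n t - c‖ₑ ≤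
      ENNReal.ofReal A + ‖Psf g y (1 / h) (N * α) (N * t - N * α)‖ₑ := by
    filter_upwards [step_ae ξ n] with t ht htm
    obtain ⟨k, hk1, hk2, hk3⟩ := ht ⟨h0.trans htm.1, htm.2.trans h1⟩
    rw [← hN] at hk1 hk2
    have := osc_pt g hp hi y A hA hy hG h hh0 (N * α) ((k : ℝ) + 1) (N * t)
      (by rw [abs_le]; constructor <;> linarith)
      (by
        have e : N * t - N * α = N * (t - α) := by ring
        rw [e, abs_of_nonneg (mul_nonneg hN0.le (by linarith [htm.1])), hh]
        exact mul_le_mul_of_nonneg_left (by linarith [htm.2]) hN0.le)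
    rw [hk3, hξ k, hc, add_sub_add_left_eq_sub, ← ofReal_norm, ← ofReal_norm,
      ← ENNReal.ofReal_add hA.le (norm_nonneg _)]
    exact ENNReal.ofReal_le_ofReal this
  have hlin : ∫⁻ t in Icc α β, ‖stepFun ξ n t - c‖ₑ ≤ ENNReal.ofReal ((290 * A) * (β - α)) := by
    calc _ ≤ ∫⁻ t in Icc α β, (ENNReal.ofReal A + ‖Psf g y (1 / h) (N * α) (N * t - N * α)‖ₑ) :=
          setLIntegral_mono_ae' measurableSet_Icc hpt
      _ = ENNReal.ofReal (A * (β - α)) + ∫⁻ t in Icc α β, ‖Psf g y (1 / h) (N * α) (N * t - N * α)‖ₑ := by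
          rw [lintegral_add_left measurable_const, setLIntegral_const, Real.volume_Icc, ENNReal.ofReal_mul hA.le]
      _ ≤ ENNReal.ofReal (A * (β - α)) + ENNReal.ofReal (289 * A * (β - α)) := by
          gcongr
          have h5 := scale_lint (fun s => ‖Psf g y (1 / h) (N * α) s‖ₑ) N α β hN0
          have h6 := Psf_bound g hp hi y A hA hy hG h hh0 (N * α)
          rw [← hh] at h5
          rw [← h5, show 289 * A * h = N * (289 * A * (β - α)) by rw [hh]; ring, ENNReal.ofReal_mul hN0.le] at h6
          exact (ENNReal.mul_le_mul_iff_right (by simpa using hN0) ENNReal.ofReal_ne_top).1 h6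
      _ = _ := by
          rw [← ENNReal.ofReal_add (by positivity) (by positivity)]; congr 1; ring
  have hint : ∫ t in Icc α β, |stepFun ξ n t - c| = (∫⁻ t in Icc α β, ‖stepFun ξ n t - c‖ₑ).toReal := by
    have := integral_norm_eq_lintegral_enorm (μ := volume.restrict (Icc α β))
      (f := fun t => stepFun ξ n t - c) ((step_meas ξ n).sub_const c).aestronglyMeasurable
    simpa only [Real.norm_eq_abs] using this
  rw [hint]
  exact ENNReal.toReal_le_of_le_ofReal (by positivity) hlin

theorem bmo_good (g : ℝ → ℝ) (hg : Measurable g) (hp : Function.Periodic g (2 * Real.pi))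
    (hi : IntegrableOn g T1) (y A : ℝ) (hA : 0 < A) (hy : y ∈ T1) (hG : Good g y A) (ξ : ℕ → ℝ)
    (hξ : ∀ n : ℕ, 1 ≤ n → pvT1 (fun u => (1 / (2 * Real.pi)) * (Real.cos (n * u) / (2 * Real.tan (u / 2))) * g (y - u)) (ξ n)) :
    bmoSeq (fun k => ξ (k + 1)) ≤ 600 * A := by
  have hL := fun k : ℕ => pv_one g hp hi y _ _ (hξ (k + 1) (by omega))
  set L0 := ξ (0 + 1) - (1 / (2 * Real.pi)) *
        ∫ u in Ioo (-Real.pi) Real.pi, g (y - u) * ((Real.cos (((0 + 1 : ℕ) : ℝ) * u) - 1) * kk u) with hL0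
  have h1 : ∀ k : ℕ, ξ (k + 1) = L0 + (1 / (2 * Real.pi)) *
      ∫ u in Ioo (-Real.pi) Real.pi, g (y - u) * ((Real.cos (((k : ℝ) + 1) * u) - 1) * kk u) := by
    intro k
    have := tendsto_nhds_unique (hL k) (hL 0)
    rw [← hL0] at this
    rw [← this]; push_cast; ring
  unfold bmoSeq
  refine ciSup_le fun n => ?_
  have := bmo_of (stepFun (fun k => ξ (k + 1)) n) (step_int _ n) (290 * A) (9 * A)
    (osc_bound g hp hi y A hA hy hG L0 _ h1 n) (by
      rw [step_mean]
      exact mean_bound g hg hp hi y A hA hy hG L0 _ (hL 0) h1 n)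
  linarith

theorem rodin1 (g : ℝ → ℝ) (hg : Measurable g) (hp : Function.Periodic g (2 * Real.pi))
    (hi : IntegrableOn g T1) (ξ : ℕ → ℝ → ℝ)
    (hξ : ∀ᵐ y, ∀ n : ℕ, 1 ≤ n → pvT1 (fun u => (1 / (2 * Real.pi)) *
      (Real.cos (n * u) / (2 * Real.tan (u / 2))) * g (y - u)) (ξ n y)) (l : ℝ) (hl : 0 < l) :
    volume {y | y ∈ T1 ∧ l < bmoSeq (fun k => ξ (k + 1) y)} ≤
      ENNReal.ofReal (200000 / l) * ∫⁻ t in T1, ‖g t‖ₑ := by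
  set A := l / 600 with hA
  have hA0 : 0 < A := by positivity
  have hpe : Function.Periodic (fun t => ‖g t‖ₑ) (2 * Real.pi) := fun t => by simp only [hp t]
  have hpp : Function.Periodic (fun t => max (g t) 0) (2 * Real.pi) := fun t => by simp only [hp t]
  have hnp : Function.Periodic (fun t => max (-g t) 0) (2 * Real.pi) := fun t => by simp only [hp t]
  have ip : IntegrableOn (fun t => max (g t) 0) T1 := Integrable.pos_part hi
  have im : IntegrableOn (fun t => max (-g t) 0) T1 := Integrable.neg_part hi
  have hci := cut_int _ hpe
  have hfin : ∫⁻ t in T1, ‖g t‖ₑ ≠ ⊤ := hi.hasFiniteIntegral.ne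
  obtain ⟨E, hE, hEy⟩ := rodin_core (cut fun t => ‖g t‖ₑ) (cut_meas _ hg.enorm) (by
    rw [hci]; exact ENNReal.mul_ne_top (by simp) hfin) A hA0
  rw [hci] at hE
  have w1 := weak_conj _ hpp ip (fun t => le_max_right _ _) A hA0
  have w2 := weak_conj _ hnp im (fun t => le_max_right _ _) A hA0
  set S1 := {θ : ℝ | θ ∈ T1 ∧ ∃ r, 1 / 2 ≤ r ∧ r < 1 ∧ A ≤ ‖Fg (fun t => max (g t) 0) (circleMap 0 r θ)‖}
  set S2 := {θ : ℝ | θ ∈ T1 ∧ ∃ r, 1 / 2 ≤ r ∧ r < 1 ∧ A ≤ ‖Fg (fun t => max (-g t) 0) (circleMap 0 r θ)‖}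
  have hdec : ∀ r, 1 / 2 ≤ r → r < 1 → ∀ θ, (Fg g (circleMap 0 r θ)).im = (Fg (fun t => max (g t) 0) (circleMap 0 r θ)).im -
      (Fg (fun t => max (-g t) 0) (circleMap 0 r θ)).im := by
    intro r hr hr1 θ
    have hr0 : 0 ≤ r := by linarith
    rw [Fg_im g hp hi r θ hr0 hr1, Fg_im _ hpp ip r θ hr0 hr1, Fg_im _ hnp im r θ hr0 hr1, ← mul_sub,
      ← integral_sub (mul_ker_int _ hpp ip θ _ (Qk_cont r hr0 hr1)) (mul_ker_int _ hnp im θ _ (Qk_cont r hr0 hr1))]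
    congr 2
    ext u
    rw [← sub_mul]
    congr 1
    have := max_zero_sub_max_neg_zero_eq_self (g (θ - u))
    linarith
  set Z := {y : ℝ | ¬ ∀ n : ℕ, 1 ≤ n → pvT1 (fun u => (1 / (2 * Real.pi)) *
      (Real.cos (n * u) / (2 * Real.tan (u / 2))) * g (y - u)) (ξ n y)}
  have hZ : volume Z = 0 := hξ
  have hsub : {y | y ∈ T1 ∧ l < bmoSeq (fun k => ξ (k + 1) y)} ⊆ E ∪ S1 ∪ S2 ∪ Z := by
    rintro y ⟨hy, hly⟩
    by_contra hcon
    simp only [mem_union, not_or] at hcon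
    obtain ⟨⟨⟨c1, c2⟩, c3⟩, c4⟩ := hcon
    have hxy := not_not.1 c4
    have hG : Good g y A := by
      refine ⟨(hEy y c1).1, (hEy y c1).2, fun r hr hr1 => ?_⟩
      rw [hdec r hr hr1]
      have d1 : ‖Fg (fun t => max (g t) 0) (circleMap 0 r y)‖ < A := by
        by_contra hh; exact c2 ⟨hy, r, hr, hr1, not_lt.1 hh⟩
      have d2 : ‖Fg (fun t => max (-g t) 0) (circleMap 0 r y)‖ < A := by
        by_contra hh; exact c3 ⟨hy, r, hr, hr1, not_lt.1 hh⟩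
      refine (abs_sub _ _).trans ?_
      have := Complex.abs_im_le_norm (Fg (fun t => max (g t) 0) (circleMap 0 r y))
      have := Complex.abs_im_le_norm (Fg (fun t => max (-g t) 0) (circleMap 0 r y))
      linarith
    have := bmo_good g hg hp hi y A hA0 hy hG (fun n => ξ n y) hxy
    rw [hA] at this
    linarith
  have le1 : ∫⁻ t in T1, ENNReal.ofReal (max (g t) 0) ≤ ∫⁻ t in T1, ‖g t‖ₑ := by
    refine lintegral_mono fun t => ?_
    rw [← ofReal_norm]
    exact ENNReal.ofReal_le_ofReal (max_le (le_abs_self _) (abs_nonneg _))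
  have le2 : ∫⁻ t in T1, ENNReal.ofReal (max (-g t) 0) ≤ ∫⁻ t in T1, ‖g t‖ₑ := by
    refine lintegral_mono fun t => ?_
    rw [← ofReal_norm]
    exact ENNReal.ofReal_le_ofReal (max_le (neg_le_abs _) (abs_nonneg _))
  calc _ ≤ volume (E ∪ S1 ∪ S2 ∪ Z) := measure_mono hsub
    _ ≤ volume E + volume S1 + volume S2 + volume Z := by
        refine (measure_union_le _ _).trans ?_
        gcongr
        refine (measure_union_le _ _).trans ?_
        gcongr
        exact measure_union_le _ _
    _ ≤ ENNReal.ofReal (12 / A) * (2 * ∫⁻ t in T1, ‖g t‖ₑ) + ENNReal.ofReal (144 / A) * (∫⁻ t in T1, ‖g t‖ₑ) +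
        ENNReal.ofReal (144 / A) * (∫⁻ t in T1, ‖g t‖ₑ) + 0 := by
        rw [hZ]
        gcongr
        · exact w1.trans (mul_le_mul_right le1 _)
        · exact w2.trans (mul_le_mul_right le2 _)
    _ = ENNReal.ofReal (187200 / l) * ∫⁻ t in T1, ‖g t‖ₑ := by
        rw [add_zero, ← mul_assoc, (by simp : (2:ENNReal) = ENNReal.ofReal 2), ← ENNReal.ofReal_mul (by positivity),
          ← add_mul, ← add_mul, ← ENNReal.ofReal_add (by positivity) (by positivity),
          ← ENNReal.ofReal_add (by positivity) (by positivity)]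
        congr 2
        rw [hA]; field_simp; norm_num
    _ ≤ _ := by
        gcongr
        norm_num

/-- mean oscillation -/
def oscI (S : ℝ → ℝ) (α β : ℝ) : ℝ :=
  (β - α)⁻¹ * ∫ t in Icc α β, |S t - (β - α)⁻¹ * ∫ s in Icc α β, S s|

theorem osc_stab (S R : ℝ → ℝ) (hS : ∀ a b, IntegrableOn S (Icc a b)) (hR : ∀ a b, IntegrableOn R (Icc a b))
    (D : ℝ) (hD : ∀ t, |S t - R t| ≤ D) (α β : ℝ) (hab : α < β) : oscI S α β ≤ oscI R α β + 2 * D := by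
  have hl : 0 < β - α := by linarith
  have hv : volume.real (Icc α β) = β - α := by
    rw [measureReal_def, Real.volume_Icc, ENNReal.toReal_ofReal hl.le]
  have hmean : |(β - α)⁻¹ * (∫ s in Icc α β, S s) - (β - α)⁻¹ * ∫ s in Icc α β, R s| ≤ D := by
    rw [← mul_sub, ← integral_sub (hS α β) (hR α β), abs_mul, abs_of_pos (inv_pos.2 hl),
      inv_mul_le_iff₀ hl, ← Real.norm_eq_abs]
    refine (norm_setIntegral_le_of_norm_le_const (by simp) (fun t _ => hD t)).trans ?_
    rw [hv]; linarith
  unfold oscI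
  set mS := (β - α)⁻¹ * ∫ s in Icc α β, S s
  set mR := (β - α)⁻¹ * ∫ s in Icc α β, R s
  have ic : ∀ c : ℝ, IntegrableOn (fun _ => c) (Icc α β) := fun c => integrableOn_const (by simp)
  have iS : IntegrableOn (fun t => |S t - mS|) (Icc α β) := ((hS α β).sub (ic mS)).abs
  have iR : IntegrableOn (fun t => |R t - mR|) (Icc α β) := ((hR α β).sub (ic mR)).abs
  have := integral_mono iS (iR.add (ic (2 * D))) (fun t => by
    simp only [Pi.add_apply]
    have h1 := hD t
    have e : S t - mS = (R t - mR) + (S t - R t) + -(mS - mR) := by ring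
    rw [e]
    refine (abs_add_three _ _ _).trans ?_
    rw [abs_neg]; linarith)
  rw [integral_add' iR (ic _), setIntegral_const, hv, smul_eq_mul] at this
  have h2 := mul_le_mul_of_nonneg_left this (inv_pos.2 hl).le
  rw [mul_add, inv_mul_cancel_left₀ hl.ne'] at h2
  exact h2

theorem osc_bddAbove (R : ℝ → ℝ) (hR : ∀ a b, IntegrableOn R (Icc a b)) (M : ℝ) (hM : ∀ t, |R t| ≤ M)
    (α β : ℝ) (hab : α < β) : oscI R α β ≤ 2 * M := by
  have := osc_stab R (fun _ => 0) hR (fun a b => integrableOn_const (by simp)) M (by simpa using hM) α β hab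
  simpa [oscI] using this

theorem bmoNorm_le (S R : ℝ → ℝ) (hS : ∀ a b, IntegrableOn S (Icc a b)) (hR : ∀ a b, IntegrableOn R (Icc a b))
    (D : ℝ) (hD : ∀ t, |S t - R t| ≤ D) (M : ℝ) (hM : ∀ t, |R t| ≤ M) : bmoNorm S ≤ bmoNorm R + 3 * D := by
  have hne : Nonempty {p : ℝ × ℝ // 0 ≤ p.1 ∧ p.1 < p.2 ∧ p.2 ≤ 1} := ⟨⟨(0, 1), by norm_num⟩⟩
  have h1 : (⨆ I : {p : ℝ × ℝ // 0 ≤ p.1 ∧ p.1 < p.2 ∧ p.2 ≤ 1}, oscI S I.1.1 I.1.2) ≤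
      (⨆ I : {p : ℝ × ℝ // 0 ≤ p.1 ∧ p.1 < p.2 ∧ p.2 ≤ 1}, oscI R I.1.1 I.1.2) + 2 * D := by
    refine ciSup_le fun I => (osc_stab S R hS hR D hD _ _ I.2.2.1).trans ?_
    gcongr
    refine le_ciSup (f := fun I : {p : ℝ × ℝ // 0 ≤ p.1 ∧ p.1 < p.2 ∧ p.2 ≤ 1} => oscI R I.1.1 I.1.2) ?_ I
    refine ⟨2 * M, ?_⟩
    rintro _ ⟨J, rfl⟩
    exact osc_bddAbove R hR M hM _ _ J.2.2.1
  have h2 : |∫ t in Icc (0:ℝ) 1, S t| ≤ |∫ t in Icc (0:ℝ) 1, R t| + D := by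
    have : |(∫ t in Icc (0:ℝ) 1, S t) - ∫ t in Icc (0:ℝ) 1, R t| ≤ D := by
      rw [← integral_sub (hS 0 1) (hR 0 1), ← Real.norm_eq_abs]
      refine (norm_setIntegral_le_of_norm_le_const (by simp) (fun t _ => hD t)).trans ?_
      simp
    have h3 := abs_sub_abs_le_abs_sub (∫ t in Icc (0:ℝ) 1, S t) (∫ t in Icc (0:ℝ) 1, R t)
    linarith
  change (⨆ I : {p : ℝ × ℝ // 0 ≤ p.1 ∧ p.1 < p.2 ∧ p.2 ≤ 1}, oscI S I.1.1 I.1.2) + _ ≤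
    (⨆ I : {p : ℝ × ℝ // 0 ≤ p.1 ∧ p.1 < p.2 ∧ p.2 ≤ 1}, oscI R I.1.1 I.1.2) + _ + _
  linarith

theorem bmo_step_le (ξ η : ℕ → ℝ) (n : ℕ) : bmoNorm (stepFun ξ n) ≤ bmoNorm (stepFun η n) +
    3 * ∑ k ∈ Finset.range (n + 1), |ξ k - η k| := by
  refine bmoNorm_le _ _ (step_int ξ n) (step_int η n) _ (fun t => ?_) _ (step_bdd η n)
  have : stepFun ξ n t - stepFun η n t = stepFun (fun k => ξ k - η k) n t := by
    unfold stepFun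
    rw [← Finset.sum_sub_distrib]
    refine Finset.sum_congr rfl fun k _ => ?_
    simp only [indicator]; split_ifs <;> simp
  rw [this]
  exact step_bdd _ n t

theorem bmo_step_cont (n : ℕ) : Continuous fun ξ : ℕ → ℝ => bmoNorm (stepFun ξ n) := by
  rw [continuous_iff_continuousAt]
  intro η
  refine tendsto_iff_dist_tendsto_zero.2 ?_
  have hc : Continuous fun ξ : ℕ → ℝ => 3 * ∑ k ∈ Finset.range (n + 1), |ξ k - η k| := by fun_prop
  have h0 := hc.tendsto η
  simp only [sub_self, abs_zero, Finset.sum_const_zero, mul_zero] at h0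
  refine squeeze_zero (fun _ => dist_nonneg) (fun ξ => ?_) h0
  rw [Real.dist_eq, abs_le]
  have h1 := bmo_step_le ξ η n
  have h2 := bmo_step_le η ξ n
  have e : ∑ k ∈ Finset.range (n + 1), |η k - ξ k| = ∑ k ∈ Finset.range (n + 1), |ξ k - η k| :=
    Finset.sum_congr rfl fun k _ => abs_sub_comm _ _
  rw [e] at h2
  constructor <;> linarith

theorem bmoSeq_meas {X : Type*} [MeasurableSpace X] (J : ℕ → X → ℝ) (hJ : ∀ n, Measurable (J n)) :
    Measurable fun p => bmoSeq fun k => J (k + 1) p := by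
  unfold bmoSeq
  refine Measurable.iSup fun n => ?_
  exact (bmo_step_cont n).measurable.comp (measurable_pi_lambda _ fun k => hJ (k + 1))

/-- the pv set along a sequence -/
theorem pv_seq (φ : ℝ → ℝ) (L : ℝ) (h : pvT1 φ L) :
    limUnder atTop (fun m : ℕ => ∫ t in {t : ℝ | 1 / ((m : ℝ) + 1) < |t| ∧ |t| < Real.pi}, φ t) = L := by
  refine Tendsto.limUnder_eq (h.comp ?_)
  refine tendsto_nhdsWithin_iff.2 ⟨tendsto_one_div_add_atTop_nhds_zero_nat, Eventually.of_forall fun m => ?_⟩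
  simp only [mem_Ioi]; positivity

theorem pvlim_meas (Φ : (ℝ × ℝ) × ℝ → ℝ) (hΦ : Measurable Φ) : Measurable fun p : ℝ × ℝ =>
    limUnder atTop (fun m : ℕ => ∫ t in {t : ℝ | 1 / ((m : ℝ) + 1) < |t| ∧ |t| < Real.pi}, Φ (p, t)) :=
  (StronglyMeasurable.limUnder fun _ => hΦ.stronglyMeasurable.integral_prod_right').measurable

/-- inner kernel -/
def inK (f : ℝ × ℝ → ℝ) (p : ℝ × ℝ) (v : ℝ) : ℝ :=
  (1 / Real.pi) * (f (p.1 + v, p.2 + v) / (2 * Real.tan (v / 2)))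

/-- measurable version of the inner principal value -/
def GG (f : ℝ × ℝ → ℝ) (p : ℝ × ℝ) : ℝ :=
  limUnder atTop (fun m : ℕ => ∫ t in {t : ℝ | 1 / ((m : ℝ) + 1) < |t| ∧ |t| < Real.pi}, inK f p t)

theorem tan_meas : Measurable Real.tan := by
  have : Real.tan = fun x => Real.sin x / Real.cos x := by ext x; exact Real.tan_eq_sin_div_cos x
  rw [this]; fun_prop

theorem GG_meas (f : ℝ × ℝ → ℝ) (hf : Measurable f) : Measurable (GG f) := by
  refine pvlim_meas (fun w => inK f w.1 w.2) ?_
  unfold inK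
  have := tan_meas
  fun_prop

theorem GG_per (f : ℝ × ℝ → ℝ) (hp : Biperiodic f) (x z : ℝ) :
    GG f (x, z + 2 * Real.pi) = GG f (x, z) := by
  have : inK f (x, z + 2 * Real.pi) = inK f (x, z) := by
    ext v
    unfold inK
    simp only
    rw [← (hp (x + v) (z + v)).2]
    congr 4; ring
  unfold GG; rw [this]

/-- the shear change of variables -/
theorem shear (Φ : ℝ × ℝ → ℝ≥0∞) (hΦ : Measurable Φ) (hp : ∀ x z, Φ (x, z + 2 * Real.pi) = Φ (x, z)) :
    ∫⁻ p in T2, Φ p = ∫⁻ d in Ioo (-Real.pi) Real.pi, ∫⁻ t in T1, Φ (t, t - d) := by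
  rw [T2, Measure.volume_eq_prod, ← Measure.prod_restrict, lintegral_prod _ hΦ.aemeasurable]
  rw [lintegral_lintegral_swap (f := fun d t => Φ (t, t - d))]
  · refine lintegral_congr fun x => ?_
    exact (per_sub (fun z => Φ (x, z)) (fun z => hp x z) x).symm
  · have : Measurable fun q : ℝ × ℝ => Φ (q.2, q.2 - q.1) := by fun_prop
    exact this.aemeasurable

theorem shear_mp : MeasurePreserving (fun q : ℝ × ℝ => (q.2, q.2 - q.1)) := by
  have h1 : MeasurePreserving (Prod.swap : ℝ × ℝ → ℝ × ℝ) := Measure.measurePreserving_swap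
  have h2 : MeasurePreserving (Prod.map id Neg.neg : ℝ × ℝ → ℝ × ℝ) :=
    (MeasurePreserving.id volume).prod (Measure.measurePreserving_neg volume)
  have h3 : MeasurePreserving (fun z : ℝ × ℝ => (z.1, z.1 + z.2)) := measurePreserving_prod_add volume volume
  have := h3.comp (h2.comp h1)
  convert this using 1
  ext q <;> simp [sub_eq_add_neg]

theorem T1_vol : volume T1 = ENNReal.ofReal (2 * Real.pi) := by
  rw [T1, Real.volume_Ico]; congr 1; ring

theorem G_bound (f : ℝ × ℝ → ℝ) (hf : Measurable f) (hp : Biperiodic f) (hi : IntegrableOn f T2)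
    (hL : IntegrableOn (fun p => |f p| * logPlus |f p|) T2)
    (hpv : ∀ᵐ p, pvT1 (inK f p) (GG f p)) :
    ∫⁻ p in T2, ‖GG f p‖ₑ ≤ ENNReal.ofReal (4200 * (1 + ∫ p in T2, |f p| * logPlus |f p|)) := by
  have hpi := Real.pi_lt_d2
  have hpi0 := Real.pi_pos
  have hmL : Measurable fun p => |f p| * logPlus |f p| := hf.abs.mul (logPlus_meas.comp hf.abs)
  have hL0 : ∀ p, 0 ≤ |f p| * logPlus |f p| := fun p => mul_nonneg (abs_nonneg _) (logPlus_nonneg _)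
  have hper2 : ∀ x z, f (x, z + 2 * Real.pi) = f (x, z) := fun x z => (hp x z).2
  have s1 := shear (fun p => ‖f p‖ₑ) hf.enorm (fun x z => by simp only [hper2])
  have s2 := shear (fun p => ENNReal.ofReal (|f p| * logPlus |f p|)) hmL.ennreal_ofReal
    (fun x z => by simp only [hper2])
  have s3 := shear (fun p => ‖GG f p‖ₑ) (GG_meas f hf).enorm (fun x z => by simp only [GG_per f hp])
  have e2 : ∫⁻ p in T2, ENNReal.ofReal (|f p| * logPlus |f p|) =
      ENNReal.ofReal (∫ p in T2, |f p| * logPlus |f p|) :=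
    (ofReal_integral_eq_lintegral_ofReal hL (Eventually.of_forall hL0)).symm
  have mm : ∀ Φ : ℝ × ℝ → ℝ≥0∞, Measurable Φ → Measurable fun d => ∫⁻ t in T1, Φ (t, t - d) := by
    intro Φ hΦ
    refine Measurable.lintegral_prod_right' (f := fun q : ℝ × ℝ => Φ (q.2, q.2 - q.1)) ?_
    fun_prop
  have a1 : ∀ᵐ d ∂(volume.restrict (Ioo (-Real.pi) Real.pi)), ∫⁻ t in T1, ‖f (t, t - d)‖ₑ < ⊤ :=
    ae_lt_top (mm _ hf.enorm) (by rw [← s1]; exact hi.hasFiniteIntegral.ne)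
  have a2 : ∀ᵐ d ∂(volume.restrict (Ioo (-Real.pi) Real.pi)),
      ∫⁻ t in T1, ENNReal.ofReal (|f (t, t - d)| * logPlus |f (t, t - d)|) < ⊤ :=
    ae_lt_top (mm _ hmL.ennreal_ofReal) (by rw [← s2, e2]; exact ENNReal.ofReal_ne_top)
  have a3 : ∀ᵐ d : ℝ, ∀ᵐ t : ℝ, pvT1 (inK f (t, t - d)) (GG f (t, t - d)) :=
    Measure.ae_ae_of_ae_prod (shear_mp.quasiMeasurePreserving.ae hpv)
  rw [s3]
  calc _ ≤ ∫⁻ d in Ioo (-Real.pi) Real.pi, (ENNReal.ofReal 600 + ENNReal.ofReal 600 *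
        ∫⁻ t in T1, ENNReal.ofReal (|f (t, t - d)| * logPlus |f (t, t - d)|)) := by
        refine lintegral_mono_ae ?_
        filter_upwards [a1, a2, ae_restrict_of_ae a3] with d b1 b2 b3
        have hm : Measurable fun t => f (t, t - d) := by fun_prop
        have hpd : Function.Periodic (fun t => f (t, t - d)) (2 * Real.pi) := by
          intro t
          simp only
          rw [show t + 2 * Real.pi - d = (t - d) + 2 * Real.pi by ring, hper2]
          exact (hp t (t - d)).1
        have i1 : IntegrableOn (fun t => f (t, t - d)) T1 := ⟨hm.aestronglyMeasurable, b1⟩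
        have mL' : Measurable fun t => |f (t, t - d)| * logPlus |f (t, t - d)| :=
          hm.abs.mul (logPlus_meas.comp hm.abs)
        have i2 : IntegrableOn (fun t => |f (t, t - d)| * logPlus |f (t, t - d)|) T1 := by
          refine ⟨mL'.aestronglyMeasurable, ?_⟩
          rw [hasFiniteIntegral_iff_ofReal (Eventually.of_forall fun t => hL0 _)]
          exact b2
        have := zyg (fun t => f (t, t - d)) hm hpd i1 i2 (fun t => GG f (t, t - d)) (by
          filter_upwards [b3] with x hx
          convert hx using 2 with v
          unfold inK
          simp only
          rw [show x + v - d = x - d + v by ring])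
        refine this.trans (le_of_eq ?_)
        have e : ENNReal.ofReal (∫ t in T1, |f (t, t - d)| * logPlus |f (t, t - d)|) = _ :=
          ofReal_integral_eq_lintegral_ofReal i2 (Eventually.of_forall fun t => hL0 _)
        have hn : 0 ≤ ∫ t in T1, |f (t, t - d)| * logPlus |f (t, t - d)| := integral_nonneg fun t => hL0 _
        rw [mul_add, mul_one, ENNReal.ofReal_add (by norm_num) (by positivity), ENNReal.ofReal_mul (by norm_num), e]
    _ = ENNReal.ofReal 600 * ENNReal.ofReal (2 * Real.pi) + ENNReal.ofReal 600 *
        ENNReal.ofReal (∫ p in T2, |f p| * logPlus |f p|) := by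
        rw [lintegral_add_left measurable_const, lintegral_const_mul _ (mm _ hmL.ennreal_ofReal), ← s2, e2,
          setLIntegral_const, Real.volume_Ioo, show Real.pi - -Real.pi = 2 * Real.pi by ring]
    _ ≤ _ := by
        have hn : 0 ≤ ∫ p in T2, |f p| * logPlus |f p| := integral_nonneg hL0
        rw [← ENNReal.ofReal_mul (by norm_num), ← ENNReal.ofReal_mul (by norm_num),
          ← ENNReal.ofReal_add (by positivity) (by positivity)]
        refine ENNReal.ofReal_le_ofReal ?_
        nlinarith

theorem main_thm :
    ∃ c : ℝ, 0 < c ∧ ∀ f : ℝ × ℝ → ℝ, Measurable f → Biperiodic f →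
      IntegrableOn f T2 → IntegrableOn (fun p => |f p| * logPlus |f p|) T2 →
      ∀ F : ℝ × ℝ → ℝ → ℝ, ∀ I2 : ℕ → ℝ × ℝ → ℝ,
        (∀ᵐ w : (ℝ × ℝ) × ℝ,
          pvT1 (fun v => (1 / Real.pi) * (f (w.1.1 + v, w.1.2 + v - w.2) /
              (2 * Real.tan (v / 2)))) (F w.1 w.2)) →
        (∀ n : ℕ, 1 ≤ n → ∀ᵐ p : ℝ × ℝ,
          pvT1 (fun u => (1 / (2 * Real.pi)) *
              (Real.cos ((n : ℝ) * u) / (2 * Real.tan (u / 2))) * F p u) (I2 n p)) →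
        ∀ lam : ℝ, 0 < lam →
          volume {p : ℝ × ℝ | p ∈ T2 ∧ lam < bmoSeq (fun k => I2 (k + 1) p)} ≤
            ENNReal.ofReal ((c / lam) * (1 + ∫ p in T2, |f p| * logPlus |f p|)) := by
  refine ⟨200000 * 4200, by norm_num, ?_⟩
  intro f hf hp hi hL F I2 hF hI lam hlam
  have hL0 : ∀ p, 0 ≤ |f p| * logPlus |f p| := fun p => mul_nonneg (abs_nonneg _) (logPlus_nonneg _)
  have hF' : ∀ᵐ w : (ℝ × ℝ) × ℝ, pvT1 (inK f (w.1.1, w.1.2 - w.2)) (F w.1 w.2) := by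
    filter_upwards [hF] with w hw
    convert hw using 2 with v
    unfold inK
    simp only
    rw [show w.1.2 + v - w.2 = w.1.2 - w.2 + v by ring]
  -- existence of the inner pv almost everywhere
  have hpv : ∀ᵐ p, pvT1 (inK f p) (GG f p) := by
    have h1 : ∀ᵐ w : ℝ × (ℝ × ℝ), pvT1 (inK f (w.2.1, w.2.2 - w.1)) (F w.2 w.1) :=
      (Measure.measurePreserving_swap (μ := (volume : Measure ℝ))
        (ν := (volume : Measure (ℝ × ℝ)))).quasiMeasurePreserving.ae hF'
    have h2 := Measure.ae_ae_of_ae_prod h1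
    obtain ⟨u, hu⟩ := h2.exists
    have h3 := (measurePreserving_add_right (volume : Measure (ℝ × ℝ)) (0, u)).quasiMeasurePreserving.ae hu
    filter_upwards [h3] with p hp'
    simp only [Prod.fst_add, Prod.snd_add, add_zero, add_sub_cancel_right, Prod.mk.eta] at hp'
    have : GG f p = F (p + (0, u)) u := pv_seq _ _ hp'
    rw [this]; exact hp'
  have hGB := G_bound f hf hp hi hL hpv
  have hGm := GG_meas f hf
  -- the outer pv
  set g : ℝ → ℝ → ℝ := fun x z => GG f (x, z) with hg
  have hout : ∀ᵐ p : ℝ × ℝ, ∀ n : ℕ, 1 ≤ n → pvT1 (fun u => (1 / (2 * Real.pi)) *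
      (Real.cos ((n : ℝ) * u) / (2 * Real.tan (u / 2))) * g p.1 (p.2 - u)) (I2 n p) := by
    rw [ae_all_iff]
    intro n
    by_cases hn : 1 ≤ n
    · have h2 : ∀ᵐ p : ℝ × ℝ, ∀ᵐ u : ℝ, pvT1 (inK f (p.1, p.2 - u)) (F p u) := Measure.ae_ae_of_ae_prod hF'
      filter_upwards [hI n hn, h2] with p h3 h4 _
      unfold pvT1 at h3 ⊢
      convert h3 using 2 with ε
      refine integral_congr_ae (ae_restrict_of_ae ?_)
      filter_upwards [h4] with u hu
      have : GG f (p.1, p.2 - u) = F p u := pv_seq _ _ hu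
      simp only [hg, this]
    · exact Eventually.of_forall fun p h => absurd h hn
  -- measurable version
  set J : ℕ → ℝ × ℝ → ℝ := fun n p => limUnder atTop (fun m : ℕ =>
    ∫ u in {t : ℝ | 1 / ((m : ℝ) + 1) < |t| ∧ |t| < Real.pi}, (1 / (2 * Real.pi)) *
      (Real.cos ((n : ℝ) * u) / (2 * Real.tan (u / 2))) * g p.1 (p.2 - u)) with hJ
  have hJm : ∀ n, Measurable (J n) := by
    intro n
    refine pvlim_meas (fun w => (1 / (2 * Real.pi)) *
      (Real.cos ((n : ℝ) * w.2) / (2 * Real.tan (w.2 / 2))) * g w.1.1 (w.1.2 - w.2)) ?_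
    have := tan_meas
    simp only [hg]
    fun_prop
  have hJI : ∀ᵐ p : ℝ × ℝ, ∀ n : ℕ, 1 ≤ n → J n p = I2 n p := by
    filter_upwards [hout] with p h n hn
    exact pv_seq _ _ (h n hn)
  have hJpv : ∀ᵐ p : ℝ × ℝ, ∀ n : ℕ, 1 ≤ n → pvT1 (fun u => (1 / (2 * Real.pi)) *
      (Real.cos ((n : ℝ) * u) / (2 * Real.tan (u / 2))) * g p.1 (p.2 - u)) (J n p) := by
    filter_upwards [hout, hJI] with p h h' n hn
    rw [h' n hn]; exact h n hn
  have hT1m : MeasurableSet T1 := measurableSet_Ico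
  have hT2m : MeasurableSet T2 := hT1m.prod hT1m
  set S' := {p : ℝ × ℝ | p ∈ T2 ∧ lam < bmoSeq (fun k => J (k + 1) p)} with hS'
  have hS'm : MeasurableSet S' := hT2m.inter (measurableSet_lt measurable_const (bmoSeq_meas J hJm))
  have hSS : volume {p : ℝ × ℝ | p ∈ T2 ∧ lam < bmoSeq (fun k => I2 (k + 1) p)} ≤ volume S' := by
    refine measure_mono_ae ?_
    filter_upwards [hJI] with p h hpS
    have e : (fun k => J (k + 1) p) = fun k => I2 (k + 1) p := by
      ext k; exact h (k + 1) (by omega)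
    refine ⟨hpS.1, ?_⟩
    rw [e]; exact hpS.2
  refine hSS.trans ?_
  have e0 : ∫⁻ p in T2, ‖GG f p‖ₑ = ∫⁻ x in T1, ∫⁻ z in T1, ‖g x z‖ₑ := by
    rw [T2, Measure.volume_eq_prod, ← Measure.prod_restrict, lintegral_prod _ hGm.enorm.aemeasurable]
  have hfin : ∀ᵐ x ∂(volume.restrict T1), ∫⁻ z in T1, ‖g x z‖ₑ < ⊤ := by
    refine ae_lt_top ?_ ?_
    · exact Measurable.lintegral_prod_right' hGm.enorm
    · rw [← e0]
      exact ne_top_of_le_ne_top ENNReal.ofReal_ne_top hGB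
  have hslice : ∀ᵐ x : ℝ, ∀ᵐ y : ℝ, ∀ n : ℕ, 1 ≤ n → pvT1 (fun u => (1 / (2 * Real.pi)) *
      (Real.cos ((n : ℝ) * u) / (2 * Real.tan (u / 2))) * g x (y - u)) (J n (x, y)) :=
    Measure.ae_ae_of_ae_prod hJpv
  calc volume S' = ∫⁻ x, volume (Prod.mk x ⁻¹' S') := by
        rw [Measure.volume_eq_prod, Measure.prod_apply hS'm]
    _ = ∫⁻ x in T1, volume (Prod.mk x ⁻¹' S') := by
        rw [← lintegral_indicator hT1m]
        refine lintegral_congr fun x => ?_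
        by_cases hx : x ∈ T1
        · rw [indicator_of_mem hx]
        · rw [indicator_of_notMem hx]
          have : Prod.mk x ⁻¹' S' = ∅ := by
            ext y
            simp only [mem_preimage, mem_empty_iff_false, iff_false]
            intro h
            exact hx h.1.1
          rw [this, measure_empty]
    _ ≤ ∫⁻ x in T1, ENNReal.ofReal (200000 / lam) * ∫⁻ z in T1, ‖g x z‖ₑ := by
        refine lintegral_mono_ae ?_
        filter_upwards [hfin, ae_restrict_of_ae hslice] with x h1 h2
        have hgm : Measurable (g x) := by simp only [hg]; fun_prop
        refine le_trans (measure_mono ?_) (rodin1 (g x) hgm (fun z => GG_per f hp x z)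
          ⟨hgm.aestronglyMeasurable, h1⟩ (fun n y => J n (x, y)) h2 lam hlam)
        intro y hy
        exact ⟨hy.1.2, hy.2⟩
    _ = ENNReal.ofReal (200000 / lam) * ∫⁻ p in T2, ‖GG f p‖ₑ := by
        rw [lintegral_const_mul _ (Measurable.lintegral_prod_right' hGm.enorm), e0]
    _ ≤ ENNReal.ofReal (200000 / lam) * ENNReal.ofReal (4200 * (1 + ∫ p in T2, |f p| * logPlus |f p|)) := by
        gcongr
    _ = _ := by
        rw [← ENNReal.ofReal_mul (by positivity)]
        congr 1
        ring

/-- for `f ∈ L log L(𝕋²)` and the iterated principal values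
`I^{(2)}_n(x,y,f) = p.v. (1/2π) ∫_𝕋 [cos(nu)/(2 tan(u/2))] ·
  (p.v. (1/π) ∫_𝕋 f(x+ν, y+ν-u)/(2 tan(ν/2)) dν) du` (`n ≥ 1`, a.e. `(x,y)`),
one has the weak type estimate
`|{(x,y) ∈ 𝕋² : bmo[I^{(2)}_n(x,y,f)] > λ}| ≤ (c/λ)(1 + ∬ |f| log⁺|f|)`
for an absolute constant `c > 0`. -/
theorem bmo_weak_type_I2 :
    ∃ c : ℝ, 0 < c ∧ ∀ f : ℝ × ℝ → ℝ, Measurable f → Biperiodic f →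
      IntegrableOn f T2 → IntegrableOn (fun p => |f p| * logPlus |f p|) T2 →
      ∀ F : ℝ × ℝ → ℝ → ℝ, ∀ I2 : ℕ → ℝ × ℝ → ℝ,
        (∀ᵐ w : (ℝ × ℝ) × ℝ,
          pvT1 (fun v => (1 / Real.pi) * (f (w.1.1 + v, w.1.2 + v - w.2) /
              (2 * Real.tan (v / 2)))) (F w.1 w.2)) →
        (∀ n : ℕ, 1 ≤ n → ∀ᵐ p : ℝ × ℝ,
          pvT1 (fun u => (1 / (2 * Real.pi)) *
              (Real.cos ((n : ℝ) * u) / (2 * Real.tan (u / 2))) * F p u) (I2 n p)) →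
        ∀ lam : ℝ, 0 < lam →
          volume {p : ℝ × ℝ | p ∈ T2 ∧ lam < bmoSeq (fun k => I2 (k + 1) p)} ≤
            ENNReal.ofReal ((c / lam) * (1 + ∫ p in T2, |f p| * logPlus |f p|)) := by
  exact main_thm
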